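/- arXiv:2108.05496 — 2 statements merged into one kernel-verified Lean document; each statement's English description precedes it below -/
import Mathlib

section
/- Suppose L = ℚ(α). If n is a positive integer coprime to η·D_f, then the map v ↦ (α − v, n) (the ideal of R generated by α − v and n) is a bijection from the set of roots {v : 0 ≤ v < n, f(v) ≡ 0 (mod n)} onto the set S_η(n) of degree-one ideals of R of absolute norm n, and its inverse is 𝔞 ↦ α(𝔞). -/
open NumberField Filter Asymptotics Topology

set_option maxHeartbeats 1000000
set_option synthInstance.maxHeartbeats 400000

noncomputable def Rring (L : Type) [Field L] [NumberField L] (η : ℕ) : Subalgebra (𝓞 L) L :=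
  Algebra.adjoin (𝓞 L) {((η : L))⁻¹}

def DegOne {L : Type} [Field L] [NumberField L] {η : ℕ} (𝔞 : Ideal ↥(Rring L η)) : Prop :=
  𝔞 ≠ ⊥ ∧ Function.Surjective ⇑(Int.castRingHom (↥(Rring L η) ⧸ 𝔞))

noncomputable def idealNorm {L : Type} [Field L] [NumberField L] {η : ℕ}
    (𝔞 : Ideal ↥(Rring L η)) : ℕ :=
  Nat.card (↥(Rring L η) ⧸ 𝔞)

def Sset (L : Type) [Field L] [NumberField L] (η n : ℕ) : Set (Ideal ↥(Rring L η)) :=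
  {𝔞 | DegOne 𝔞 ∧ idealNorm 𝔞 = n}

noncomputable def rho (L : Type) [Field L] [NumberField L] (η n : ℕ) : ℕ :=
  Nat.card ↥(Sset L η n)

noncomputable def rhoSum (L : Type) [Field L] [NumberField L] (η : ℕ)
    (res : Ideal ↥(Rring L η) → ℕ) (h : ℤ) (n : ℕ) : ℂ :=
  ∑ᶠ 𝔞 ∈ Sset L η n, Complex.exp (2 * (Real.pi : ℂ) * Complex.I * (h : ℂ) * (res 𝔞 : ℂ) / (n : ℂ))

def SplitsCompletely (L : Type) [Field L] [NumberField L] (p : ℕ) : Prop :=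
  ∃ s : Finset (Ideal (𝓞 L)), s.card = Module.finrank ℚ L ∧
    (∀ P ∈ s, P.IsPrime ∧ Nat.card (𝓞 L ⧸ P) = p) ∧
    Ideal.span {((p : ℕ) : 𝓞 L)} = ∏ P ∈ s, P

def IsDiscOf (D : ℤ) (f : Polynomial ℤ) : Prop :=
  ∃ g : Fin f.natDegree → ℂ,
    (f.map (Int.castRingHom ℂ)).roots = Multiset.map g Finset.univ.val ∧
    (D : ℂ) = (f.leadingCoeff : ℂ) ^ (2 * f.natDegree - 2) *
      ∏ i : Fin f.natDegree, ∏ j : Fin f.natDegree,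
        (if (i : ℕ) < (j : ℕ) then (g i - g j) ^ 2 else 1)

open scoped Classical in
noncomputable def omegaP (L : Type) [Field L] [NumberField L] (η : ℕ) (Df : ℤ) (n : ℕ) : ℕ :=
  (n.primeFactors.filter (fun p : ℕ => ¬ ((p : ℕ) : ℤ) ∣ (η : ℤ) * Df ∧ SplitsCompletely L p)).card

def UnramifiedPrime (L : Type) [Field L] [NumberField L] (η p : ℕ) : Prop :=
  ¬ ∃ 𝔭 : Ideal ↥(Rring L η), 𝔭.IsPrime ∧ 𝔭 ≠ ⊥ ∧ 𝔭 ^ 2 ∣ Ideal.span {((p : ℕ) : ↥(Rring L η))}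

def RamifiedIdeal {L : Type} [Field L] [NumberField L] {η : ℕ} (𝔭 : Ideal ↥(Rring L η)) : Prop :=
  ∃ p : ℕ, p.Prime ∧ ((p : ℕ) : ↥(Rring L η)) ∈ 𝔭 ∧ 𝔭 ^ 2 ∣ Ideal.span {((p : ℕ) : ↥(Rring L η))}

noncomputable def rhoO (L : Type) [Field L] [NumberField L] (n : ℕ) : ℕ :=
  Nat.card {𝔞 : Ideal (𝓞 L) //
    Function.Surjective ⇑(Int.castRingHom ((𝓞 L) ⧸ 𝔞)) ∧ Nat.card ((𝓞 L) ⧸ 𝔞) = n}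

def IsNormalDigits (n : ℕ) (a : ℕ → ℕ) : Prop :=
  ∀ m : ℕ, 0 < m → ∀ ω : Fin m → ℕ, (∀ i, ω i < n) →
    Filter.Tendsto
      (fun N : ℕ =>
        (((Finset.range N).filter (fun l => ∀ i : Fin m, a (l + (i : ℕ)) = ω i)).card : ℝ) / N)
      Filter.atTop (nhds (1 / (n : ℝ) ^ m))

open scoped Classical


section Stmt1Aux

open Polynomial

lemma aux_card (A : Type) [CommRing A] (n : ℕ) (hs : Function.Surjective (Int.castRingHom A)) :
    Nat.card A = n ↔ ∀ m : ℤ, (m : A) = 0 ↔ (n : ℤ) ∣ m := by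
  have key : ∀ k : ℕ, CharP A k → Nat.card A = k := by
    intro k hk
    have hb : Function.Bijective (ZMod.castHom (dvd_refl k) A) := by
      refine ⟨ZMod.castHom_injective A, fun a => ?_⟩
      obtain ⟨m, rfl⟩ := hs a
      exact ⟨m, by simp⟩
    rw [← Nat.card_congr (Equiv.ofBijective _ hb), Nat.card_zmod]
  constructor
  · intro h m
    have := key (ringChar A) inferInstance
    have h2 : CharP A n := by
      rw [← h, this]; infer_instance
    exact CharP.intCast_eq_zero_iff A n m
  · intro h
    apply key
    exact ⟨fun m => by simpa using (h m).trans (by norm_cast)⟩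

lemma aux_dvd (L : Type) [Field L] [NumberField L] (f g : ℤ[X]) (hp : f.IsPrimitive)
    (hirr : Irreducible f) (a : L) (hf : aeval a f = 0) (hg : aeval a g = 0) : f ∣ g := by
  rw [IsPrimitive.Int.dvd_iff_map_cast_dvd_map_cast _ _ hp]
  have h1 := (IsPrimitive.Int.irreducible_iff_irreducible_map_cast hp).1 hirr
  have h2 := minpoly.eq_of_irreducible (x := a) h1 (by
    rw [← algebraMap_int_eq, aeval_map_algebraMap]; exact hf)
  have h3 : minpoly ℚ a ∣ g.map (Int.castRingHom ℚ) := minpoly.dvd _ _ (by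
    rw [← algebraMap_int_eq, aeval_map_algebraMap]; exact hg)
  rw [← h2] at h3
  exact (dvd_mul_right _ _).trans h3

lemma aux_lc (L : Type) [Field L] [NumberField L] (f : ℤ[X]) (hp : f.IsPrimitive)
    (hirr : Irreducible f) (a : L) (hf : aeval a f = 0) (N : ℤ) (hN : N ≠ 0)
    (hi : IsIntegral ℤ ((N : L) * a)) : ∃ k, f.leadingCoeff ∣ N ^ k := by
  obtain ⟨g, hm, hg⟩ := hi
  have h := aux_dvd L f (g.comp (C N * X)) hp hirr a hf (by
    rw [aeval_comp]; simpa [aeval_def, -eq_intCast] using hg)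
  have h2 := leadingCoeff_dvd_leadingCoeff h
  rw [leadingCoeff_comp (by rw [natDegree_C_mul_X _ hN]; simp), hm.leadingCoeff] at h2
  rw [leadingCoeff_C_mul_X, one_mul] at h2
  exact ⟨_, h2⟩

lemma aux_discr (L : Type) [Field L] [NumberField L] (f : ℤ[X]) (hp : f.IsPrimitive)
    (hirr : Irreducible f) (a : L) (hf : aeval a f = 0)
    (hgen : IntermediateField.adjoin ℚ {a} = ⊤) (D : ℤ)
    (g : Fin f.natDegree → ℂ)
    (hg : (f.map (Int.castRingHom ℂ)).roots = Multiset.map g Finset.univ.val)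
    (hD : (D : ℂ) = (f.leadingCoeff : ℂ) ^ (2 * f.natDegree - 2) *
      ∏ i : Fin f.natDegree, ∏ j : Fin f.natDegree,
        (if (i : ℕ) < (j : ℕ) then (g i - g j) ^ 2 else 1)) :
    ∃ k : ℕ, ∀ x : L, IsIntegral ℤ x →
      ((f.leadingCoeff ^ k * D : ℤ) : L) * x ∈ Algebra.adjoin ℤ {a} := by
  have h1 := (IsPrimitive.Int.irreducible_iff_irreducible_map_cast hp).1 hirr
  have h2 := minpoly.eq_of_irreducible (x := a) h1 (by
    rw [← algebraMap_int_eq, aeval_map_algebraMap]; exact hf)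
  set c := f.leadingCoeff with hc
  have hc0 : c ≠ 0 := leadingCoeff_ne_zero.2 hirr.ne_zero
  have hcL : (c : L) ≠ 0 := by exact_mod_cast hc0
  have hai : IsIntegral ℚ a := Algebra.IsIntegral.isIntegral a
  have hcai : IsIntegral ℤ ((c : L) * a) := by
    have := isIntegral_leadingCoeff_smul f a hf
    simpa [zsmul_eq_mul] using this
  have htop : Algebra.adjoin ℚ {a} = ⊤ := by
    rw [← IntermediateField.adjoin_simple_toSubalgebra_of_isAlgebraic hai.isAlgebraic, hgen]
    rfl
  have htop' : Algebra.adjoin ℚ {(c : L) * a} = ⊤ := by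
    rw [eq_top_iff, ← htop]
    apply Algebra.adjoin_le
    intro y hy
    rw [Set.mem_singleton_iff.1 hy]
    have := Subalgebra.smul_mem _ (Algebra.self_mem_adjoin_singleton ℚ ((c : L) * a)) ((c : ℚ)⁻¹)
    have e : ((c : ℚ)⁻¹) • ((c : L) * a) = a := by
      rw [Algebra.smul_def]; simp; field_simp
    rw [e] at this
    exact this
  let pa := PowerBasis.ofAdjoinEqTop hai htop
  let pb := PowerBasis.ofAdjoinEqTop (hcai.tower_top (A := ℚ)) htop'
  have hpa : pa.gen = a := PowerBasis.ofAdjoinEqTop_gen hai htop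
  have hpb : pb.gen = c * a := PowerBasis.ofAdjoinEqTop_gen (hcai.tower_top (A := ℚ)) htop'
  have hdim : Module.finrank ℚ L = f.natDegree := by
    rw [pa.finrank, ← pa.natDegree_minpoly, hpa, ← h2, natDegree_mul_C, natDegree_map_eq_of_injective]
    · exact Int.cast_injective
    · simpa using h1.ne_zero
  have hdimb : pb.dim = f.natDegree := by rw [← pb.finrank, hdim]
  have hfm : f.map (Int.castRingHom ℂ) = (f.map (Int.castRingHom ℚ)).map (algebraMap ℚ ℂ) := by
    rw [Polynomial.map_map]; congr 1
  have hgr : ∀ i, aeval (g i) (minpoly ℚ pa.gen) = 0 := by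
    intro i
    have : g i ∈ (f.map (Int.castRingHom ℂ)).roots := by
      rw [hg]; exact Multiset.mem_map_of_mem _ (Finset.mem_univ_val i)
    have := isRoot_of_mem_roots this
    rw [hpa, ← h2, map_mul, aeval_def, ← eval_map, ← hfm, this.eq_zero, zero_mul]
  have hnod : Function.Injective g := by
    have : (f.map (Int.castRingHom ℂ)).roots.Nodup := by
      rw [hfm]; exact nodup_roots h1.separable.map
    rw [hg] at this
    intro i j hij
    exact Multiset.inj_on_of_nodup_map this i (Finset.mem_univ_val i) j (Finset.mem_univ_val j) hij
  let e0 : Fin f.natDegree → (L →ₐ[ℚ] ℂ) := fun i => pa.lift (g i) (hgr i)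
  have he0 : ∀ i, e0 i a = g i := by
    intro i
    have := pa.lift_gen (g i) (hgr i)
    rwa [hpa] at this
  have hbij : Function.Bijective (e0 ∘ Fin.cast hdimb) := by
    rw [Fintype.bijective_iff_injective_and_card]
    constructor
    · intro i j hij
      have := congrArg (fun t : L →ₐ[ℚ] ℂ => t a) hij
      simp only [Function.comp, he0] at this
      exact Fin.cast_injective _ (hnod this)
    · rw [AlgHom.card, Fintype.card_fin, pb.finrank]
  have hdisc := Algebra.discr_powerBasis_eq_prod ℚ ℂ pb (Equiv.ofBijective _ hbij)
  have hprod : ∃ k : ℕ, algebraMap ℚ ℂ (Algebra.discr ℚ pb.basis) = (c : ℂ) ^ k *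
      ∏ i : Fin f.natDegree, ∏ j : Fin f.natDegree,
        (if (i : ℕ) < (j : ℕ) then (g i - g j) ^ 2 else 1) := by
    have hp1 : ∀ i j : Fin pb.dim, ((Equiv.ofBijective _ hbij) j pb.gen -
        (Equiv.ofBijective _ hbij) i pb.gen) ^ 2 =
        (c : ℂ) ^ 2 * (g (Fin.cast hdimb i) - g (Fin.cast hdimb j)) ^ 2 := by
      intro i j
      simp only [Equiv.ofBijective_apply, Function.comp, hpb, map_mul, map_intCast, he0]
      ring
    simp only [hp1, Finset.prod_mul_distrib, Finset.prod_const, Finset.prod_pow_eq_pow_sum, ← pow_mul] at hdisc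
    refine ⟨∑ i : Fin pb.dim, 2 * (Finset.Ioi i).card, hdisc.trans ?_⟩
    congr 1
    rw [← Equiv.prod_comp (finCongr hdimb)]
    refine Finset.prod_congr rfl fun i _ => ?_
    rw [← Equiv.prod_comp (finCongr hdimb), ← Finset.prod_filter]
    refine Finset.prod_congr ?_ fun j _ => rfl
    ext j; simp
  obtain ⟨k, hk⟩ := hprod
  refine ⟨k, fun x hx => ?_⟩
  have hmem := Algebra.discr_mul_isIntegral_mem_adjoin ℚ (R := ℤ) (B := pb) (by rw [hpb]; exact hcai) hx
  have hrel : (c : ℚ) ^ (2 * f.natDegree - 2) * Algebra.discr ℚ pb.basis = c ^ k * D := by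
    apply (algebraMap ℚ ℂ).injective
    rw [map_mul, hk]
    simp only [map_mul, map_pow, map_intCast]
    rw [hD]; ring
  have hle : Algebra.adjoin ℤ {pb.gen} ≤ Algebra.adjoin ℤ {a} := by
    apply Algebra.adjoin_le
    rintro _ rfl
    rw [hpb]
    exact mul_mem (intCast_mem _ _) (Algebra.self_mem_adjoin_singleton ℤ a)
  have hm2 := mul_mem (intCast_mem (Algebra.adjoin ℤ {a}) (c ^ (2 * f.natDegree - 2))) (hle hmem)
  convert hm2 using 1
  rw [Algebra.smul_def, ← mul_assoc]
  congr 1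
  have := congrArg (algebraMap ℚ L) hrel
  simpa using this.symm

lemma aux_pow (L : Type) [Field L] [NumberField L] (η : ℕ) (hη : 0 < η) (x : L) (hx : x ∈ Rring L η) :
    ∃ k : ℕ, IsIntegral ℤ ((η : L) ^ k * x) := by
  have h0 : (η : L) ≠ 0 := by exact_mod_cast hη.ne'
  have hi : IsIntegral ℤ (η : L) := by simpa using isIntegral_algebraMap (R := ℤ) (A := L) (x := (η : ℤ))
  induction hx using Algebra.adjoin_induction with
  | mem x hx => 
    rw [Set.mem_singleton_iff.1 hx]
    exact ⟨1, by rw [pow_one, mul_inv_cancel₀ h0]; exact isIntegral_one⟩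
  | algebraMap r => exact ⟨0, by rw [pow_zero, one_mul]; exact r.2⟩
  | add x y _ _ h1 h2 =>
    obtain ⟨k, hk⟩ := h1
    obtain ⟨l, hl⟩ := h2
    refine ⟨k + l, ?_⟩
    have := ((hi.pow l).mul hk).add ((hi.pow k).mul hl)
    have e : (η : L) ^ (k + l) * (x + y) = η ^ l * (η ^ k * x) + η ^ k * (η ^ l * y) := by ring
    rw [e]; exact this
  | mul x y _ _ h1 h2 =>
    obtain ⟨k, hk⟩ := h1
    obtain ⟨l, hl⟩ := h2
    refine ⟨k + l, ?_⟩
    have e : (η : L) ^ (k + l) * (x * y) = (η ^ k * x) * (η ^ l * y) := by ring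
    rw [e]; exact hk.mul hl

lemma aux_coe (L : Type) [Field L] [NumberField L] (η : ℕ) (α : ↥(Rring L η)) (p : ℤ[X]) :
    ((aeval α p : ↥(Rring L η)) : L) = aeval (α : L) p :=
  (Polynomial.aeval_algHom_apply ((Rring L η).val.toRingHom.toIntAlgHom) α p).symm

lemma aux_sub {A : Type} [CommRing A] (a : A) (v : ℤ) (p : ℤ[X]) :
    a - (v : A) ∣ aeval a p - ((p.eval v : ℤ) : A) := by
  have h := Polynomial.sub_dvd_eval_sub a (v : A) (p.map (Int.castRingHom A))
  have e : eval (v : A) (p.map (Int.castRingHom A)) = ((p.eval v : ℤ) : A) := by simp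
  rw [e, eval_map] at h
  exact h

lemma aux_key (L : Type) [Field L] [NumberField L] (η : ℕ) (hη : 0 < η)
    (α : ↥(Rring L η))
    (f : Polynomial ℤ) (hp : f.IsPrimitive) (hirr : Irreducible f)
    (hroot : Polynomial.aeval (α : L) f = 0)
    (hgen : IntermediateField.adjoin ℚ {(α : L)} = ⊤)
    (Df : ℤ) (hDf : IsDiscOf Df f)
    (n : ℕ) (hcop : Int.gcd (n : ℤ) ((η : ℤ) * Df) = 1) (x : ↥(Rring L η)) :
    ∃ N : ℤ, IsCoprime N n ∧ ∃ p : ℤ[X], (N : ↥(Rring L η)) * x = aeval α p := by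
  obtain ⟨g, hg, hD⟩ := hDf
  have hc1 : IsCoprime (n : ℤ) ((η : ℤ) * Df) := Int.isCoprime_iff_gcd_eq_one.2 hcop
  have hcη : IsCoprime (n : ℤ) (η : ℤ) := hc1.of_mul_right_left
  have hcD : IsCoprime (n : ℤ) Df := hc1.of_mul_right_right
  obtain ⟨k, hk⟩ := aux_discr L f hp hirr α hroot hgen Df g hg hD
  obtain ⟨l, hl⟩ := aux_pow L η hη α α.2
  obtain ⟨r, hr⟩ := aux_lc L f hp hirr α hroot ((η : ℤ) ^ l) (by positivity) (by simpa using hl)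
  have hcc : IsCoprime (n : ℤ) f.leadingCoeff :=
    (hcη.pow_right.pow_right : IsCoprime (n : ℤ) (((η : ℤ) ^ l) ^ r)).of_isCoprime_of_dvd_right hr
  obtain ⟨s, hs⟩ := aux_pow L η hη x x.2
  refine ⟨f.leadingCoeff ^ k * Df * (η : ℤ) ^ s, ?_, ?_⟩
  · exact ((hcc.pow_right.mul_right hcD).mul_right hcη.pow_right).symm
  · have := hk _ hs
    rw [Algebra.adjoin_singleton_eq_range_aeval] at this
    obtain ⟨p, hp⟩ := this
    refine ⟨p, Subtype.ext ?_⟩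
    rw [aux_coe]
    refine Eq.trans ?_ hp.symm
    push_cast
    ring

lemma aux_ideal (L : Type) [Field L] [NumberField L] (η : ℕ) (hη : 0 < η)
    (α : ↥(Rring L η))
    (f : Polynomial ℤ) (hp : f.IsPrimitive) (hirr : Irreducible f)
    (hroot : Polynomial.aeval (α : L) f = 0)
    (hgen : IntermediateField.adjoin ℚ {(α : L)} = ⊤)
    (Df : ℤ) (hDf : IsDiscOf Df f)
    (n : ℕ) (hcop : Int.gcd (n : ℤ) ((η : ℤ) * Df) = 1) (v : ℕ)
    (hv : (n : ℤ) ∣ f.eval (v : ℤ)) (I : Ideal ↥(Rring L η))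
    (hI : I = Ideal.span {α - ((v : ℕ) : ↥(Rring L η)), ((n : ℕ) : ↥(Rring L η))}) :
    (∀ x : ↥(Rring L η), ∃ m : ℤ, x - (m : ↥(Rring L η)) ∈ I) ∧
    (∀ m : ℤ, (m : ↥(Rring L η)) ∈ I ↔ (n : ℤ) ∣ m) := by
  have key := aux_key L η hη α f hp hirr hroot hgen Df hDf n hcop
  have hnI : (n : ↥(Rring L η)) ∈ I := by rw [hI]; exact Ideal.subset_span (by simp)
  have hvI : α - (v : ↥(Rring L η)) ∈ I := by rw [hI]; exact Ideal.subset_span (by simp)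
  refine ⟨fun x => ?_, fun m => ⟨fun hm => ?_, ?_⟩⟩
  · obtain ⟨N, ⟨u, w, huw⟩, p, hpx⟩ := key x
    refine ⟨u * p.eval (v : ℤ), ?_⟩
    have h1 : aeval α p - ((p.eval (v : ℤ) : ℤ) : ↥(Rring L η)) ∈ I :=
      I.mem_of_dvd (by simpa using aux_sub α (v : ℤ) p) hvI
    have h2 := I.add_mem (I.mul_mem_left (u : ↥(Rring L η)) h1) (I.mul_mem_left (w * x) hnI)
    have huw' : (u : ↥(Rring L η)) * N + w * n = 1 := by exact_mod_cast congrArg (Int.cast : ℤ → ↥(Rring L η)) huw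
    have e : x - ((u * p.eval (v : ℤ) : ℤ) : ↥(Rring L η)) =
        (u : ↥(Rring L η)) * (aeval α p - ((p.eval (v : ℤ) : ℤ) : ↥(Rring L η))) + w * x * n := by
      rw [← hpx, Int.cast_mul]
      linear_combination (-x) * huw'
    rw [e]; exact h2
  · rw [hI, Ideal.mem_span_pair] at hm
    obtain ⟨x, y, hxy⟩ := hm
    obtain ⟨N1, hN1, p, hpx⟩ := key x
    obtain ⟨N2, hN2, q, hqy⟩ := key y
    have hz : aeval (α : L) (C (N1 * N2 * m) - C N2 * p * (X - C (v : ℤ)) - C N1 * C (n : ℤ) * q) = 0 := by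
      rw [← aux_coe, ZeroMemClass.coe_eq_zero]
      simp only [map_sub, map_mul, aeval_X, ← hpx, ← hqy, eq_intCast, map_intCast, map_natCast,
        Int.cast_natCast, ← hxy]
      ring
    obtain ⟨t, ht⟩ := aux_dvd L f _ hp hirr α hroot hz
    have h3 := congrArg (eval (v : ℤ)) ht
    simp only [eval_sub, eval_mul, eval_C, eval_X, sub_self, mul_zero, sub_zero] at h3
    have h4 : (n : ℤ) ∣ N1 * N2 * m := by
      have : N1 * N2 * m = eval (v : ℤ) f * eval (v : ℤ) t + n * (N1 * eval (v : ℤ) q) := by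
        linear_combination h3
      rw [this]
      exact dvd_add (hv.mul_right _) (dvd_mul_right _ _)
    exact (hN1.mul_left hN2).symm.dvd_of_dvd_mul_left h4
  · rintro ⟨t, rfl⟩
    rw [Int.cast_mul, Int.cast_natCast]
    exact I.mul_mem_right _ hnI

lemma aux_S (L : Type) [Field L] [NumberField L] (η n : ℕ) (hn : 0 < n) (I : Ideal ↥(Rring L η)) :
    I ∈ Sset L η n ↔ (∀ x : ↥(Rring L η), ∃ m : ℤ, x - (m : ↥(Rring L η)) ∈ I) ∧
    (∀ m : ℤ, (m : ↥(Rring L η)) ∈ I ↔ (n : ℤ) ∣ m) := by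
  have hsurj : Function.Surjective ⇑(Int.castRingHom (↥(Rring L η) ⧸ I)) ↔
      ∀ x : ↥(Rring L η), ∃ m : ℤ, x - (m : ↥(Rring L η)) ∈ I := by
    constructor
    · intro h x
      obtain ⟨m, hm⟩ := h (Ideal.Quotient.mk I x)
      refine ⟨m, ?_⟩
      rw [← Ideal.Quotient.eq_zero_iff_mem, map_sub, map_intCast, ← hm]
      simp
    · intro h y
      obtain ⟨x, rfl⟩ := Ideal.Quotient.mk_surjective y
      obtain ⟨m, hm⟩ := h x
      refine ⟨m, ?_⟩
      rw [← Ideal.Quotient.eq_zero_iff_mem, map_sub, map_intCast, sub_eq_zero] at hm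
      rw [hm]; simp
  have hmem : ∀ m : ℤ, ((m : ↥(Rring L η) ⧸ I) = 0 ↔ (m : ↥(Rring L η)) ∈ I) := by
    intro m
    rw [← Ideal.Quotient.eq_zero_iff_mem, map_intCast]
  constructor
  · rintro ⟨⟨_, h1⟩, h2⟩
    refine ⟨hsurj.1 h1, fun m => ?_⟩
    rw [← hmem]
    exact (aux_card _ n h1).1 h2 m
  · rintro ⟨h1, h2⟩
    have h1' := hsurj.2 h1
    refine ⟨⟨?_, h1'⟩, (aux_card _ n h1').2 fun m => (hmem m).trans (h2 m)⟩
    rintro rfl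
    have := (h2 n).2 dvd_rfl
    rw [Ideal.mem_bot] at this
    have h3 := congrArg (Subtype.val) this
    simp at h3
    omega

end Stmt1Aux

theorem statement1 (L : Type) [Field L] [NumberField L] (η : ℕ) (hη : 0 < η)
    (α : ↥(Rring L η))
    (f : Polynomial ℤ) (hprim : f.content = 1) (hirr : Irreducible f)
    (hroot : Polynomial.aeval (α : L) f = 0)
    (hgen : IntermediateField.adjoin ℚ {(α : L)} = ⊤)
    (Df : ℤ) (hDf : IsDiscOf Df f)
    (res : Ideal ↥(Rring L η) → ℕ)
    (hres : ∀ 𝔞 : Ideal ↥(Rring L η), DegOne 𝔞 →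
      res 𝔞 < idealNorm 𝔞 ∧ α - ((res 𝔞 : ℕ) : ↥(Rring L η)) ∈ 𝔞)
    (n : ℕ) (hn : 0 < n) (hcop : Int.gcd (n : ℤ) ((η : ℤ) * Df) = 1) :
    Set.BijOn (fun v : ℕ => Ideal.span {α - ((v : ℕ) : ↥(Rring L η)), ((n : ℕ) : ↥(Rring L η))})
      {v : ℕ | v < n ∧ (n : ℤ) ∣ f.eval (v : ℤ)} (Sset L η n) ∧
    Set.InvOn res (fun v : ℕ => Ideal.span {α - ((v : ℕ) : ↥(Rring L η)), ((n : ℕ) : ↥(Rring L η))})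
      {v : ℕ | v < n ∧ (n : ℤ) ∣ f.eval (v : ℤ)} (Sset L η n) := by
  classical
  have hp : f.IsPrimitive := Polynomial.isPrimitive_iff_content_eq_one.2 hprim
  have hroot' : Polynomial.aeval α f = 0 := by
    apply Subtype.ext
    rw [aux_coe, hroot]; rfl
  have hid : ∀ v : ℕ, (n : ℤ) ∣ f.eval (v : ℤ) → _ := fun v hv =>
    aux_ideal L η hη α f hp hirr hroot hgen Df hDf n hcop v hv _ rfl
  have hmaps : Set.MapsTo
      (fun v : ℕ => Ideal.span {α - ((v : ℕ) : ↥(Rring L η)), ((n : ℕ) : ↥(Rring L η))})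
      {v : ℕ | v < n ∧ (n : ℤ) ∣ f.eval (v : ℤ)} (Sset L η n) := fun v hv =>
    (aux_S L η n hn _).2 (hid v hv.2)
  have hmaps' : Set.MapsTo res (Sset L η n) {v : ℕ | v < n ∧ (n : ℤ) ∣ f.eval (v : ℤ)} := by
    intro I hI
    obtain ⟨h1, h2⟩ := hres I hI.1
    rw [hI.2] at h1
    refine ⟨h1, ?_⟩
    rw [← ((aux_S L η n hn I).1 hI).2]
    have h3 : α - (((res I : ℕ) : ℤ) : ↥(Rring L η)) ∈ I := by simpa using h2
    have h4 := I.mem_of_dvd (aux_sub α ((res I : ℕ) : ℤ) f) h3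
    rw [hroot', zero_sub] at h4
    exact I.neg_mem_iff.1 h4
  have hinv : Set.InvOn res
      (fun v : ℕ => Ideal.span {α - ((v : ℕ) : ↥(Rring L η)), ((n : ℕ) : ↥(Rring L η))})
      {v : ℕ | v < n ∧ (n : ℤ) ∣ f.eval (v : ℤ)} (Sset L η n) := by
    constructor
    · intro v hv
      have hI := hmaps hv
      obtain ⟨h1, h2⟩ := hres _ hI.1
      rw [hI.2] at h1
      dsimp only at hI h1 h2 ⊢
      set I := Ideal.span {α - ((v : ℕ) : ↥(Rring L η)), ((n : ℕ) : ↥(Rring L η))} with hIdef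
      have hvI : α - (v : ↥(Rring L η)) ∈ I := Ideal.subset_span (by simp)
      have h3 : (((res I : ℤ) - (v : ℤ) : ℤ) : ↥(Rring L η)) ∈ I := by
        have := I.sub_mem hvI h2
        rw [sub_sub_sub_cancel_left] at this
        simpa using this
      rw [((aux_S L η n hn I).1 hI).2] at h3
      have h4 : v < n := hv.1
      have h5 := Int.eq_zero_of_abs_lt_dvd h3 (by rw [abs_lt]; constructor <;> omega)
      omega
    · intro I hI
      have hv := hmaps' hI
      have h := hid _ hv.2
      have hs := (aux_S L η n hn I).1 hI
      dsimp only at h ⊢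
      have hle : Ideal.span {α - ((res I : ℕ) : ↥(Rring L η)), ((n : ℕ) : ↥(Rring L η))} ≤ I := by
        rw [Ideal.span_le]
        rintro y (rfl | rfl)
        · exact (hres I hI.1).2
        · have := (hs.2 n).2 dvd_rfl
          simpa using this
      refine le_antisymm hle fun x hx => ?_
      obtain ⟨m, hm⟩ := h.1 x
      have h6 : (m : ↥(Rring L η)) ∈ I := by
        have := I.sub_mem hx (hle hm)
        simpa using this
      have h7 := (h.2 m).2 ((hs.2 m).1 h6)
      have := Ideal.add_mem _ hm h7
      simpa using this
  exact ⟨hinv.bijOn hmaps hmaps', hinv⟩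
end

section
/- Let η be a positive integer and let α ∈ R be irrational (α ∉ ℚ). Then the sequence of ratios α(𝔞)/𝔑(𝔞), as 𝔞 runs over all degree-one ideals of R arranged so that the norms 𝔑(𝔞) are nondecreasing, is uniformly distributed in [0,1]: for all real u, v with 0 ≤ u < v ≤ 1, the quantity #{𝔞 ∈ S_η : 𝔑(𝔞) ≤ x, u ≤ α(𝔞)/𝔑(𝔞) < v} / #{𝔞 ∈ S_η : 𝔑(𝔞) ≤ x} tends to v − u as x → ∞. -/
open NumberField Filter Asymptotics Topology

set_option maxHeartbeats 1000000
set_option synthInstance.maxHeartbeats 400000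

/-- counting function -/
noncomputable def cntI {K : Type} [Field K] [NumberField K] (J : Set (Ideal (𝓞 K))) (x : ℝ) : ℕ :=
  Set.ncard {𝔞 : Ideal (𝓞 K) | 𝔞 ∈ J ∧ 𝔞 ≠ ⊥ ∧ (Ideal.absNorm 𝔞 : ℝ) ≤ x}

def PosLow {K : Type} [Field K] [NumberField K] (J : Set (Ideal (𝓞 K))) : Prop :=
  ∃ c : ℝ, 0 < c ∧ ∃ x0 : ℝ, ∀ x : ℝ, x0 ≤ x → c * x ≤ (cntI J x : ℝ)

section AA
variable {K : Type} [Field K] [NumberField K]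

lemma finI (x : ℝ) : {𝔞 : Ideal (𝓞 K) | (Ideal.absNorm 𝔞 : ℝ) ≤ x}.Finite := by
  refine (Ideal.finite_setOfPred_absNorm_le (S := 𝓞 K) ⌈x⌉₊).subset fun I hI => ?_
  have h : (Ideal.absNorm I : ℝ) ≤ x := hI
  have : (Ideal.absNorm I : ℝ) ≤ (⌈x⌉₊ : ℝ) := h.trans (Nat.le_ceil x)
  exact_mod_cast this

lemma finJ (J : Set (Ideal (𝓞 K))) (x : ℝ) :
    {𝔞 : Ideal (𝓞 K) | 𝔞 ∈ J ∧ 𝔞 ≠ ⊥ ∧ (Ideal.absNorm 𝔞 : ℝ) ≤ x}.Finite :=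
  (finI x).subset fun _ h => h.2.2

lemma cntI_mono {J J' : Set (Ideal (𝓞 K))} (h : J ⊆ J') {x y : ℝ} (hxy : x ≤ y) :
    cntI J x ≤ cntI J' y :=
  Set.ncard_le_ncard (fun _ ha => ⟨h ha.1, ha.2.1, ha.2.2.trans hxy⟩) (finJ _ _)

lemma cntI_univ_eq (x : ℝ) : cntI (Set.univ : Set (Ideal (𝓞 K))) x =
    Nat.card {I : nonZeroDivisors (Ideal (𝓞 K)) // (Ideal.absNorm (I : Ideal (𝓞 K)) : ℝ) ≤ x} := by
  rw [cntI, ← Nat.card_coe_set_eq]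
  refine Nat.card_congr ?_
  refine ⟨fun a => ⟨⟨a.1, mem_nonZeroDivisors_of_ne_zero a.2.2.1⟩, a.2.2.2⟩,
    fun b => ⟨b.1.1, trivial, nonZeroDivisors.ne_zero b.1.2, b.2⟩, fun _ => rfl, fun _ => rfl⟩

lemma one_le_absNorm {I : Ideal (𝓞 K)} (h : I ≠ ⊥) : (1 : ℝ) ≤ (Ideal.absNorm I : ℝ) := by
  have : Ideal.absNorm I ≠ 0 := by rwa [Ne, Ideal.absNorm_eq_zero_iff]
  exact_mod_cast Nat.one_le_iff_ne_zero.mpr this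

lemma two_le_absNorm {I : Ideal (𝓞 K)} (h : I ≠ ⊥) (h' : I ≠ ⊤) :
    (2 : ℝ) ≤ (Ideal.absNorm I : ℝ) := by
  have : Ideal.absNorm I ≠ 0 := by rwa [Ne, Ideal.absNorm_eq_zero_iff]
  have : Ideal.absNorm I ≠ 1 := by rwa [Ne, Ideal.absNorm_eq_one_iff]
  have : 2 ≤ Ideal.absNorm I := by omega
  exact_mod_cast this

lemma cntI_lower : PosLow (Set.univ : Set (Ideal (𝓞 K))) := by
  have h := NumberField.dedekindZeta_residue_pos K
  rw [NumberField.dedekindZeta_residue_def] at h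
  have h2 := NumberField.Ideal.tendsto_norm_le_div_atTop₀ K
  set ℓ := ((2 ^ NumberField.InfinitePlace.nrRealPlaces K * (2 * Real.pi) ^ NumberField.InfinitePlace.nrComplexPlaces K * NumberField.Units.regulator K * NumberField.classNumber K) /
            (NumberField.Units.torsionOrder K * Real.sqrt |NumberField.discr K|)) with hl
  have h3 : ∀ᶠ s : ℝ in atTop, ℓ / 2 < _ := h2.eventually_const_lt (half_lt_self h)
  obtain ⟨x0, hx0⟩ := (h3.and (eventually_gt_atTop 0)).exists_forall_of_atTop
  refine ⟨ℓ / 2, half_pos h, x0, fun x hx => ?_⟩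
  obtain ⟨h4, h5⟩ := hx0 x hx
  rw [lt_div_iff₀ h5] at h4
  rw [cntI_univ_eq]
  exact h4.le

lemma cntI_zero (J : Set (Ideal (𝓞 K))) {x : ℝ} (hx : x < 1) : cntI J x = 0 := by
  rw [cntI]
  convert Set.ncard_empty (Ideal (𝓞 K))
  ext a
  simp only [Set.mem_setOf_eq, Set.mem_empty_iff_false, iff_false]
  rintro ⟨_, h, h'⟩
  linarith [one_le_absNorm h]

variable (K) in
lemma cntI_upper : ∃ C : ℝ, 0 < C ∧ ∀ (J : Set (Ideal (𝓞 K))) (x : ℝ), 0 ≤ x →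
    (cntI J x : ℝ) ≤ C * x := by
  have h2 := NumberField.Ideal.tendsto_norm_le_div_atTop₀ K
  set ℓ := ((2 ^ NumberField.InfinitePlace.nrRealPlaces K * (2 * Real.pi) ^ NumberField.InfinitePlace.nrComplexPlaces K * NumberField.Units.regulator K * NumberField.classNumber K) /
            (NumberField.Units.torsionOrder K * Real.sqrt |NumberField.discr K|)) with hl
  have h3 : ∀ᶠ s : ℝ in atTop, _ < |ℓ| + 1 :=
    h2.eventually_lt_const ((le_abs_self ℓ).trans_lt (lt_add_one |ℓ|))
  obtain ⟨x0, hx0⟩ := (h3.and (eventually_gt_atTop 1)).exists_forall_of_atTop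
  have key : ∀ x, x0 ≤ x → (cntI (Set.univ : Set (Ideal (𝓞 K))) x : ℝ) ≤ (|ℓ| + 1) * x := by
    intro x hx
    obtain ⟨h4, h5⟩ := hx0 x hx
    rw [div_lt_iff₀ (by linarith)] at h4
    rw [cntI_univ_eq]
    exact h4.le
  have h1x : 1 < x0 := (hx0 x0 le_rfl).2
  have hp : 0 < |ℓ| + 1 := by positivity
  refine ⟨(|ℓ| + 1) * x0, by positivity, fun J x hx => ?_⟩
  rcases lt_or_ge x 1 with h | h
  · rw [cntI_zero J h]; simp; positivity
  · have h6 : (cntI J x : ℝ) ≤ cntI (Set.univ : Set (Ideal (𝓞 K))) (max x x0) := by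
      exact_mod_cast cntI_mono (Set.subset_univ _) (le_max_left _ _)
    refine h6.trans ((key _ (le_max_right _ _)).trans ?_)
    rw [mul_assoc]
    gcongr
    apply max_le <;> nlinarith

lemma cnt_dvd_le {C : ℝ} (hC : ∀ (J : Set (Ideal (𝓞 K))) (x : ℝ), 0 ≤ x →
    (cntI J x : ℝ) ≤ C * x) (q : Ideal (𝓞 K)) (hq : q ≠ ⊥) (x : ℝ) (hx : 0 ≤ x) :
    (cntI {a | q ∣ a} x : ℝ) ≤ C * (x / Ideal.absNorm q) := by
  have hq1 := one_le_absNorm hq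
  refine le_trans ?_ (hC Set.univ (x / Ideal.absNorm q) (by positivity))
  have : {𝔞 : Ideal (𝓞 K) | 𝔞 ∈ {a | q ∣ a} ∧ 𝔞 ≠ ⊥ ∧ (Ideal.absNorm 𝔞 : ℝ) ≤ x} ⊆
    (fun b => q * b) '' {𝔞 : Ideal (𝓞 K) | 𝔞 ∈ Set.univ ∧ 𝔞 ≠ ⊥ ∧ (Ideal.absNorm 𝔞 : ℝ) ≤ x / Ideal.absNorm q} := by
    rintro a ⟨⟨b, rfl⟩, h0, h1⟩
    refine ⟨b, ⟨trivial, ?_, ?_⟩, rfl⟩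
    · rintro rfl; simp at h0
    · rw [le_div_iff₀ (by linarith), mul_comm]
      rw [map_mul] at h1; exact_mod_cast h1
  have h2 := Set.ncard_le_ncard this ((finJ _ _).image _)
  exact_mod_cast h2.trans (Set.ncard_image_le (finJ _ _))

lemma posLow_remove (J : Set (Ideal (𝓞 K))) (hJ : ∀ a b : Ideal (𝓞 K), b ∈ J → a ∣ b → a ∈ J)
    (hlow : PosLow J) (P : Ideal (𝓞 K)) (hP : P ≠ ⊥) (hP' : P ≠ ⊤) :
    PosLow {a | a ∈ J ∧ ¬ P ∣ a} := by
  obtain ⟨c, hc, x0, h⟩ := hlow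
  obtain ⟨C, hC0, hC⟩ := cntI_upper K
  obtain ⟨k, hk⟩ := pow_unbounded_of_one_lt (2 * C / c) (one_lt_two (α := ℝ))
  have hN := two_le_absNorm hP hP'
  have hk0 : 0 < k + 1 := by omega
  refine ⟨c / (2 * (k + 1)), by positivity, max x0 0, fun x hx => ?_⟩
  have hx1 := h x ((le_max_left _ _).trans hx)
  have hx2 : 0 ≤ x := (le_max_right _ _).trans hx
  have hsub : {𝔞 : Ideal (𝓞 K) | 𝔞 ∈ J ∧ 𝔞 ≠ ⊥ ∧ (Ideal.absNorm 𝔞 : ℝ) ≤ x} ⊆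
      (⋃ i ∈ Finset.range k, (fun b => P ^ i * b) ''
        {𝔞 : Ideal (𝓞 K) | 𝔞 ∈ {a | a ∈ J ∧ ¬ P ∣ a} ∧ 𝔞 ≠ ⊥ ∧ (Ideal.absNorm 𝔞 : ℝ) ≤ x}) ∪
      {𝔞 : Ideal (𝓞 K) | 𝔞 ∈ {a | P ^ k ∣ a} ∧ 𝔞 ≠ ⊥ ∧ (Ideal.absNorm 𝔞 : ℝ) ≤ x} := by
    rintro a ⟨h1, h2, h3⟩
    by_cases hd : P ^ k ∣ a
    · right; exact ⟨hd, h2, h3⟩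
    · left
      have hfm : FiniteMultiplicity P a := ⟨k, fun hh => hd ((pow_dvd_pow P (Nat.le_succ k)).trans hh)⟩
      obtain ⟨b, hb, hb'⟩ := hfm.exists_eq_pow_mul_and_not_dvd
      simp only [Set.mem_iUnion]
      have hb0 : b ≠ ⊥ := by rintro rfl; simp at hb'
      refine ⟨multiplicity P a, ?_, b, ⟨⟨hJ b a h1 ⟨_, by rw [mul_comm]; exact hb⟩, hb'⟩, hb0, ?_⟩, hb.symm⟩
      · rw [Finset.mem_range]
        by_contra hh
        exact hd ((pow_dvd_pow P (not_lt.mp hh)).trans ⟨b, hb⟩)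
      · refine le_trans ?_ h3
        rw [hb, map_mul]
        push_cast
        have : (1:ℝ) ≤ (Ideal.absNorm (P ^ multiplicity P a) : ℝ) := one_le_absNorm (pow_ne_zero _ hP)
        nlinarith [one_le_absNorm hb0]
  have hcard := Set.ncard_le_ncard hsub ((Set.Finite.biUnion (Finset.finite_toSet _)
    (fun i _ => (finJ _ _).image _)).union (finJ _ _))
  have h4 := hcard.trans (Set.ncard_union_le _ _)
  have h5 : (⋃ i ∈ Finset.range k, (fun b => P ^ i * b) ''
        {𝔞 : Ideal (𝓞 K) | 𝔞 ∈ {a | a ∈ J ∧ ¬ P ∣ a} ∧ 𝔞 ≠ ⊥ ∧ (Ideal.absNorm 𝔞 : ℝ) ≤ x}).ncard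
        ≤ k * cntI {a | a ∈ J ∧ ¬ P ∣ a} x := by
    refine (Finset.set_ncard_biUnion_le _ _).trans ?_
    refine (Finset.sum_le_card_nsmul _ _ (cntI {a | a ∈ J ∧ ¬ P ∣ a} x) (fun i _ => ?_)).trans (by simp)
    exact Set.ncard_image_le (finJ _ _)
  have h6 := cnt_dvd_le hC (P ^ k) (pow_ne_zero _ hP) x hx2
  have h7 : (cntI J x : ℝ) ≤ k * cntI {a | a ∈ J ∧ ¬ P ∣ a} x + cntI {a | P ^ k ∣ a} x := by
    have := h4.trans (Nat.add_le_add_right h5 _)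
    exact_mod_cast this
  have h8 : C * (x / (Ideal.absNorm (P ^ k) : ℝ)) ≤ c / 2 * x := by
    rw [map_pow]
    push_cast
    have e1 : (2:ℝ)^k ≤ (Ideal.absNorm P : ℝ) ^ k := by gcongr
    have e2 : 2 * C ≤ c * (Ideal.absNorm P : ℝ) ^ k := by
      rw [div_lt_iff₀ hc] at hk
      nlinarith
    rw [← mul_div_assoc, div_le_iff₀ (by positivity)]
    nlinarith
  rw [div_mul_eq_mul_div, div_le_iff₀ (by positivity)]
  have : (0:ℝ) ≤ (cntI {a | a ∈ J ∧ ¬ P ∣ a} x : ℝ) := by positivity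
  nlinarith

lemma posLow_sieve {ι : Type} (q : ι → Ideal (𝓞 K)) (h0 : ∀ i, q i ≠ ⊥) (h1 : ∀ i, q i ≠ ⊤)
    (hs : Summable fun i => 1 / (Ideal.absNorm (q i) : ℝ)) :
    PosLow {a : Ideal (𝓞 K) | ∀ i, ¬ q i ∣ a} := by
  classical
  obtain ⟨c, hc, x0, h⟩ := cntI_lower (K := K)
  obtain ⟨C, hC0, hC⟩ := cntI_upper K
  have hε : 0 < c / (2 * C) := by positivity
  obtain ⟨s, hs'⟩ := summable_iff_vanishing_norm.mp hs _ hε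
  have step1 : PosLow {a : Ideal (𝓞 K) | ∀ i, i ∉ s → ¬ q i ∣ a} := by
    refine ⟨c / 2, by positivity, max x0 1, fun x hx => ?_⟩
    have hx1 := h x ((le_max_left _ _).trans hx)
    have hx2 : 1 ≤ x := (le_max_right _ _).trans hx
    have hfin : {i | (Ideal.absNorm (q i) : ℝ) ≤ x}.Finite := by
      have := hs.tendsto_cofinite_zero.eventually_lt_const (show (0:ℝ) < 1 / x by positivity)
      rw [Filter.eventually_cofinite] at this
      refine this.subset fun i hi => ?_
      simp only [Set.mem_setOf_eq, not_lt]
      have := one_le_absNorm (h0 i)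
      exact one_div_le_one_div_of_le (by linarith) hi
    set t := hfin.toFinset \ s with ht
    have hsub : {𝔞 : Ideal (𝓞 K) | 𝔞 ∈ Set.univ ∧ 𝔞 ≠ ⊥ ∧ (Ideal.absNorm 𝔞 : ℝ) ≤ x} ⊆
      {𝔞 : Ideal (𝓞 K) | 𝔞 ∈ {a : Ideal (𝓞 K) | ∀ i, i ∉ s → ¬ q i ∣ a} ∧ 𝔞 ≠ ⊥ ∧ (Ideal.absNorm 𝔞 : ℝ) ≤ x} ∪
      (⋃ i ∈ t, {𝔞 : Ideal (𝓞 K) | 𝔞 ∈ {a | q i ∣ a} ∧ 𝔞 ≠ ⊥ ∧ (Ideal.absNorm 𝔞 : ℝ) ≤ x}) := by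
      rintro a ⟨-, h2, h3⟩
      by_cases hd : ∀ i, i ∉ s → ¬ q i ∣ a
      · left; exact ⟨hd, h2, h3⟩
      · right
        push Not at hd
        obtain ⟨i, hi, hi'⟩ := hd
        simp only [Set.mem_iUnion]
        refine ⟨i, ?_, hi', h2, h3⟩
        rw [ht, Finset.mem_sdiff]
        refine ⟨?_, hi⟩
        rw [Set.Finite.mem_toFinset]
        refine le_trans ?_ h3
        have hz : Ideal.absNorm a ≠ 0 := by rwa [Ne, Ideal.absNorm_eq_zero_iff]
        exact_mod_cast Nat.le_of_dvd (Nat.pos_of_ne_zero hz) (map_dvd _ hi')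
    have hcard := Set.ncard_le_ncard hsub ((finJ _ _).union (Set.Finite.biUnion (Finset.finite_toSet _)
      (fun i _ => (finJ _ _))))
    have h4 := hcard.trans (Set.ncard_union_le _ _)
    have h5 : ((⋃ i ∈ t, {𝔞 : Ideal (𝓞 K) | 𝔞 ∈ {a | q i ∣ a} ∧ 𝔞 ≠ ⊥ ∧ (Ideal.absNorm 𝔞 : ℝ) ≤ x}).ncard : ℝ)
        ≤ ∑ i ∈ t, C * (x / Ideal.absNorm (q i)) := by
      have := Finset.set_ncard_biUnion_le t (fun i => {𝔞 : Ideal (𝓞 K) | 𝔞 ∈ {a | q i ∣ a} ∧ 𝔞 ≠ ⊥ ∧ (Ideal.absNorm 𝔞 : ℝ) ≤ x})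
      refine (Nat.cast_le.mpr this).trans ?_
      push_cast
      exact Finset.sum_le_sum fun i _ => cnt_dvd_le hC (q i) (h0 i) x (by linarith)
    have h6 := hs' t (by rw [ht]; exact Finset.sdiff_disjoint)
    have h7 : ∑ i ∈ t, C * (x / Ideal.absNorm (q i)) = C * x * ∑ i ∈ t, 1 / (Ideal.absNorm (q i) : ℝ) := by
      rw [Finset.mul_sum]; refine Finset.sum_congr rfl fun i _ => by ring
    have h8 : ∑ i ∈ t, 1 / (Ideal.absNorm (q i) : ℝ) ≤ c / (2 * C) :=
      (le_abs_self _).trans h6.le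
    have h9 : C * x * ∑ i ∈ t, 1 / (Ideal.absNorm (q i) : ℝ) ≤ C * x * (c / (2 * C)) := by gcongr
    have h10 : C * x * (c / (2 * C)) = c / 2 * x := by field_simp
    have h11 : (cntI (Set.univ : Set (Ideal (𝓞 K))) x : ℝ) ≤ cntI {a : Ideal (𝓞 K) | ∀ i, i ∉ s → ¬ q i ∣ a} x +
       ((⋃ i ∈ t, {𝔞 : Ideal (𝓞 K) | 𝔞 ∈ {a | q i ∣ a} ∧ 𝔞 ≠ ⊥ ∧ (Ideal.absNorm 𝔞 : ℝ) ≤ x}).ncard : ℝ) := by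
      exact_mod_cast h4
    linarith
  have hmax : ∀ i, ∃ P : Ideal (𝓞 K), P ≠ ⊥ ∧ P ≠ ⊤ ∧ P ∣ q i := by
    intro i
    exact ⟨q i, h0 i, h1 i, dvd_rfl⟩
  choose P hP0 hP1 hP2 using hmax
  have step2 : ∀ s' : Finset ι, PosLow {a : Ideal (𝓞 K) | (∀ i, i ∉ s → ¬ q i ∣ a) ∧ ∀ i ∈ s', ¬ P i ∣ a} := by
    intro s'
    induction s' using Finset.induction_on with
    | empty => simpa using step1
    | insert i s' hi ih =>
      have := posLow_remove _ ?_ ih (P i) (hP0 i) (hP1 i)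
      · convert this using 1
        ext a
        simp only [Set.mem_setOf_eq, Finset.mem_insert, forall_eq_or_imp]
        tauto
      · rintro a b ⟨hb1, hb2⟩ hab
        exact ⟨fun i hi hd => hb1 i hi (hd.trans hab), fun i hi hd => hb2 i hi (hd.trans hab)⟩
  obtain ⟨c', hc', x1, h'⟩ := step2 s
  refine ⟨c', hc', x1, fun x hx => (h' x hx).trans ?_⟩
  have : {a : Ideal (𝓞 K) | (∀ i, i ∉ s → ¬ q i ∣ a) ∧ ∀ i ∈ s, ¬ P i ∣ a} ⊆ {a : Ideal (𝓞 K) | ∀ i, ¬ q i ∣ a} := by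
    rintro a ⟨ha, hb⟩ i
    by_cases hi : i ∈ s
    · exact fun hh => hb i hi ((hP2 i).trans hh)
    · exact ha i hi
  exact_mod_cast cntI_mono this le_rfl

end AA

lemma summable_fib {ι : Type} (f : ι → ℕ) (D : ℕ) (hf : ∀ (p : ℕ) (u : Finset ι), (∀ i ∈ u, f i = p) → u.card ≤ D)
    (g : ℕ → ℝ) (hg : ∀ p, 0 ≤ g p) (hs : Summable g) : Summable fun i => g (f i) := by
  classical
  refine summable_of_sum_le (c := D * ∑' p, g p) (fun i => hg _) fun u => ?_
  rw [← Finset.sum_fiberwise_of_maps_to (s := u) (t := u.image f) (g := f) (fun i hi => Finset.mem_image_of_mem f hi)]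
  have : ∑ p ∈ u.image f, ∑ i ∈ u with f i = p, g (f i) ≤ ∑ p ∈ u.image f, D * g p := by
    refine Finset.sum_le_sum fun p _ => ?_
    rw [Finset.sum_congr rfl (g := fun _ => g p) (fun i hi => by rw [(Finset.mem_filter.mp hi).2])]
    rw [Finset.sum_const, nsmul_eq_mul]
    have := hf p {i ∈ u | f i = p} (fun i hi => (Finset.mem_filter.mp hi).2)
    have h2 : (({i ∈ u | f i = p} : Finset ι).card : ℝ) ≤ D := by exact_mod_cast this
    exact mul_le_mul_of_nonneg_right h2 (hg p)
  refine this.trans ?_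
  rw [← Finset.mul_sum]
  gcongr
  exact hs.sum_le_tsum _ (fun _ _ => hg _)

section BB
variable {K : Type} [Field K] [NumberField K]

lemma absNorm_natCast (p : ℕ) : Ideal.absNorm (Ideal.span {(p : 𝓞 K)}) = p ^ Module.finrank ℚ K := by
  rw [Ideal.absNorm_span_singleton]
  have : (p : 𝓞 K) = algebraMap ℤ (𝓞 K) p := by simp
  rw [this, Algebra.norm_algebraMap, Int.natAbs_pow, Int.natAbs_natCast, NumberField.RingOfIntegers.rank]

lemma span_ne_bot {p : ℕ} (hp : p.Prime) : Ideal.span {(p : 𝓞 K)} ≠ ⊥ := by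
  rw [Ne, Ideal.span_singleton_eq_bot]
  exact_mod_cast hp.ne_zero

lemma prime_above {P : Ideal (𝓞 K)} (hP : P.IsPrime) (h0 : P ≠ ⊥) :
    ∃ p : ℕ, p.Prime ∧ (p : 𝓞 K) ∈ P := by
  have h1 : ((Ideal.absNorm P : ℕ) : 𝓞 K) ∈ P := Ideal.absNorm_mem P
  have hne : Ideal.absNorm P ≠ 0 := by rwa [Ne, Ideal.absNorm_eq_zero_iff]
  have key : ∀ n : ℕ, n ≠ 0 → (n : 𝓞 K) ∈ P → ∃ p : ℕ, p.Prime ∧ (p : 𝓞 K) ∈ P := by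
    intro n
    induction n using Nat.recOnMul with
    | zero => intro h; exact absurd rfl h
    | one => intro _ h; exact absurd ((Ideal.eq_top_iff_one _).mpr (by simpa using h)) hP.ne_top
    | prime p hp => intro _ h; exact ⟨p, hp, h⟩
    | mul a b ha hb =>
      intro h h'
      push_cast at h'
      rcases hP.mem_or_mem h' with h2 | h2
      · exact ha (by rintro rfl; simp at h) h2
      · exact hb (by rintro rfl; simp at h) h2
  exact key _ hne h1

lemma absNorm_above {P : Ideal (𝓞 K)} (h1 : P ≠ ⊤) {p : ℕ} (hp : p.Prime)
    (hpP : (p : 𝓞 K) ∈ P) : ∃ k, 1 ≤ k ∧ Ideal.absNorm P = p ^ k := by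
  have hd : P ∣ Ideal.span {(p : 𝓞 K)} := by
    rw [Ideal.dvd_span_singleton]; exact hpP
  have := map_dvd Ideal.absNorm hd
  rw [absNorm_natCast] at this
  obtain ⟨k, _, hk⟩ := (Nat.dvd_prime_pow hp).mp this
  refine ⟨k, ?_, hk⟩
  rcases Nat.eq_zero_or_pos k with h | h
  · subst h
    rw [pow_zero, Ideal.absNorm_eq_one_iff] at hk
    exact absurd hk h1
  · exact h

lemma above_unique {P : Ideal (𝓞 K)} (h1 : P ≠ ⊤) {p q : ℕ} (hp : p.Prime) (hq : q.Prime)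
    (hpP : (p : 𝓞 K) ∈ P) (hqP : (q : 𝓞 K) ∈ P) : p = q := by
  obtain ⟨k, hk, e⟩ := absNorm_above h1 hp hpP
  obtain ⟨l, hl, e'⟩ := absNorm_above h1 hq hqP
  rw [e] at e'
  have : p ∣ q ^ l := e' ▸ dvd_pow_self p (by omega)
  exact (Nat.prime_dvd_prime_iff_eq hp hq).mp (hp.dvd_of_dvd_pow this)

lemma card_above {p : ℕ} (hp : p.Prime) (u : Finset (Ideal (𝓞 K)))
    (hu : ∀ P ∈ u, P.IsPrime ∧ P ≠ ⊥ ∧ (p : 𝓞 K) ∈ P) : u.card ≤ Module.finrank ℚ K := by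
  have hd : ∏ P ∈ u, P ∣ Ideal.span {(p : 𝓞 K)} := by
    refine Finset.prod_primes_dvd _ (fun P hP => ?_) (fun P hP => ?_)
    · exact Ideal.prime_of_isPrime (hu P hP).2.1 (hu P hP).1
    · rw [Ideal.dvd_span_singleton]; exact (hu P hP).2.2
  have h1 := map_dvd Ideal.absNorm hd
  rw [absNorm_natCast, map_prod] at h1
  have h2 : p ^ u.card ∣ ∏ P ∈ u, Ideal.absNorm P := by
    rw [← Finset.prod_const]
    refine Finset.prod_dvd_prod_of_dvd _ _ fun P hP => ?_
    obtain ⟨k, hk, e⟩ := absNorm_above (hu P hP).1.ne_top hp (hu P hP).2.2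
    rw [e]; exact dvd_pow_self p (by omega)
  exact (Nat.pow_dvd_pow_iff_le_right hp.one_lt).mp (h2.trans h1)

/-- primes which are norms of ideals -/
noncomputable def fP (K : Type) [Field K] [NumberField K] (p : ℕ) : ℝ :=
  open scoped Classical in
  if p.Prime ∧ ∃ P : Ideal (𝓞 K), P.IsPrime ∧ Ideal.absNorm P = p then 1 / (p : ℝ) else 0

lemma not_summable_fP : ¬ Summable (fP K) := by
  classical
  intro hs
  let ι := {P : Ideal (𝓞 K) // P.IsPrime ∧ P ≠ ⊥}
  have hex : ∀ i : ι, ∃ p : ℕ, p.Prime ∧ (p : 𝓞 K) ∈ i.1 := fun i => prime_above i.2.1 i.2.2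
  choose f hf1 hf2 using hex
  have hg : Summable (fun p : ℕ => fP K p + 1 / (p : ℝ) ^ 2) :=
    hs.add (Real.summable_one_div_nat_pow.mpr (by norm_num))
  have hg0 : ∀ p : ℕ, 0 ≤ fP K p := fun p => by unfold fP; split_ifs <;> positivity
  have h1 := summable_fib f (Module.finrank ℚ K) ?_ _ (fun p => add_nonneg (hg0 p) (by positivity)) hg
  · have h2 : Summable fun i : ι => 1 / (Ideal.absNorm i.1 : ℝ) := by
      refine Summable.of_nonneg_of_le (fun i => by positivity) (fun i => ?_) h1
      obtain ⟨k, hk, e⟩ := absNorm_above i.2.1.ne_top (hf1 i) (hf2 i)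
      have hp : (1:ℝ) ≤ (f i : ℝ) := by exact_mod_cast (hf1 i).one_lt.le
      rcases Nat.lt_or_ge k 2 with h | h
      · have : k = 1 := by omega
        subst this
        rw [pow_one] at e
        have : fP K (f i) = 1 / (f i : ℝ) := by
          unfold fP; rw [if_pos ⟨hf1 i, i.1, i.2.1, e⟩]
        rw [this, e]
        have : 0 ≤ 1 / (f i : ℝ) ^ 2 := by positivity
        linarith
      · have : 1 / (Ideal.absNorm i.1 : ℝ) ≤ 1 / (f i : ℝ) ^ 2 := by
          rw [e]; push_cast
          apply one_div_le_one_div_of_le (by positivity)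
          exact pow_le_pow_right₀ hp h
        linarith [hg0 (f i)]
    obtain ⟨c, hc, x0, h⟩ := posLow_sieve (fun i : ι => i.1) (fun i => i.2.2) (fun i => i.2.1.ne_top) h2
    have h3 : ∀ x, cntI {a : Ideal (𝓞 K) | ∀ i : ι, ¬ i.1 ∣ a} x ≤ 1 := by
      intro x
      rw [cntI, Set.ncard_le_one (finJ _ _)]
      have : ∀ a : Ideal (𝓞 K), (∀ i : ι, ¬ i.1 ∣ a) → a ≠ ⊥ → a = ⊤ := by
        intro a ha ha'
        by_contra hh
        obtain ⟨M, hM, hM'⟩ := Ideal.exists_le_maximal a hh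
        refine ha ⟨M, hM.isPrime, ?_⟩ (Ideal.dvd_iff_le.mpr hM')
        rintro rfl
        exact ha' (le_bot_iff.mp hM')
      rintro a ⟨ha, ha', _⟩ b ⟨hb, hb', _⟩
      rw [this a ha ha', this b hb hb']
    have h4 := h (max x0 (2 / c)) (le_max_left _ _)
    have h5 : ((cntI {a : Ideal (𝓞 K) | ∀ i : ι, ¬ i.1 ∣ a} (max x0 (2 / c)) : ℕ) : ℝ) ≤ 1 := by
      exact_mod_cast h3 _
    have h6 : c * (2 / c) ≤ c * max x0 (2 / c) := by gcongr; exact le_max_right _ _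
    have h7 : c * (2 / c) = 2 := by field_simp
    linarith
  · intro p u hu
    rcases u.eq_empty_or_nonempty with rfl | ⟨i, hi⟩
    · simp
    · have hp : p.Prime := hu i hi ▸ hf1 i
      have := card_above (K := K) hp (u.map ⟨Subtype.val, Subtype.val_injective⟩) ?_
      · simpa using this
      · intro P hP
        rw [Finset.mem_map] at hP
        obtain ⟨j, hj, rfl⟩ := hP
        exact ⟨j.2.1, j.2.2, hu j hj ▸ hf2 j⟩

lemma exists_prime_dvd {p : ℕ} (hp : p.Prime) {a : Ideal (𝓞 K)} (ha : a ≠ ⊥)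
    (h : p ∣ Ideal.absNorm a) : ∃ P : Ideal (𝓞 K), P.IsPrime ∧ P ≠ ⊥ ∧ (p : 𝓞 K) ∈ P ∧ P ∣ a := by
  classical
  have e := Ideal.prod_normalizedFactors_eq_self ha
  rw [← e, map_multiset_prod] at h
  obtain ⟨P, hP, hd⟩ := hp.prime.exists_mem_multiset_map_dvd h
  have hPp := UniqueFactorizationMonoid.prime_of_normalized_factor P hP
  have hPP : P.IsPrime := Ideal.isPrime_of_prime hPp
  have hP0 : P ≠ ⊥ := hPp.ne_zero
  obtain ⟨q, hq, hqP⟩ := prime_above hPP hP0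
  obtain ⟨k, hk, e⟩ := absNorm_above hPP.ne_top hq hqP
  rw [e] at hd
  have : p = q := (Nat.prime_dvd_prime_iff_eq hp hq).mp (hp.dvd_of_dvd_pow hd)
  subst this
  exact ⟨P, hPP, hP0, hqP, UniqueFactorizationMonoid.dvd_of_mem_normalizedFactors hP⟩

lemma posLow_sqfree (η : ℕ) (hη : 0 < η) :
    PosLow {a : Ideal (𝓞 K) | a ≠ ⊥ → Squarefree (Ideal.absNorm a) ∧ (Ideal.absNorm a).Coprime η} := by
  classical
  let prA (p : ℕ) (P : Ideal (𝓞 K)) : Prop := P.IsPrime ∧ P ≠ ⊥ ∧ (p : 𝓞 K) ∈ P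
  let good (p : ℕ) (q : Ideal (𝓞 K)) : Prop := p.Prime ∧
    ((prA p q ∧ (p ∣ η ∨ p ^ 2 ≤ Ideal.absNorm q)) ∨ ∃ P1 P2, prA p P1 ∧ prA p P2 ∧ q = P1 * P2)
  let ι := {q : Ideal (𝓞 K) // ∃ p, good p q}
  have hex : ∀ i : ι, ∃ p : ℕ, good p i.1 := fun i => i.2
  choose f hf using hex
  let g : ℕ → ℝ := fun p => (if p ∈ η.divisors then 1 else 0) + 1 / (p : ℝ) ^ 2
  have hg : Summable g := by
    refine Summable.add ?_ (Real.summable_one_div_nat_pow.mpr (by norm_num))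
    refine summable_of_ne_finset_zero (s := η.divisors) fun b hb => if_neg hb
  set D := Module.finrank ℚ K
  -- finite set of primes above p
  have hfinite : ∀ p : ℕ, p.Prime → {P : Ideal (𝓞 K) | prA p P}.Finite := by
    intro p hp
    by_contra hinf
    obtain ⟨u, hu, hc⟩ := (show {P : Ideal (𝓞 K) | prA p P}.Infinite from hinf).exists_subset_card_eq (D + 1)
    have := card_above (K := K) hp u (fun P hP => hu hP)
    omega
  have h0 : ∀ i : ι, i.1 ≠ ⊥ := by
    intro i
    rcases hf i with ⟨hp, ⟨h, _⟩ | ⟨P1, P2, h1, h2, e⟩⟩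
    · exact h.2.1
    · rw [e]; exact mul_ne_zero h1.2.1 h2.2.1
  have h1 : ∀ i : ι, i.1 ≠ ⊤ := by
    intro i
    rcases hf i with ⟨hp, ⟨h, _⟩ | ⟨P1, P2, h1, h2, e⟩⟩
    · exact h.1.ne_top
    · rw [e]; intro hh
      exact h1.1.ne_top (top_le_iff.mp (hh ▸ Ideal.mul_le_left))
  have hsum := summable_fib f (D + D * D) ?_ g (fun p => by
    apply add_nonneg
    · split_ifs <;> norm_num
    · positivity) hg
  · have h2 : Summable fun i : ι => 1 / (Ideal.absNorm i.1 : ℝ) := by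
      refine Summable.of_nonneg_of_le (fun i => by positivity) (fun i => ?_) hsum
      have hpp := (hf i).1
      have hpos : (1:ℝ) ≤ (f i : ℝ) := by exact_mod_cast hpp.one_lt.le
      have hbig : f i ^ 2 ≤ Ideal.absNorm i.1 → 1 / (Ideal.absNorm i.1 : ℝ) ≤ g (f i) := by
        intro hle
        have : 1 / (Ideal.absNorm i.1 : ℝ) ≤ 1 / (f i : ℝ) ^ 2 := by
          apply one_div_le_one_div_of_le (by positivity)
          exact_mod_cast hle
        have h3 : (0:ℝ) ≤ (if f i ∈ η.divisors then 1 else 0) := by split_ifs <;> norm_num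
        simp only [g]; linarith
      rcases (hf i).2 with ⟨h, h' | h'⟩ | ⟨P1, P2, h1, h2, e⟩
      · have : g (f i) = 1 + 1 / (f i : ℝ) ^ 2 := by
          simp only [g]; rw [if_pos (Nat.mem_divisors.mpr ⟨h', hη.ne'⟩)]
        rw [this]
        have h3 : 1 / (Ideal.absNorm i.1 : ℝ) ≤ 1 := by
          rw [div_le_one (by linarith [one_le_absNorm (h0 i)])]; exact one_le_absNorm (h0 i)
        have : 0 ≤ 1 / (f i : ℝ) ^ 2 := by positivity
        linarith
      · exact hbig h'
      · apply hbig
        obtain ⟨k, hk, e1⟩ := absNorm_above h1.1.ne_top hpp h1.2.2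
        obtain ⟨l, hl, e2⟩ := absNorm_above h2.1.ne_top hpp h2.2.2
        rw [e, map_mul, e1, e2, ← pow_add]
        exact Nat.pow_le_pow_right hpp.pos (by omega)
    obtain ⟨c, hc, x0, h⟩ := posLow_sieve (fun i : ι => i.1) h0 h1 h2
    refine ⟨c, hc, x0, fun x hx => (h x hx).trans ?_⟩
    have : {a : Ideal (𝓞 K) | ∀ i : ι, ¬ i.1 ∣ a} ⊆ {a : Ideal (𝓞 K) | a ≠ ⊥ → Squarefree (Ideal.absNorm a) ∧ (Ideal.absNorm a).Coprime η} := by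
      intro a ha ha0
      constructor
      · rw [Nat.squarefree_iff_prime_squarefree]
        intro p hp hpp
        obtain ⟨P, hP1, hP2, hP3, hP4⟩ := exists_prime_dvd hp ha0 ((dvd_mul_right p p).trans hpp)
        obtain ⟨k, hk, e1⟩ := absNorm_above hP1.ne_top hp hP3
        rcases Nat.lt_or_ge k 2 with h | h
        · have : k = 1 := by omega
          subst this
          obtain ⟨b, rfl⟩ := hP4
          rw [map_mul, e1, pow_one] at hpp
          have hpb := Nat.dvd_of_mul_dvd_mul_left hp.pos hpp
          obtain ⟨Q, hQ1, hQ2, hQ3, hQ4⟩ := exists_prime_dvd hp (right_ne_zero_of_mul ha0) hpb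
          exact ha ⟨P * Q, p, hp, Or.inr ⟨P, Q, ⟨hP1, hP2, hP3⟩, ⟨hQ1, hQ2, hQ3⟩, rfl⟩⟩ (mul_dvd_mul_left P hQ4)
        · refine ha ⟨P, p, hp, Or.inl ⟨⟨hP1, hP2, hP3⟩, Or.inr ?_⟩⟩ hP4
          rw [e1]; exact Nat.pow_le_pow_right hp.pos h
      · rw [Nat.coprime_iff_gcd_eq_one]
        by_contra hh
        obtain ⟨p, hp, hpd⟩ := Nat.exists_prime_and_dvd hh
        obtain ⟨P, hP1, hP2, hP3, hP4⟩ := exists_prime_dvd hp ha0 (hpd.trans (Nat.gcd_dvd_left _ _))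
        exact ha ⟨P, p, hp, Or.inl ⟨⟨hP1, hP2, hP3⟩, Or.inl (hpd.trans (Nat.gcd_dvd_right _ _))⟩⟩ hP4
    exact_mod_cast cntI_mono this le_rfl
  · intro p u hu
    rcases u.eq_empty_or_nonempty with rfl | ⟨i, hi⟩
    · simp
    have hp : p.Prime := hu i hi ▸ (hf i).1
    set s := (hfinite p hp).toFinset with hs
    have hsc : s.card ≤ D := card_above (K := K) hp s (fun P hP => by
      rw [hs, Set.Finite.mem_toFinset] at hP; exact hP)
    have hsub : u.map ⟨Subtype.val, Subtype.val_injective⟩ ⊆ s ∪ (s ×ˢ s).image (fun z => z.1 * z.2) := by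
      intro q hq
      rw [Finset.mem_map] at hq
      obtain ⟨j, hj, rfl⟩ := hq
      have := (hf j).2
      rw [hu j hj] at this
      rw [Finset.mem_union]
      rcases this with ⟨h, _⟩ | ⟨P1, P2, h1, h2, e⟩
      · left; rw [hs, Set.Finite.mem_toFinset]; exact h
      · right
        rw [Finset.mem_image]
        refine ⟨(P1, P2), ?_, e.symm⟩
        rw [Finset.mem_product, hs, Set.Finite.mem_toFinset, Set.Finite.mem_toFinset]
        exact ⟨h1, h2⟩
    have h3 := Finset.card_le_card hsub
    rw [Finset.card_map] at h3
    refine h3.trans ((Finset.card_union_le _ _).trans ?_)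
    refine Nat.add_le_add hsc (Finset.card_image_le.trans ?_)
    rw [Finset.card_product]
    exact Nat.mul_le_mul hsc hsc

end BB

lemma exists_root (d : ℕ) (hd : d ≠ 0) (n : ℕ) : ∃ k : ℕ, k ^ d ≤ n ∧ n < (k + 1) ^ d := by
  refine ⟨Nat.findGreatest (fun k => k ^ d ≤ n) n, ?_, ?_⟩
  · exact Nat.findGreatest_spec (P := fun k => k ^ d ≤ n) (Nat.zero_le n) (by simp [zero_pow hd])
  · by_contra h
    push Not at h
    have h2 : Nat.findGreatest (fun k => k ^ d ≤ n) n + 1 ≤ n := (Nat.le_self_pow hd _).trans h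
    have := Nat.le_findGreatest (P := fun k => k ^ d ≤ n) h2 h
    omega

lemma count_mod (m k : ℕ) (hm : 0 < m) (hk : m ≤ k) (w : ZMod m) :
    (((Finset.Icc (-(k:ℤ)) k).filter (fun z : ℤ => (z : ZMod m) = w)).card : ℝ) ≤ 4 * k / m := by
  haveI : NeZero m := ⟨hm.ne'⟩
  have e : (Finset.Icc (-(k:ℤ)) k).filter (fun z : ℤ => (z : ZMod m) = w) =
      {x ∈ Finset.Ioc (-(k:ℤ) - 1) k | x ≡ (w.val : ℤ) [ZMOD m]} := by
    ext z
    simp only [Finset.mem_filter, Finset.mem_Icc, Finset.mem_Ioc]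
    rw [← ZMod.intCast_eq_intCast_iff]
    have hw : (((w.val:ℕ):ℤ) : ZMod m) = w := by rw [Int.cast_natCast, ZMod.natCast_zmod_val]
    rw [hw]
    constructor <;> rintro ⟨h1, h2⟩ <;> refine ⟨⟨by omega, by omega⟩, h2⟩
  rw [e]
  have h := Int.Ioc_filter_modEq_card (-(k:ℤ) - 1) k (r := m) (by exact_mod_cast hm) (w.val : ℤ)
  have hmR : (0:ℝ) < m := by exact_mod_cast hm
  have hkR : (m:ℝ) ≤ k := by exact_mod_cast hk
  have hcast : (({x ∈ Finset.Ioc (-(k:ℤ) - 1) k | x ≡ (w.val : ℤ) [ZMOD m]}.card : ℤ) : ℝ) ≤ 4 * k / m := by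
    rw [h]
    push_cast
    apply max_le _ (by positivity)
    have h1 := Int.floor_le ((((k:ℤ) - (w.val:ℤ) : ℚ)) / ((m:ℤ):ℚ))
    have h2 := Int.lt_floor_add_one (((((-(k:ℤ) - 1 : ℤ):ℚ) - (w.val:ℤ) : ℚ)) / ((m:ℤ):ℚ))
    have h1' : ((⌊(((k:ℤ) - (w.val:ℤ) : ℚ)) / ((m:ℤ):ℚ)⌋ : ℤ) : ℝ) ≤ (((k:ℝ) - (w.val:ℝ))) / (m:ℝ) := by
      exact_mod_cast h1
    have h2' : ((-(k:ℝ) - 1) - (w.val:ℝ)) / (m:ℝ) < ((⌊((((-(k:ℤ) - 1 : ℤ):ℚ) - (w.val:ℤ) : ℚ)) / ((m:ℤ):ℚ)⌋ : ℤ) : ℝ) + 1 := by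
      have h2'' := h2
      push_cast at h2''
      exact_mod_cast h2''
    push_cast at h1' h2'
    have h3 : ((k:ℝ) - (w.val:ℝ)) / (m:ℝ) - ((-(k:ℝ) - 1) - (w.val:ℝ)) / (m:ℝ) + 1 ≤ 4 * k / m := by
      rw [← sub_div, div_add_one hmR.ne', div_le_div_iff_of_pos_right hmR]
      have : (1:ℝ) ≤ m := by exact_mod_cast hm
      linarith
    linarith
  exact_mod_cast hcast

section CC
variable (K : Type) [Field K] [NumberField K]

abbrev bI := Module.Free.ChooseBasisIndex ℤ (𝓞 K)

lemma card_bI : Fintype.card (bI K) = Module.finrank ℚ K := by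
  rw [← Module.finrank_eq_card_chooseBasisIndex, NumberField.RingOfIntegers.rank]

noncomputable def bas : Module.Basis (bI K) ℤ (𝓞 K) := NumberField.RingOfIntegers.basis K

noncomputable def elt (z : bI K → ℤ) : 𝓞 K := ∑ i, z i • bas K i

variable {K} in
lemma elt_sub (z w : bI K → ℤ) : elt K (z - w) = elt K z - elt K w := by
  simp [elt, sub_smul, Finset.sum_sub_distrib]

variable {K} in
lemma elt_repr (z : bI K → ℤ) (i : bI K) : (bas K).repr (elt K z) i = z i := by
  simp only [elt]
  exact congrFun ((bas K).repr_sum_self z) i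

lemma pigeon : ∃ C0 : ℕ, ∀ a : Ideal (𝓞 K), a ≠ ⊥ → ∃ (k : ℕ) (z : bI K → ℤ) (b : Ideal (𝓞 K)),
    k ^ Module.finrank ℚ K ≤ Ideal.absNorm a ∧ (∀ i, |z i| ≤ k) ∧
    a * b = Ideal.span {elt K z} ∧ elt K z ≠ 0 ∧ Ideal.absNorm b ≤ C0 ∧ b ≠ ⊥ := by
  classical
  refine ⟨(ClassGroup.normBound AbsoluteValue.abs (bas K)).toNat, fun a ha => ?_⟩
  have hn : Ideal.absNorm a ≠ 0 := by rwa [Ne, Ideal.absNorm_eq_zero_iff]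
  have hd : Module.finrank ℚ K ≠ 0 := Module.finrank_pos.ne'
  obtain ⟨k, hk1, hk2⟩ := exists_root _ hd (Ideal.absNorm a)
  have hfin : Finite (𝓞 K ⧸ a) := Ideal.finiteQuotientOfFreeOfNeBot a ha
  have : Fintype (𝓞 K ⧸ a) := Fintype.ofFinite _
  have hcard : Fintype.card (𝓞 K ⧸ a) < Fintype.card (bI K → Fin (k + 1)) := by
    rw [Fintype.card_fun, Fintype.card_fin, card_bI, ← Nat.card_eq_fintype_card]
    exact hk2
  obtain ⟨z, w, hzw, he⟩ := Fintype.exists_ne_map_eq_of_card_lt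
    (fun z : bI K → Fin (k + 1) => Ideal.Quotient.mk a (elt K (fun i => (z i : ℤ)))) hcard
  have he' := Ideal.Quotient.eq.mp he
  rw [← elt_sub] at he'
  set y : bI K → ℤ := (fun i => (z i : ℤ)) - fun i => (w i : ℤ) with hy
  have hy0 : elt K y ≠ 0 := by
    intro h0
    apply hzw
    funext i
    have := elt_repr y i
    rw [h0] at this
    simp only [map_zero, Finsupp.coe_zero, Pi.zero_apply, hy, Pi.sub_apply] at this
    apply Fin.ext
    omega
  have hyk : ∀ i, |y i| ≤ k := by
    intro i
    have h1 := (z i).2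
    have h2 := (w i).2
    simp only [hy, Pi.sub_apply]
    rw [abs_le]; omega
  obtain ⟨b, hb⟩ := Ideal.dvd_span_singleton.mpr he'
  have hb0 : b ≠ ⊥ := by
    rintro rfl
    rw [Ideal.mul_bot, Ideal.span_singleton_eq_bot] at hb
    exact hy0 hb
  refine ⟨k, y, b, hk1, hyk, hb.symm, hy0, ?_, hb0⟩
  have hN := ClassGroup.norm_le AbsoluteValue.abs (bas K) (elt K y) (y := k) (fun i => by
    rw [elt_repr]; exact hyk i)
  rw [card_bI] at hN
  have h3 := congrArg Ideal.absNorm hb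
  rw [Ideal.absNorm_span_singleton, map_mul] at h3
  have h4 : ((Ideal.absNorm a : ℤ)) * Ideal.absNorm b ≤ ClassGroup.normBound AbsoluteValue.abs (bas K) * (Ideal.absNorm a : ℤ) := by
    have e : (((Algebra.norm ℤ (elt K y)).natAbs : ℕ) : ℤ) = |Algebra.norm ℤ (elt K y)| := Int.natCast_natAbs _
    have e2 : AbsoluteValue.abs (Algebra.norm ℤ (elt K y)) = |Algebra.norm ℤ (elt K y)| := rfl
    rw [e2, ← e, h3] at hN
    push_cast at hN
    refine hN.trans ?_
    have hpos := ClassGroup.normBound_pos AbsoluteValue.abs (bas K)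
    have : ((k:ℤ) ^ Module.finrank ℚ K) ≤ Ideal.absNorm a := by exact_mod_cast hk1
    exact mul_le_mul_of_nonneg_left this hpos.le
  have h5 : (Ideal.absNorm b : ℤ) ≤ ClassGroup.normBound AbsoluteValue.abs (bas K) := by
    have : (0:ℤ) < Ideal.absNorm a := by exact_mod_cast Nat.pos_of_ne_zero hn
    nlinarith
  omega

lemma box_sum (m k : ℕ) (hm : 0 < m) (hk : m ≤ k) (G : (bI K → ZMod m) → ℝ) (hG : ∀ w, 0 ≤ G w) :
    haveI : NeZero m := ⟨hm.ne'⟩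
    ∑ z ∈ Fintype.piFinset (fun _ : bI K => Finset.Icc (-(k:ℤ)) k), G (fun i => (z i : ZMod m)) ≤
      (4 * k / m : ℝ) ^ Module.finrank ℚ K * ∑ w, G w := by
  classical
  haveI : NeZero m := ⟨hm.ne'⟩
  rw [← Finset.sum_fiberwise_of_maps_to (t := Finset.univ) (g := fun z : bI K → ℤ => (fun i => (z i : ZMod m)))
    (fun _ _ => Finset.mem_univ _), Finset.mul_sum]
  refine Finset.sum_le_sum fun w _ => ?_
  rw [Finset.sum_congr rfl (g := fun _ => G w) (fun z hz => by rw [(Finset.mem_filter.mp hz).2])]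
  rw [Finset.sum_const, nsmul_eq_mul]
  refine mul_le_mul_of_nonneg_right ?_ (hG w)
  have : ({z ∈ Fintype.piFinset (fun _ : bI K => Finset.Icc (-(k:ℤ)) k) | (fun i => (z i : ZMod m)) = w} : Finset (bI K → ℤ)) =
      Fintype.piFinset (fun i : bI K => (Finset.Icc (-(k:ℤ)) k).filter (fun z : ℤ => (z : ZMod m) = w i)) := by
    ext z
    simp only [Finset.mem_filter, Fintype.mem_piFinset, funext_iff]
    exact ⟨fun h i => ⟨h.1 i, h.2 i⟩, fun h => ⟨fun i => (h i).1, fun i => (h i).2⟩⟩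
  rw [this, Fintype.card_piFinset]
  push_cast
  refine (Finset.prod_le_prod (fun _ _ => by positivity) (fun i _ => count_mod m k hm hk (w i))).trans ?_
  rw [Finset.prod_const, Finset.card_univ, card_bI]

lemma weighted_count : ∃ (C0 : ℕ) (C1 : ℝ), 0 < C1 ∧ ∀ (m : ℕ) (hm : 0 < m) (W : ℕ → ℝ)
    (G : ℕ → ℤ → (bI K → ZMod m) → ℝ) (B : ℝ), (∀ t s w, 0 ≤ G t s w) →
    (haveI : NeZero m := ⟨hm.ne'⟩; ∀ t s, 1 ≤ t → t ≤ C0 → (s = 1 ∨ s = -1) → ∑ w, G t s w ≤ B) →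
    (∀ (t : ℕ) (s : ℤ) (z : bI K → ℤ) (n : ℕ), 1 ≤ t → t ≤ C0 → (s = 1 ∨ s = -1) →
      (n : ℤ) * t * s = Algebra.norm ℤ (elt K z) → W n ≤ G t s (fun i => (z i : ZMod m))) →
    ∃ x0 : ℝ, ∀ x : ℝ, x0 ≤ x →
      ∑ a ∈ (finJ (K := K) Set.univ x).toFinset, W (Ideal.absNorm a) ≤
        C1 * x * (B / (m:ℝ) ^ Module.finrank ℚ K) := by
  classical
  obtain ⟨C0, hC0⟩ := pigeon K
  have hfinB := Ideal.finite_setOfPred_absNorm_le (S := 𝓞 K) C0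
  set d := Module.finrank ℚ K with hd
  have hd0 : d ≠ 0 := Module.finrank_pos.ne'
  set Bs := hfinB.toFinset.filter (fun b => b ≠ ⊥) with hBs
  refine ⟨C0, (Bs.card + 1) * 2 * 4 ^ d, by positivity, ?_⟩
  intro m hm W G B hG hB hW
  haveI : NeZero m := ⟨hm.ne'⟩
  refine ⟨(m:ℝ) ^ d, fun x hx => ?_⟩
  have hx0 : (0:ℝ) ≤ x := le_trans (by positivity) hx
  obtain ⟨k, hk1, hk2⟩ := exists_root d hd0 ⌊x⌋₊
  have hmk : m ≤ k := by
    by_contra hh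
    have h1 : k + 1 ≤ m := by omega
    have h2 : (k + 1) ^ d ≤ m ^ d := Nat.pow_le_pow_left h1 d
    have h3 : m ^ d ≤ ⌊x⌋₊ := Nat.le_floor (by exact_mod_cast hx)
    omega
  have hkx : (k:ℝ) ^ d ≤ x := by
    have : ((k ^ d : ℕ) : ℝ) ≤ (⌊x⌋₊ : ℝ) := by exact_mod_cast hk1
    push_cast at this
    exact this.trans (Nat.floor_le hx0)
  set Bx := Fintype.piFinset (fun _ : bI K => Finset.Icc (-(k:ℤ)) k) with hBx
  set Tg := Bs ×ˢ (({1, -1} : Finset ℤ) ×ˢ Bx) with hTg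
  -- choice
  have hch : ∀ a : Ideal (𝓞 K), a ∈ (finJ (K := K) Set.univ x).toFinset →
      ∃ y : Ideal (𝓞 K) × ℤ × (bI K → ℤ), y ∈ Tg ∧ a * y.1 = Ideal.span {elt K y.2.2} ∧
        (Ideal.absNorm a : ℤ) * Ideal.absNorm y.1 * y.2.1 = Algebra.norm ℤ (elt K y.2.2) := by
    intro a ha
    rw [Set.Finite.mem_toFinset] at ha
    obtain ⟨_, ha0, hax⟩ := ha
    obtain ⟨k', z, b, h1, h2, h3, h4, h5, h6⟩ := hC0 a ha0
    have hkk : k' ≤ k := by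
      by_contra hh
      have e1 : (k + 1) ^ d ≤ k' ^ d := Nat.pow_le_pow_left (by omega) d
      have e2 : Ideal.absNorm a ≤ ⌊x⌋₊ := Nat.le_floor hax
      omega
    have hN := congrArg Ideal.absNorm h3
    rw [Ideal.absNorm_span_singleton, map_mul] at hN
    have hzB : z ∈ Bx := by
      rw [hBx, Fintype.mem_piFinset]
      intro i
      rw [Finset.mem_Icc, ← abs_le]
      exact (h2 i).trans (by exact_mod_cast hkk)
    have hbB : b ∈ Bs := by
      rw [hBs, Finset.mem_filter, Set.Finite.mem_toFinset]
      exact ⟨h5, h6⟩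
    rcases Int.natAbs_eq (Algebra.norm ℤ (elt K z)) with h | h
    · refine ⟨(b, 1, z), ?_, h3, ?_⟩
      · rw [hTg, Finset.mem_product, Finset.mem_product]; exact ⟨hbB, by simp, hzB⟩
      · rw [h, ← hN]; push_cast; ring
    · refine ⟨(b, -1, z), ?_, h3, ?_⟩
      · rw [hTg, Finset.mem_product, Finset.mem_product]; exact ⟨hbB, by simp, hzB⟩
      · rw [h, ← hN]; push_cast; ring
  choose! f hf1 hf2 hf3 using hch
  have hinj : Set.InjOn f ((finJ (K := K) Set.univ x).toFinset : Set (Ideal (𝓞 K))) := by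
    intro a ha a' ha' e
    have e1 := hf2 a ha
    have e2 := hf2 a' ha'
    rw [e, ← e2] at e1
    have hb : (f a').1 ≠ 0 := by
      have := hf1 a' ha'
      rw [hTg, Finset.mem_product, hBs, Finset.mem_filter] at this
      exact this.1.2
    exact mul_right_cancel₀ hb e1
  have hmemB : ∀ b ∈ Bs, 1 ≤ Ideal.absNorm b ∧ Ideal.absNorm b ≤ C0 := by
    intro b hb
    rw [hBs, Finset.mem_filter, Set.Finite.mem_toFinset] at hb
    refine ⟨?_, hb.1⟩
    have : Ideal.absNorm b ≠ 0 := by rw [Ne, Ideal.absNorm_eq_zero_iff]; exact hb.2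
    omega
  have step1 : ∑ a ∈ (finJ (K := K) Set.univ x).toFinset, W (Ideal.absNorm a) ≤
      ∑ y ∈ Tg, G (Ideal.absNorm y.1) y.2.1 (fun i => (y.2.2 i : ZMod m)) := by
    calc _ ≤ ∑ a ∈ (finJ (K := K) Set.univ x).toFinset,
          G (Ideal.absNorm (f a).1) (f a).2.1 (fun i => ((f a).2.2 i : ZMod m)) := by
          refine Finset.sum_le_sum fun a ha => ?_
          have hm1 := hf1 a ha
          rw [hTg, Finset.mem_product, Finset.mem_product] at hm1
          refine hW _ _ _ _ (hmemB _ hm1.1).1 (hmemB _ hm1.1).2 (by simpa using hm1.2.1) (hf3 a ha)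
      _ = ∑ y ∈ (finJ (K := K) Set.univ x).toFinset.image f, G (Ideal.absNorm y.1) y.2.1 (fun i => (y.2.2 i : ZMod m)) := by
          rw [Finset.sum_image hinj]
      _ ≤ _ := by
          refine Finset.sum_le_sum_of_subset_of_nonneg ?_ (fun _ _ _ => hG _ _ _)
          intro y hy
          rw [Finset.mem_image] at hy
          obtain ⟨a, ha, rfl⟩ := hy
          exact hf1 a ha
  have hB0 : 0 ≤ (4 * k / m : ℝ) ^ d := by positivity
  have step2 : ∑ y ∈ Tg, G (Ideal.absNorm y.1) y.2.1 (fun i => (y.2.2 i : ZMod m)) ≤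
      ∑ b ∈ Bs, ∑ s ∈ ({1, -1} : Finset ℤ), (4 * k / m : ℝ) ^ d * B := by
    rw [hTg, Finset.sum_product]
    refine Finset.sum_le_sum fun b hb => ?_
    rw [Finset.sum_product]
    refine Finset.sum_le_sum fun s hs => ?_
    refine (box_sum K m k hm hmk (G (Ideal.absNorm b) s) (hG _ _)).trans ?_
    exact mul_le_mul_of_nonneg_left (hB _ _ (hmemB b hb).1 (hmemB b hb).2 (by simpa using hs)) hB0
  have hcard2 : (({1, -1} : Finset ℤ).card : ℝ) = 2 := by simp
  rw [Finset.sum_const, Finset.sum_const, nsmul_eq_mul, nsmul_eq_mul, hcard2] at step2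
  refine step1.trans (step2.trans ?_)
  by_cases hBs0 : Bs.Nonempty
  · obtain ⟨b, hb⟩ := hBs0
    have hBnn : 0 ≤ B := le_trans (Finset.sum_nonneg fun w _ => hG _ _ w)
      (hB _ 1 (hmemB b hb).1 (hmemB b hb).2 (Or.inl rfl))
    have e : (4 * k / m : ℝ) ^ d * B = 4 ^ d * (k:ℝ)^d * (B / (m:ℝ)^d) := by
      rw [div_pow, mul_pow]; ring
    rw [e]
    have hq : 0 ≤ B / (m:ℝ)^d := by positivity
    calc (Bs.card : ℝ) * (2 * (4 ^ d * (k:ℝ)^d * (B / (m:ℝ)^d))) ≤ (Bs.card + 1 : ℝ) * (2 * (4 ^ d * x * (B / (m:ℝ)^d))) := by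
          gcongr
          linarith
      _ = _ := by ring
  · rw [Finset.not_nonempty_iff_eq_empty] at hBs0
    -- top ideal forces nonempty
    exfalso
    obtain ⟨k', z, b, h1, h2, h3, h4, h5, h6⟩ := hC0 ⊤ top_ne_bot
    have hbB : b ∈ Bs := by
      rw [hBs, Finset.mem_filter, Set.Finite.mem_toFinset]
      exact ⟨h5, h6⟩
    rw [hBs0] at hbB
    simp at hbB

end CC

noncomputable def eZ (n : ℕ) (j : ℤ) : ℂ := Complex.exp (2 * Real.pi * Complex.I * j / n)

lemma eZ_std (n : ℕ) [NeZero n] (j : ℤ) : eZ n j = ZMod.stdAddChar (j : ZMod n) := by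
  rw [ZMod.stdAddChar_coe, eZ]

lemma eZ_congr (n : ℕ) [NeZero n] {j k : ℤ} (h : (j : ZMod n) = k) : eZ n j = eZ n k := by
  rw [eZ_std, eZ_std, h]

lemma eZ_norm (n : ℕ) (j : ℤ) : ‖eZ n j‖ = 1 := by
  rw [eZ]
  have : (2 * Real.pi * Complex.I * j / n : ℂ) = ((2 * Real.pi * j / n : ℝ) : ℂ) * Complex.I := by
    push_cast; ring
  rw [this, Complex.norm_exp_ofReal_mul_I]

noncomputable def Tn (R : Type) [CommRing R] (a : R) (n : ℕ) (c : ℤ) : ℂ :=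
  ∑ᶠ φ : R →+* ZMod n, eZ n (c * (φ a).val)

noncomputable def rhoR (R : Type) [CommRing R] (n : ℕ) : ℕ := Nat.card (R →+* ZMod n)

section DD
variable {R : Type} [CommRing R] (a : R)

lemma Tn_congr (n : ℕ) [NeZero n] {c c' : ℤ} (h : (c : ZMod n) = c') : Tn R a n c = Tn R a n c' := by
  unfold Tn
  congr 1
  ext φ
  apply eZ_congr
  push_cast
  rw [h]

lemma Tn_le (n : ℕ) (hf : Finite (R →+* ZMod n)) (c : ℤ) : ‖Tn R a n c‖ ≤ rhoR R n := by
  classical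
  haveI := Fintype.ofFinite (R →+* ZMod n)
  rw [Tn, finsum_eq_sum_of_fintype, rhoR, Nat.card_eq_fintype_card]
  refine (norm_sum_le _ _).trans ?_
  simp [eZ_norm]

noncomputable def homProd (R : Type) [CommRing R] {k m : ℕ} (h : k.Coprime m) :
    (R →+* ZMod (k * m)) ≃ (R →+* ZMod k) × (R →+* ZMod m) where
  toFun φ := ((ZMod.castHom (dvd_mul_right k m) (ZMod k)).comp φ, (ZMod.castHom (dvd_mul_left m k) (ZMod m)).comp φ)
  invFun q := (ZMod.chineseRemainder h).symm.toRingHom.comp (q.1.prod q.2)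
  left_inv φ := by
    ext x
    simp only [RingHom.comp_apply, RingEquiv.toRingHom_eq_coe, RingHom.coe_coe]
    rw [RingEquiv.symm_apply_eq]
    have : ∀ y : ZMod (k * m), ZMod.chineseRemainder h y = (ZMod.castHom (dvd_mul_right k m) (ZMod k) y, ZMod.castHom (dvd_mul_left m k) (ZMod m) y) := by
      intro y
      have := congrArg (fun f : ZMod (k*m) →+* ZMod k × ZMod m => f y) (Subsingleton.elim (ZMod.chineseRemainder h).toRingHom
        ((ZMod.castHom (dvd_mul_right k m) (ZMod k)).prod (ZMod.castHom (dvd_mul_left m k) (ZMod m))))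
      exact this
    rw [this]; rfl
  right_inv q := by
    have h1 : ((ZMod.castHom (dvd_mul_right k m) (ZMod k)).comp (ZMod.chineseRemainder h).symm.toRingHom) = RingHom.fst _ _ := by
      have := Subsingleton.elim (ZMod.castHom (dvd_mul_right k m) (ZMod k))
        ((RingHom.fst _ _).comp (ZMod.chineseRemainder h).toRingHom)
      rw [this]
      ext x <;> simp
    have h2 : ((ZMod.castHom (dvd_mul_left m k) (ZMod m)).comp (ZMod.chineseRemainder h).symm.toRingHom) = RingHom.snd _ _ := by
      have := Subsingleton.elim (ZMod.castHom (dvd_mul_left m k) (ZMod m))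
        ((RingHom.snd _ _).comp (ZMod.chineseRemainder h).toRingHom)
      rw [this]
      ext x <;> simp
    ext1
    · simp only
      rw [← RingHom.comp_assoc, h1]; rfl
    · simp only
      rw [← RingHom.comp_assoc, h2]; rfl

lemma rhoR_mul {k m : ℕ} (h : k.Coprime m) : rhoR R (k * m) = rhoR R k * rhoR R m := by
  rw [rhoR, Nat.card_congr (homProd R h), Nat.card_prod]; rfl

lemma eZ_mul {k m : ℕ} (hk : k ≠ 0) (hm : m ≠ 0) {u w : ℤ} (h : u * k + w * m = 1) (j : ℤ) :
    eZ (k * m) j = eZ k (w * j) * eZ m (u * j) := by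
  rw [eZ, eZ, eZ, ← Complex.exp_add]
  congr 1
  have h' : (u * k + w * m : ℂ) = 1 := by exact_mod_cast h
  have hk' : (k:ℂ) ≠ 0 := by exact_mod_cast hk
  have hm' : (m:ℂ) ≠ 0 := by exact_mod_cast hm
  push_cast
  field_simp
  linear_combination (-(j:ℂ)) * h'

lemma Tn_mul (hfin : ∀ n, n ≠ 0 → Finite (R →+* ZMod n)) {k m : ℕ} (hk : k ≠ 0) (hm : m ≠ 0) {u w : ℤ}
    (h : u * k + w * m = 1) (hc : k.Coprime m) (c : ℤ) :
    Tn R a (k * m) c = Tn R a k (w * c) * Tn R a m (u * c) := by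
  classical
  haveI := hfin k hk
  haveI := hfin m hm
  haveI := hfin (k * m) (mul_ne_zero hk hm)
  haveI := Fintype.ofFinite (R →+* ZMod k)
  haveI := Fintype.ofFinite (R →+* ZMod m)
  haveI := Fintype.ofFinite (R →+* ZMod (k*m))
  haveI : NeZero k := ⟨hk⟩
  haveI : NeZero m := ⟨hm⟩
  haveI : NeZero (k * m) := ⟨mul_ne_zero hk hm⟩
  rw [Tn, Tn, Tn, finsum_eq_sum_of_fintype, finsum_eq_sum_of_fintype, finsum_eq_sum_of_fintype,
    Finset.sum_mul_sum, ← Fintype.sum_prod_type']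
  refine Fintype.sum_equiv (homProd R hc) _ _ fun φ => ?_
  rw [eZ_mul hk hm h]
  congr 1
  · apply eZ_congr
    simp only [homProd, Equiv.coe_fn_mk, RingHom.comp_apply]
    push_cast
    rw [ZMod.natCast_zmod_val, mul_assoc, ZMod.castHom_apply, ← ZMod.natCast_val]
  · apply eZ_congr
    simp only [homProd, Equiv.coe_fn_mk, RingHom.comp_apply]
    push_cast
    rw [ZMod.natCast_zmod_val, mul_assoc, ZMod.castHom_apply, ← ZMod.natCast_val]

noncomputable def Mp (p : ℕ) (c : ZMod p) : ℝ := ‖Tn R a p c.val‖ / rhoR R p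

lemma Mp_nonneg (p : ℕ) (c : ZMod p) : 0 ≤ Mp a p c := by unfold Mp; positivity

lemma Mp_le_one (p : ℕ) (hf : Finite (R →+* ZMod p)) (c : ZMod p) : Mp a p c ≤ 1 :=
  div_le_one_of_le₀ (Tn_le a p hf _) (by positivity)

lemma Mp_mul (p : ℕ) [NeZero p] (hf : Finite (R →+* ZMod p)) (c : ℤ) :
    ‖Tn R a p c‖ = rhoR R p * Mp a p (c : ZMod p) := by
  have : Tn R a p c = Tn R a p (c : ZMod p).val := Tn_congr a p (by simp)
  rw [Mp, ← this]
  by_cases h : (rhoR R p : ℝ) = 0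
  · have := Tn_le a p hf c
    rw [h] at this ⊢
    rw [zero_mul]
    exact le_antisymm this (norm_nonneg _)
  · field_simp

open scoped Classical in
noncomputable def wp (p : ℕ) (c : ℤ) (n : ℕ) : ℝ :=
  if p ∣ n ∧ ¬ p ^ 2 ∣ n then Mp a p ((c : ZMod p) * ((n / p : ℕ) : ZMod p)⁻¹) else 1

lemma wp_nonneg (p : ℕ) (c : ℤ) (n : ℕ) : 0 ≤ wp a p c n := by
  unfold wp; split_ifs
  · exact Mp_nonneg _ _ _
  · exact zero_le_one

lemma wp_le_one (p : ℕ) (hf : Finite (R →+* ZMod p)) (c : ℤ) (n : ℕ) : wp a p c n ≤ 1 := by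
  unfold wp; split_ifs
  · exact Mp_le_one _ _ hf _
  · exact le_rfl

lemma wp_mod {p : ℕ} (hp : p.Prime) (c : ℤ) (n : ℕ) : wp a p c (n % p ^ 2) = wp a p c n := by
  have h1 : p ∣ n % p ^ 2 ↔ p ∣ n := Nat.dvd_mod_iff (dvd_pow_self p two_ne_zero)
  have h2 : p ^ 2 ∣ n % p ^ 2 ↔ p ^ 2 ∣ n := Nat.dvd_mod_iff dvd_rfl
  unfold wp
  simp only [h1, h2]
  have h3 : ((n % p ^ 2 / p : ℕ) : ZMod p) = ((n / p : ℕ) : ZMod p) := by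
    rw [pow_two, Nat.mod_mul_right_div_self, ZMod.natCast_mod]
  rw [h3]

lemma Tn_bound (hfin : ∀ n, n ≠ 0 → Finite (R →+* ZMod n)) (P : Finset ℕ) (hP : ∀ p ∈ P, p.Prime) :
    ∀ (n : ℕ), n ≠ 0 → ∀ c : ℤ, ‖Tn R a n c‖ ≤ rhoR R n * ∏ p ∈ P, wp a p c n := by
  classical
  induction P using Finset.induction_on with
  | empty => intro n hn c; simpa using Tn_le a n (hfin n hn) c
  | insert p P hpP ih =>
    have ih := ih (fun q hq => hP q (Finset.mem_insert_of_mem hq))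
    have hp : p.Prime := hP p (Finset.mem_insert_self _ _)
    intro n hn c
    rw [Finset.prod_insert hpP]
    by_cases hd : p ∣ n ∧ ¬ p ^ 2 ∣ n
    swap
    · have : wp a p c n = 1 := by rw [wp, if_neg hd]
      rw [this, one_mul]; exact ih n hn c
    have hwp : wp a p c n = Mp a p ((c : ZMod p) * ((n / p : ℕ) : ZMod p)⁻¹) := by rw [wp, if_pos hd]
    obtain ⟨⟨m, rfl⟩, hd2⟩ := hd
    have hp0 := hp.ne_zero
    have hm : m ≠ 0 := by rintro rfl; simp at hn
    have hcop : p.Coprime m := by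
      rw [hp.coprime_iff_not_dvd]
      intro h
      exact hd2 (by rw [pow_two]; exact mul_dvd_mul_left p h)
    obtain ⟨u, w, huw⟩ : ∃ u w : ℤ, u * p + w * m = 1 := by
      have := (Nat.isCoprime_iff_coprime (m := p) (n := m)).mpr hcop
      exact this
    haveI : NeZero p := ⟨hp0⟩
    haveI : Fact p.Prime := ⟨hp⟩
    rw [Tn_mul a hfin hp0 hm huw hcop, norm_mul, Mp_mul a p (hfin p hp0), rhoR_mul hcop, hwp,
      Nat.mul_div_cancel_left m hp.pos]
    have e1 : ((w * c : ℤ) : ZMod p) = (c : ZMod p) * (m : ZMod p)⁻¹ := by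
      have h1 : (w : ZMod p) * (m : ZMod p) = 1 := by
        have := congrArg (fun z : ℤ => (z : ZMod p)) huw
        simpa using this
      have : (m : ZMod p)⁻¹ = w := (eq_inv_of_mul_eq_one_left h1).symm
      rw [this]; push_cast; ring
    have e2 : ∏ q ∈ P, wp a q (u * c) m = ∏ q ∈ P, wp a q c (p * m) := by
      refine Finset.prod_congr rfl fun q hq => ?_
      have hqp : q.Prime := hP q (Finset.mem_insert_of_mem hq)
      have hne : q ≠ p := fun h => hpP (h ▸ hq)
      haveI : Fact q.Prime := ⟨hqp⟩
      have hc1 : q.Coprime p := (Nat.coprime_primes hqp hp).mpr hne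
      have d1 : q ∣ p * m ↔ q ∣ m := ⟨fun h => hc1.dvd_of_dvd_mul_left h, fun h => h.mul_left p⟩
      have d2 : q ^ 2 ∣ p * m ↔ q ^ 2 ∣ m :=
        ⟨fun h => (hc1.pow_left 2).dvd_of_dvd_mul_left h, fun h => h.mul_left p⟩
      unfold wp
      simp only [d1, d2]
      split_ifs with hh
      · obtain ⟨⟨l, rfl⟩, hh2⟩ := hh
        have : p * (q * l) = q * (p * l) := by ring
        rw [this, Nat.mul_div_cancel_left _ hqp.pos, Nat.mul_div_cancel_left _ hqp.pos]
        congr 1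
        have h1 : (u : ZMod q) * (p : ZMod q) = 1 := by
          have := congrArg (fun z : ℤ => (z : ZMod q)) huw
          simpa using this
        have hpq : (p : ZMod q) ≠ 0 := right_ne_zero_of_mul_eq_one h1
        have h3 : (u : ZMod q) = (p : ZMod q)⁻¹ := eq_inv_of_mul_eq_one_left h1
        push_cast
        rw [h3, mul_inv]; ring
      · rfl
    rw [e1, ← e2]
    have := ih m hm (u * c)
    have hM := Mp_nonneg a p ((c : ZMod p) * (m : ZMod p)⁻¹)
    push_cast
    calc _ ≤ (rhoR R p : ℝ) * Mp a p ((c : ZMod p) * (m : ZMod p)⁻¹) * (rhoR R m * ∏ q ∈ P, wp a q (u * c) m) := by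
          gcongr
      _ = _ := by ring

end DD

section EE
variable {R : Type} [CommRing R] (a : R)

lemma sum_norm_le (p : ℕ) [Fact p.Prime] (r s : ZMod p) (h : r ≠ s) :
    ∑ c : ZMod p, ‖(ZMod.stdAddChar (c * r) + ZMod.stdAddChar (c * s) : ℂ)‖ ≤ Real.sqrt 2 * p := by
  have h0 : ∑ c : ZMod p, (ZMod.stdAddChar (c * (r - s)) : ℂ) = 0 := by
    have := AddChar.sum_mulShift (R := ZMod p) (R' := ℂ) (ψ := ZMod.stdAddChar) (r - s) (ZMod.isPrimitive_stdAddChar p)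
    rw [this, if_neg (sub_ne_zero.mpr h)]; simp
  have hn : ∀ z : ZMod p, Complex.normSq (ZMod.stdAddChar z : ℂ) = 1 := by
    intro z
    rw [Complex.normSq_eq_norm_sq, AddChar.norm_apply, one_pow]
  have hsq : ∀ c : ZMod p, ‖(ZMod.stdAddChar (c * r) + ZMod.stdAddChar (c * s) : ℂ)‖ ^ 2 =
      2 + 2 * (ZMod.stdAddChar (c * (r - s)) : ℂ).re := by
    intro c
    rw [← Complex.normSq_eq_norm_sq, Complex.normSq_add, hn, hn, mul_sub, sub_eq_add_neg, AddChar.map_add_eq_mul, AddChar.map_neg_eq_conj]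
    ring
  have hs2 : ∑ c : ZMod p, ‖(ZMod.stdAddChar (c * r) + ZMod.stdAddChar (c * s) : ℂ)‖ ^ 2 = 2 * p := by
    simp_rw [hsq]
    rw [Finset.sum_add_distrib, ← Finset.mul_sum, ← Complex.re_sum, h0]
    simp [ZMod.card]; ring
  have hcs := sq_sum_le_card_mul_sum_sq (s := (Finset.univ : Finset (ZMod p)))
    (f := fun c => ‖(ZMod.stdAddChar (c * r) + ZMod.stdAddChar (c * s) : ℂ)‖)
  rw [hs2, Finset.card_univ, ZMod.card] at hcs
  refine abs_le_of_sq_le_sq' ?_ (by positivity) |>.2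
  rw [mul_pow, Real.sq_sqrt (by norm_num)]
  linarith

lemma Mp_saving (p : ℕ) [Fact p.Prime] (hf : Finite (R →+* ZMod p)) (D : ℕ) (hD : rhoR R p ≤ D)
    (φ1 φ2 : R →+* ZMod p) (h : φ1 a ≠ φ2 a) :
    (p : ℝ) * (2 - Real.sqrt 2) / D ≤ ∑ c : ZMod p, (1 - Mp a p c) := by
  classical
  haveI := Fintype.ofFinite (R →+* ZMod p)
  have hne : φ1 ≠ φ2 := fun e => h (by rw [e])
  have hcard : rhoR R p = Fintype.card (R →+* ZMod p) := Nat.card_eq_fintype_card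
  have hρ : 0 < rhoR R p := by
    rw [hcard]; exact Fintype.card_pos_iff.mpr ⟨φ1⟩
  have hρ' : (0:ℝ) < rhoR R p := by exact_mod_cast hρ
  have hD' : (rhoR R p : ℝ) ≤ D := by exact_mod_cast hD
  have key : ∀ c : ZMod p, (2 - ‖(ZMod.stdAddChar (c * φ1 a) + ZMod.stdAddChar (c * φ2 a) : ℂ)‖) / D ≤ 1 - Mp a p c := by
    intro c
    set E := ‖(ZMod.stdAddChar (c * φ1 a) + ZMod.stdAddChar (c * φ2 a) : ℂ)‖ with hE
    have hE2 : E ≤ 2 := by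
      rw [hE]; refine (norm_add_le _ _).trans ?_
      rw [AddChar.norm_apply, AddChar.norm_apply]; norm_num
    have hT : ‖Tn R a p c.val‖ ≤ E + (rhoR R p - 2) := by
      have e : Tn R a p c.val = ∑ φ : R →+* ZMod p, (ZMod.stdAddChar (c * φ a) : ℂ) := by
        rw [Tn, finsum_eq_sum_of_fintype]
        refine Finset.sum_congr rfl fun φ _ => ?_
        rw [eZ_std]; push_cast; rw [ZMod.natCast_zmod_val, ZMod.natCast_zmod_val]
      have e2 : (Finset.univ : Finset (R →+* ZMod p)) = {φ1, φ2} ∪ ({φ1, φ2} : Finset (R →+* ZMod p))ᶜ := (Finset.union_compl _).symm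
      rw [e, e2, Finset.sum_union disjoint_compl_right, Finset.sum_pair hne]
      refine (norm_add_le _ _).trans ?_
      refine add_le_add le_rfl ((norm_sum_le _ _).trans ?_)
      simp only [AddChar.norm_apply, Finset.sum_const, nsmul_eq_mul, mul_one]
      have : (({φ1, φ2} : Finset (R →+* ZMod p))ᶜ).card + 2 = rhoR R p := by
        rw [hcard, ← Finset.card_add_card_compl ({φ1, φ2} : Finset (R →+* ZMod p)), Finset.card_pair hne]; ring
      have : (((({φ1, φ2} : Finset (R →+* ZMod p))ᶜ).card : ℝ)) + 2 = rhoR R p := by exact_mod_cast this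
      linarith
    have : 1 - Mp a p c = (rhoR R p - ‖Tn R a p c.val‖) / rhoR R p := by
      rw [Mp]; field_simp
    rw [this]
    calc (2 - E) / D ≤ (2 - E) / rhoR R p := by
          apply div_le_div_of_nonneg_left (by linarith) hρ' hD'
      _ ≤ _ := div_le_div_of_nonneg_right (by linarith) hρ'.le
  calc (p : ℝ) * (2 - Real.sqrt 2) / D ≤ ∑ c : ZMod p, (2 - ‖(ZMod.stdAddChar (c * φ1 a) + ZMod.stdAddChar (c * φ2 a) : ℂ)‖) / D := by
        rw [← Finset.sum_div, Finset.sum_sub_distrib]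
        have := sum_norm_le p _ _ h
        simp only [Finset.sum_const, Finset.card_univ, ZMod.card, nsmul_eq_mul]
        gcongr
        linarith
    _ ≤ _ := Finset.sum_le_sum fun c _ => key c

lemma Mp_zero (p : ℕ) (hf : Finite (R →+* ZMod p)) (φ : R →+* ZMod p) : Mp a p 0 = 1 := by
  classical
  haveI := Fintype.ofFinite (R →+* ZMod p)
  have hcard : rhoR R p = Fintype.card (R →+* ZMod p) := Nat.card_eq_fintype_card
  have hρ : 0 < rhoR R p := by
    rw [hcard]; exact Fintype.card_pos_iff.mpr ⟨φ⟩
  have hρ' : (0:ℝ) < rhoR R p := by exact_mod_cast hρ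
  have : Tn R a p ((0 : ZMod p).val : ℤ) = rhoR R p := by
    rw [Tn, finsum_eq_sum_of_fintype, hcard]
    simp [eZ]
  rw [Mp, this, Complex.norm_natCast, div_self hρ'.ne']

lemma sum_wp (p : ℕ) [Fact p.Prime] (hf : Finite (R →+* ZMod p)) (φ : R →+* ZMod p) (h : ℤ) (hh : (h : ZMod p) ≠ 0) :
    ∑ c : ZMod p, (1 - Mp a p c) ≤ ∑ z : ZMod (p ^ 2), (1 - wp a p h z.val) := by
  classical
  have hp : p.Prime := Fact.out
  have h1 : ∑ c : ZMod p, (1 - Mp a p c) = ∑ c ∈ (Finset.univ : Finset (ZMod p)).filter (fun c => c ≠ 0), (1 - Mp a p c) := by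
    rw [Finset.sum_filter]
    refine Finset.sum_congr rfl fun c _ => ?_
    split_ifs with hc
    · rfl
    · push Not at hc; rw [hc, Mp_zero a p hf φ, sub_self]
  rw [h1]
  let f : ZMod p → ZMod (p ^ 2) := fun c => ((p * (h * c⁻¹).val : ℕ) : ZMod (p ^ 2))
  have hfval : ∀ c, (f c).val = p * ((h : ZMod p) * c⁻¹).val := by
    intro c
    apply ZMod.val_cast_of_lt
    rw [pow_two]
    exact Nat.mul_lt_mul_of_pos_left (ZMod.val_lt _) hp.pos
  have hinj : Set.InjOn f ((Finset.univ : Finset (ZMod p)).filter (fun c => c ≠ 0) : Set (ZMod p)) := by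
    intro c _ c' _ e
    have := congrArg ZMod.val e
    rw [hfval, hfval] at this
    have := ZMod.val_injective p (Nat.eq_of_mul_eq_mul_left hp.pos this)
    exact inv_injective (mul_left_cancel₀ hh this)
  calc _ = ∑ c ∈ (Finset.univ : Finset (ZMod p)).filter (fun c => c ≠ 0), (1 - wp a p h (f c).val) := by
        refine Finset.sum_congr rfl fun c hc => ?_
        have hc : c ≠ 0 := (Finset.mem_filter.mp hc).2
        have hne : (h : ZMod p) * c⁻¹ ≠ 0 := mul_ne_zero hh (inv_ne_zero hc)
        rw [hfval, wp, if_pos, Nat.mul_div_cancel_left _ hp.pos, ZMod.natCast_zmod_val]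
        · congr 2; field_simp
        · refine ⟨dvd_mul_right _ _, ?_⟩
          rw [pow_two]
          intro hd
          have hd := Nat.dvd_of_mul_dvd_mul_left hp.pos hd
          have h0 := Nat.eq_zero_of_dvd_of_lt hd (ZMod.val_lt _)
          exact hne ((ZMod.val_eq_zero _).mp h0)
    _ = ∑ z ∈ ((Finset.univ : Finset (ZMod p)).filter (fun c => c ≠ 0)).image f, (1 - wp a p h z.val) := by
        rw [Finset.sum_image hinj]
    _ ≤ _ := Finset.sum_le_sum_of_subset_of_nonneg (Finset.subset_univ _)
        fun z _ _ => sub_nonneg.mpr (wp_le_one a p hf h _)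

lemma sum_prod_ge {ι : Type} [Fintype ι] [DecidableEq ι] (i0 : ι) (q : ℕ) [NeZero q] (g : ZMod q → ℝ) (hg : ∀ z, 0 ≤ g z) (u : (ZMod q)ˣ) :
    (q.totient : ℝ) ^ (Fintype.card ι - 1) * ∑ z, g z ≤ ∑ y : ι → ZMod q, g (u * ∏ i, y i) := by
  classical
  rw [← (Equiv.funSplitAt i0 (ZMod q)).symm.sum_comp, Fintype.sum_prod_type_right]
  let S : Finset ({j // j ≠ i0} → ZMod q) := Finset.univ.image (fun (x : {j // j ≠ i0} → (ZMod q)ˣ) j => (x j : ZMod q))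
  have hS : S.card = q.totient ^ (Fintype.card ι - 1) := by
    rw [Finset.card_image_of_injective, Finset.card_univ, Fintype.card_fun, ZMod.card_units_eq_totient, Fintype.card_subtype_compl, Fintype.card_subtype_eq]
    intro x x' e
    ext j
    exact congrFun e j
  calc _ = ∑ y ∈ S, ∑ z, g z := by rw [Finset.sum_const, hS, nsmul_eq_mul]; push_cast; rfl
    _ = ∑ y ∈ S, ∑ z, g (u * ∏ i, (Equiv.funSplitAt i0 (ZMod q)).symm (z, y) i) := by
        refine Finset.sum_congr rfl fun y hy => ?_
        obtain ⟨x, -, rfl⟩ := Finset.mem_image.mp hy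
        let U : (ZMod q)ˣ := u * ∏ j, x j
        rw [← Equiv.sum_comp (Units.mulLeft U) g]
        refine Finset.sum_congr rfl fun z _ => ?_
        congr 1
        rw [Units.mulLeft_apply, Fintype.prod_eq_mul_prod_subtype_ne _ i0]
        have e1 : (Equiv.funSplitAt i0 (ZMod q)).symm (z, fun j => ((x j : ZMod q))) i0 = z := by simp [Equiv.funSplitAt, Equiv.piSplitAt]
        have e2 : ∀ j : {j // j ≠ i0}, (Equiv.funSplitAt i0 (ZMod q)).symm (z, fun j => ((x j : ZMod q))) j = x j := by
          intro j; simp [Equiv.funSplitAt, Equiv.piSplitAt, j.2]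
        simp only [e1, e2, U, Units.val_mul, Units.coe_prod]
        ring
    _ ≤ _ := Finset.sum_le_sum_of_subset_of_nonneg (Finset.subset_univ _)
        fun _ _ _ => Finset.sum_nonneg fun _ _ => hg _

lemma local_bound {ι : Type} [Fintype ι] [DecidableEq ι] [Nonempty ι] (p : ℕ) [Fact p.Prime]
    (hf : Finite (R →+* ZMod p)) (D : ℕ) (hD : rhoR R p ≤ D)
    (φ1 φ2 : R →+* ZMod p) (hφ : φ1 a ≠ φ2 a) (h : ℤ) (hh : (h : ZMod p) ≠ 0) (u : (ZMod (p ^ 2))ˣ) :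
    ∑ y : ι → ZMod (p ^ 2), wp a p h ((u : ZMod (p ^ 2)) * ∏ i, y i).val ≤
      ((p ^ 2 : ℕ) : ℝ) ^ Fintype.card ι * (1 - ((2 - Real.sqrt 2) / D / 2 ^ Fintype.card ι) / p) := by
  have hp : p.Prime := Fact.out
  obtain ⟨i0⟩ := ‹Nonempty ι›
  have h1 := sum_prod_ge i0 (p ^ 2) (fun z => 1 - wp a p h z.val) (fun z => sub_nonneg.mpr (wp_le_one a p hf h _)) u
  have h2 := (Mp_saving a p hf D hD φ1 φ2 hφ).trans (sum_wp a p hf φ1 h hh)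
  have h6 : ∑ y : ι → ZMod (p ^ 2), (1 - wp a p h ((u : ZMod (p ^ 2)) * ∏ i, y i).val) =
      ((p ^ 2 : ℕ) : ℝ) ^ Fintype.card ι - ∑ y : ι → ZMod (p ^ 2), wp a p h ((u : ZMod (p ^ 2)) * ∏ i, y i).val := by
    rw [Finset.sum_sub_distrib, Finset.sum_const, Finset.card_univ, Fintype.card_fun, ZMod.card]; simp
  rw [h6] at h1
  have hs2 : 0 ≤ 2 - Real.sqrt 2 := by
    have : Real.sqrt 2 ≤ 2 := by rw [Real.sqrt_le_left (by norm_num)]; norm_num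
    linarith
  have ht : ((p ^ 2 : ℕ) : ℝ) / 2 ≤ ((p ^ 2).totient : ℝ) := by
    rw [Nat.totient_prime_pow hp (by norm_num)]
    have : (2:ℝ) ≤ p := by exact_mod_cast hp.two_le
    rw [Nat.cast_mul, Nat.cast_sub hp.one_le]
    push_cast
    simp only [Nat.add_one_sub_one, pow_one]
    nlinarith
  have hc : Fintype.card ι - 1 + 1 = Fintype.card ι := Nat.succ_pred_eq_of_pos (Fintype.card_pos_iff.mpr ⟨i0⟩)
  set k := Fintype.card ι - 1 with hk
  rw [← hc] at h1 ⊢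
  have h3 : (((p ^ 2 : ℕ) : ℝ) / 2) ^ k * ((p : ℝ) * (2 - Real.sqrt 2) / D) ≤
      (((p ^ 2).totient : ℝ)) ^ k * ∑ z : ZMod (p ^ 2), (1 - wp a p h z.val) := by
    gcongr
  have hp0 : (p:ℝ) ≠ 0 := by exact_mod_cast hp.ne_zero
  have h4 : ((p ^ 2 : ℕ) : ℝ) ^ (k + 1) * (1 - ((2 - Real.sqrt 2) / D / 2 ^ (k + 1)) / p) =
      ((p ^ 2 : ℕ) : ℝ) ^ (k + 1) - (((p ^ 2 : ℕ) : ℝ) / 2) ^ k * ((p : ℝ) * (2 - Real.sqrt 2) / D) / 2 := by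
    push_cast
    rw [div_pow]
    field_simp
    ring
  have h5 : 0 ≤ (((p ^ 2 : ℕ) : ℝ) / 2) ^ k * ((p : ℝ) * (2 - Real.sqrt 2) / D) := by positivity
  rw [h4]
  push_cast at h1 h3 h5 ⊢
  linarith

end EE

section FF

lemma zhom_ext {A : Type} [CommRing A] {n : ℕ} [NeZero n] {φ ψ : A →+* ZMod n}
    (h : RingHom.ker φ = RingHom.ker ψ) : φ = ψ := by
  ext x
  have h1 : x - ((φ x).val : A) ∈ RingHom.ker φ := by
    rw [RingHom.mem_ker, map_sub, map_natCast, ZMod.natCast_zmod_val, sub_self]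
  rw [h, RingHom.mem_ker, map_sub, map_natCast, ZMod.natCast_zmod_val, sub_eq_zero] at h1
  exact h1.symm

lemma card_quot_ker {A : Type} [CommRing A] {n : ℕ} (φ : A →+* ZMod n) :
    Nat.card (A ⧸ RingHom.ker φ) = n := by
  rw [Nat.card_congr (RingHom.quotientKerEquivOfSurjective (ZMod.ringHom_surjective φ)).toEquiv, Nat.card_zmod]

/-- If the characteristic of a quotient equals its cardinality there is a hom with that kernel. -/
lemma exists_hom_of_char {A : Type} [CommRing A] {n : ℕ} (hn : n ≠ 0) (I : Ideal A)
    (hc : Nat.card (A ⧸ I) = n) (hch : ∀ m : ℕ, (m : A) ∈ I → n ∣ m) (hn0 : (n : A) ∈ I) :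
    ∃ φ : A →+* ZMod n, RingHom.ker φ = I := by
  haveI : NeZero n := ⟨hn⟩
  haveI : CharP (A ⧸ I) n := by
    refine ⟨fun m => ?_⟩
    rw [← map_natCast (Ideal.Quotient.mk I), Ideal.Quotient.eq_zero_iff_mem]
    refine ⟨hch m, ?_⟩
    rintro ⟨k, rfl⟩
    push_cast
    exact I.mul_mem_right _ hn0
  haveI : Finite (A ⧸ I) := Nat.finite_of_card_ne_zero (by rw [hc]; exact hn)
  have hinj := ZMod.castHom_injective (A ⧸ I) (n := n)
  have hbij : Function.Bijective (ZMod.castHom (dvd_refl n) (A ⧸ I)) := by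
    rw [Nat.bijective_iff_injective_and_card]
    exact ⟨hinj, by rw [hc, Nat.card_zmod]⟩
  let e := RingEquiv.ofBijective _ hbij
  refine ⟨e.symm.toRingHom.comp (Ideal.Quotient.mk I), ?_⟩
  ext x
  rw [RingHom.mem_ker, RingHom.comp_apply]
  simp only [RingEquiv.toRingHom_eq_coe, RingHom.coe_coe, EmbeddingLike.map_eq_zero_iff]
  exact Ideal.Quotient.eq_zero_iff_mem

variable {L : Type} [Field L] [NumberField L] {η : ℕ}

lemma rring_form (hη : 0 < η) (x : Rring L η) : ∃ (b : 𝓞 L) (k : ℕ), (η : Rring L η) ^ k * x = algebraMap (𝓞 L) (Rring L η) b := by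
  have hη0 : (η : L) ≠ 0 := by exact_mod_cast hη.ne'
  have key : ∀ y ∈ Rring L η, ∃ (b : 𝓞 L) (k : ℕ), (η : L) ^ k * y = algebraMap (𝓞 L) L b := by
    intro y hy
    induction hy using Algebra.adjoin_induction with
    | mem y hy =>
      refine ⟨1, 1, ?_⟩
      rw [Set.mem_singleton_iff.mp hy]; simp [hη0]
    | algebraMap r => exact ⟨r, 0, by simp⟩
    | add y z _ _ h1 h2 =>
      obtain ⟨b, k, h1⟩ := h1
      obtain ⟨b', k', h2⟩ := h2
      refine ⟨(η : 𝓞 L) ^ k' * b + (η : 𝓞 L) ^ k * b', k + k', ?_⟩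
      simp only [map_add, map_mul, map_pow, map_natCast]
      rw [← h1, ← h2]; ring
    | mul y z _ _ h1 h2 =>
      obtain ⟨b, k, h1⟩ := h1
      obtain ⟨b', k', h2⟩ := h2
      refine ⟨b * b', k + k', ?_⟩
      simp only [map_mul]
      rw [← h1, ← h2]; ring
  obtain ⟨b, k, h⟩ := key x x.2
  refine ⟨b, k, ?_⟩
  apply Subtype.ext
  push_cast
  exact h

lemma algMap_inj : Function.Injective (algebraMap (𝓞 L) (Rring L η)) := by
  intro x y h
  have := congrArg (Subtype.val) h
  exact RingOfIntegers.ext this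

lemma isLoc (hη : 0 < η) : IsLocalization.Away ((η : 𝓞 L)) (Rring L η) := by
  have hη0 : (η : L) ≠ 0 := by exact_mod_cast hη.ne'
  have hu : IsUnit (algebraMap (𝓞 L) (Rring L η) (η : 𝓞 L)) := by
    rw [map_natCast]
    refine IsUnit.of_mul_eq_one ⟨(η : L)⁻¹, Algebra.subset_adjoin rfl⟩ ?_
    apply Subtype.ext
    push_cast
    exact mul_inv_cancel₀ hη0
  refine ⟨⟨?_, ?_, ?_⟩⟩
  · rintro ⟨y, k, rfl⟩
    rw [map_pow]; exact hu.pow k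
  · intro z
    obtain ⟨b, k, h⟩ := rring_form hη z
    refine ⟨(b, ⟨(η : 𝓞 L) ^ k, k, rfl⟩), ?_⟩
    rw [← h, map_pow, map_natCast, mul_comm]
  · intro x y h
    exact ⟨1, by rw [algMap_inj h]⟩

lemma hom_res_inj (hη : 0 < η) {n : ℕ} {φ ψ : Rring L η →+* ZMod n}
    (h : φ.comp (algebraMap (𝓞 L) (Rring L η)) = ψ.comp (algebraMap (𝓞 L) (Rring L η))) : φ = ψ := by
  haveI := isLoc (L := L) hη
  exact IsLocalization.ringHom_ext (Submonoid.powers (η : 𝓞 L)) h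

lemma hom_extend (hη : 0 < η) {n : ℕ} (hc : n.Coprime η) (φ : 𝓞 L →+* ZMod n) :
    ∃ ψ : Rring L η →+* ZMod n, ψ.comp (algebraMap (𝓞 L) (Rring L η)) = φ := by
  haveI := isLoc (L := L) hη
  have hu : IsUnit (φ (η : 𝓞 L)) := by
    rw [map_natCast, ZMod.isUnit_iff_coprime]; exact hc.symm
  exact ⟨IsLocalization.Away.lift (η : 𝓞 L) hu, IsLocalization.Away.lift_comp (η : 𝓞 L) hu⟩

lemma absNorm_ker {n : ℕ} (φ : 𝓞 L →+* ZMod n) : Ideal.absNorm (RingHom.ker φ) = n := by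
  rw [Ideal.absNorm_apply, Submodule.cardQuot_apply]; exact card_quot_ker φ

lemma hom_card (hη : 0 < η) {n : ℕ} (hn : n ≠ 0) :
    Finite (Rring L η →+* ZMod n) ∧
      rhoR (Rring L η) n ≤ Nat.card {a : Ideal (𝓞 L) // Ideal.absNorm a = n} := by
  haveI : NeZero n := ⟨hn⟩
  have hfin : Finite {a : Ideal (𝓞 L) // Ideal.absNorm a = n} :=
    (Ideal.finite_setOfPred_absNorm_eq (S := 𝓞 L) n).to_subtype
  let f : (Rring L η →+* ZMod n) → {a : Ideal (𝓞 L) // Ideal.absNorm a = n} :=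
    fun φ => ⟨RingHom.ker (φ.comp (algebraMap (𝓞 L) (Rring L η))), absNorm_ker _⟩
  have hinj : Function.Injective f := by
    intro φ ψ h
    exact hom_res_inj hη (zhom_ext (congrArg Subtype.val h))
  exact ⟨Finite.of_injective f hinj, Nat.card_le_card_of_injective f hinj⟩

lemma rho_prime_le (hη : 0 < η) {p : ℕ} (hp : p.Prime) :
    rhoR (Rring L η) p ≤ Module.finrank ℚ L := by
  refine (hom_card hη hp.ne_zero).2.trans ?_
  have hfin := Ideal.finite_setOfPred_absNorm_eq (S := 𝓞 L) p
  have : Nat.card {a : Ideal (𝓞 L) // Ideal.absNorm a = p} = hfin.toFinset.card := by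
    rw [← Set.ncard_eq_toFinset_card _ hfin]; rfl
  rw [this]
  refine card_above hp _ fun P hP => ?_
  have hP : Ideal.absNorm P = p := by simpa using hP
  refine ⟨Ideal.isPrime_of_irreducible_absNorm (by rw [hP]; exact hp), ?_, ?_⟩
  · rintro rfl; rw [Ideal.absNorm_bot] at hP; exact hp.ne_zero hP.symm
  · rw [← hP]; exact Ideal.absNorm_mem P

lemma ker_mem (hη : 0 < η) {n : ℕ} (hn : n ≠ 0) (φ : Rring L η →+* ZMod n) :
    RingHom.ker φ ∈ Sset L η n := by
  refine ⟨⟨?_, ?_⟩, card_quot_ker φ⟩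
  · intro h
    have : (n : Rring L η) ∈ RingHom.ker φ := by
      rw [RingHom.mem_ker, map_natCast, ZMod.natCast_self]
    rw [h, Ideal.mem_bot] at this
    exact hn (by exact_mod_cast this)
  · haveI : NeZero n := ⟨hn⟩
    intro y
    obtain ⟨x, rfl⟩ := Ideal.Quotient.mk_surjective y
    refine ⟨((φ x).val : ℤ), ?_⟩
    rw [eq_intCast, Int.cast_natCast, ← map_natCast (Ideal.Quotient.mk (RingHom.ker φ)), Ideal.Quotient.eq, RingHom.mem_ker, map_sub, map_natCast, ZMod.natCast_zmod_val, sub_self]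

lemma degOne_finite (hη : 0 < η) {I : Ideal (Rring L η)} (h : DegOne I) : idealNorm I ≠ 0 := by
  obtain ⟨x, hx, hx0⟩ := Submodule.exists_mem_ne_zero_of_ne_bot h.1
  obtain ⟨b, k, hb⟩ := rring_form hη x
  have hb0 : b ≠ 0 := by
    rintro rfl
    rw [map_zero] at hb
    have hη0 : (η : Rring L η) ≠ 0 := by exact_mod_cast hη.ne'
    rcases mul_eq_zero.mp hb with h | h
    · exact pow_ne_zero _ hη0 h
    · exact hx0 h
  have hN : (Ideal.absNorm (Ideal.span {b}) : Rring L η) ∈ I := by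
    have h1 := Ideal.absNorm_mem (Ideal.span {b})
    obtain ⟨c, hc⟩ := Ideal.mem_span_singleton.mp h1
    have := congrArg (algebraMap (𝓞 L) (Rring L η)) hc
    rw [map_natCast, map_mul, ← hb] at this
    rw [this]
    exact I.mul_mem_right _ (I.mul_mem_left _ hx)
  set N := Ideal.absNorm (Ideal.span {b}) with hNd
  have hN0 : N ≠ 0 := by
    rw [hNd, Ne, Ideal.absNorm_eq_zero_iff, Ideal.span_singleton_eq_bot]; exact hb0
  have hz : ((N : ℤ) : Rring L η ⧸ I) = 0 := by
    rw [Int.cast_natCast, ← map_natCast (Ideal.Quotient.mk I), Ideal.Quotient.eq_zero_iff_mem]; exact hN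
  have : Finite (Rring L η ⧸ I) := by
    haveI : NeZero N := ⟨hN0⟩
    refine Finite.of_surjective (fun z : Fin N => ((z : ℤ) : Rring L η ⧸ I)) fun y => ?_
    obtain ⟨z, rfl⟩ := h.2 y
    have hNpos : (0:ℤ) < N := by exact_mod_cast Nat.pos_of_ne_zero hN0
    have h1 := Int.emod_nonneg z hNpos.ne'
    have h2 := Int.emod_lt_of_pos z hNpos
    refine ⟨⟨(z % N).toNat, by omega⟩, ?_⟩
    simp only [eq_intCast]
    rw [Int.toNat_of_nonneg h1, Int.emod_def, Int.cast_sub, Int.cast_mul, hz, zero_mul, sub_zero]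
  exact Nat.card_pos.ne'

lemma ker_surj (hη : 0 < η) {n : ℕ} (hn : n ≠ 0) {I : Ideal (Rring L η)} (h : I ∈ Sset L η n) :
    ∃ φ : Rring L η →+* ZMod n, RingHom.ker φ = I := by
  obtain ⟨⟨h0, hs⟩, hc⟩ := h
  have hc : Nat.card (Rring L η ⧸ I) = n := hc
  have hfin : Finite (Rring L η ⧸ I) := Nat.finite_of_card_ne_zero (by rw [hc]; exact hn)
  -- characteristic
  set m := ringChar (Rring L η ⧸ I) with hm
  haveI : CharP (Rring L η ⧸ I) m := ringChar.charP _
  have hbij : Function.Bijective (ZMod.castHom (dvd_refl m) (Rring L η ⧸ I)) := by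
    refine ⟨ZMod.castHom_injective _, fun y => ?_⟩
    obtain ⟨z, hz⟩ := hs y
    exact ⟨(z : ZMod m), by rw [map_intCast, ← hz]; simp⟩
  have hmn : m = n := by
    rw [← hc, ← Nat.card_congr (Equiv.ofBijective _ hbij), Nat.card_zmod]
  have hch : ∀ k : ℕ, (k : Rring L η) ∈ I ↔ n ∣ k := by
    intro k
    rw [← hmn, ← CharP.cast_eq_zero_iff (Rring L η ⧸ I) m k, ← map_natCast (Ideal.Quotient.mk I), Ideal.Quotient.eq_zero_iff_mem]
  exact exists_hom_of_char hn I hc (fun k => (hch k).mp) ((hch n).mpr dvd_rfl)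

lemma res_ker {n : ℕ} (hη : 0 < η) (hn : n ≠ 0) (α : Rring L η) (res : Ideal (Rring L η) → ℕ)
    (hres : ∀ 𝔞 : Ideal ↥(Rring L η), DegOne 𝔞 →
      res 𝔞 < idealNorm 𝔞 ∧ α - ((res 𝔞 : ℕ) : ↥(Rring L η)) ∈ 𝔞) (φ : Rring L η →+* ZMod n) :
    res (RingHom.ker φ) = (φ α).val := by
  obtain ⟨h1, h2⟩ := ker_mem hη hn φ
  obtain ⟨h3, h4⟩ := hres _ h1
  rw [h2] at h3
  rw [RingHom.mem_ker, map_sub, map_natCast, sub_eq_zero] at h4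
  rw [h4, ZMod.val_cast_of_lt h3]

lemma sqfree_hom {a : Ideal (𝓞 L)} (ha : a ≠ ⊥) (hs : Squarefree (Ideal.absNorm a)) :
    ∃ φ : 𝓞 L →+* ZMod (Ideal.absNorm a), RingHom.ker φ = a := by
  have hn : Ideal.absNorm a ≠ 0 := by rwa [Ne, Ideal.absNorm_eq_zero_iff]
  refine exists_hom_of_char hn a (by rw [Ideal.absNorm_apply, Submodule.cardQuot_apply]) ?_ (Ideal.absNorm_mem a)
  intro m hm
  rw [← Nat.prod_primeFactors_of_squarefree hs]
  refine Finset.prod_primes_dvd _ (fun p hp => (Nat.prime_of_mem_primeFactors hp).prime) fun p hp => ?_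
  have hpp := Nat.prime_of_mem_primeFactors hp
  obtain ⟨P, hP, hP0, hpP, hPa⟩ := exists_prime_dvd hpp ha (Nat.dvd_of_mem_primeFactors hp)
  have hmP : (m : 𝓞 L) ∈ P := Ideal.dvd_iff_le.mp hPa hm
  by_contra hnd
  have hcop := (Nat.isCoprime_iff_coprime (m := p) (n := m)).mpr ((hpp.coprime_iff_not_dvd).mpr hnd)
  obtain ⟨u, w, huw⟩ := hcop
  apply hP.ne_top
  rw [Ideal.eq_top_iff_one]
  have : (1 : 𝓞 L) = (u : 𝓞 L) * (p : 𝓞 L) + (w : 𝓞 L) * (m : 𝓞 L) := by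
    have := congrArg (fun z : ℤ => (z : 𝓞 L)) huw
    push_cast at this
    exact this.symm
  rw [this]
  exact P.add_mem (P.mul_mem_left _ hpP) (P.mul_mem_left _ hmP)

end FF

section GG

lemma dvd_of_mem {K : Type} [Field K] [NumberField K] {P : Ideal (𝓞 K)} (hP : P ≠ ⊤) {p m : ℕ} (hpp : p.Prime)
    (hpP : (p : 𝓞 K) ∈ P) (hmP : (m : 𝓞 K) ∈ P) : p ∣ m := by
  by_contra hnd
  have hcop := (Nat.isCoprime_iff_coprime (m := p) (n := m)).mpr ((hpp.coprime_iff_not_dvd).mpr hnd)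
  obtain ⟨u, w, huw⟩ := hcop
  apply hP
  rw [Ideal.eq_top_iff_one]
  have : (1 : 𝓞 K) = (u : 𝓞 K) * (p : 𝓞 K) + (w : 𝓞 K) * (m : 𝓞 K) := by
    have := congrArg (fun z : ℤ => (z : 𝓞 K)) huw
    push_cast at this
    exact this.symm
  rw [this]
  exact P.add_mem (P.mul_mem_left _ hpP) (P.mul_mem_left _ hmP)

lemma sq_hom {M : Type} [Field M] [NumberField M] {P : Ideal (𝓞 M)} (hP : P.IsPrime) {p : ℕ} (hp : p.Prime)
    (hN : Ideal.absNorm P = p) (hd : ¬ p ∣ Ideal.absNorm (differentIdeal ℤ (𝓞 M))) :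
    ∃ ψ : 𝓞 M →+* ZMod (p ^ 2), RingHom.ker ψ = P ^ 2 := by
  have hpP : (p : 𝓞 M) ∈ P := hN ▸ Ideal.absNorm_mem P
  have hp2 : (p : 𝓞 M) ∉ P ^ 2 := by
    intro h
    apply hd
    have hmax : (Ideal.span {(p : ℤ)}).IsMaximal := 
      PrincipalIdealRing.isMaximal_of_irreducible (Nat.prime_iff_prime_int.mp hp).irreducible
    have := pow_sub_one_dvd_differentIdeal (A := ℤ) (B := 𝓞 M) (p := Ideal.span {(p : ℤ)}) P 2
      (by rw [Ne, Ideal.span_singleton_eq_bot]; exact_mod_cast hp.ne_zero)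
      (by rw [Ideal.map_span, Set.image_singleton, Ideal.dvd_span_singleton]; simpa using h)
    rw [show 2 - 1 = 1 from rfl, pow_one] at this
    rw [← hN]
    exact map_dvd Ideal.absNorm this
  refine exists_hom_of_char (pow_ne_zero 2 hp.ne_zero) (P ^ 2) ?_ ?_ ?_
  · rw [← Submodule.cardQuot_apply, ← Ideal.absNorm_apply, map_pow, hN]
  · intro m hm
    have h1 : p ∣ m := dvd_of_mem hP.ne_top hp hpP (Ideal.pow_le_self two_ne_zero hm)
    obtain ⟨k, rfl⟩ := h1
    rw [pow_two]
    apply mul_dvd_mul_left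
    by_contra hnd
    have hcop := (Nat.isCoprime_iff_coprime (m := p) (n := k)).mpr ((hp.coprime_iff_not_dvd).mpr hnd)
    obtain ⟨u, w, huw⟩ := hcop
    apply hp2
    have : (p : 𝓞 M) = (u : 𝓞 M) * (p : 𝓞 M) ^ 2 + (w : 𝓞 M) * ((p * k : ℕ) : 𝓞 M) := by
      have := congrArg (fun z : ℤ => (z : 𝓞 M)) huw
      push_cast at this ⊢
      linear_combination (-(p : 𝓞 M)) * this
    rw [this]
    exact Ideal.add_mem _ (Ideal.mul_mem_left _ _ (Ideal.pow_mem_pow hpP 2)) (Ideal.mul_mem_left _ _ hm)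
  · push_cast
    exact Ideal.pow_mem_pow hpP 2

lemma isUnit_sq {M : Type} [Field M] [NumberField M] {P : Ideal (𝓞 M)} {p : ℕ} (hp : p.Prime)
    (hN : Ideal.absNorm P = p) {ψ : 𝓞 M →+* ZMod (p ^ 2)} (hψ : RingHom.ker ψ = P ^ 2) (x : 𝓞 M)
    (hx : ¬ p ∣ Ideal.absNorm (Ideal.span {x})) : IsUnit (ψ x) := by
  have hpP : (p : 𝓞 M) ∈ P := hN ▸ Ideal.absNorm_mem P
  haveI : NeZero (p ^ 2) := ⟨pow_ne_zero 2 hp.ne_zero⟩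
  have hv : ψ x = (((ψ x).val : ℕ) : ZMod (p ^ 2)) := by rw [ZMod.natCast_zmod_val]
  rw [hv, ZMod.isUnit_iff_coprime]
  apply Nat.Coprime.pow_right
  rw [Nat.coprime_comm, hp.coprime_iff_not_dvd]
  intro hd
  apply hx
  have h1 : x - ((ψ x).val : 𝓞 M) ∈ RingHom.ker ψ := by
    rw [RingHom.mem_ker, map_sub, map_natCast, ← hv, sub_self]
  rw [hψ] at h1
  have h2 := Ideal.pow_le_self two_ne_zero h1
  have h3 : ((ψ x).val : 𝓞 M) ∈ P := by
    obtain ⟨k, hk⟩ := hd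
    rw [hk]; push_cast; exact P.mul_mem_right _ hpP
  have h4 : x ∈ P := by
    have := P.add_mem h2 h3
    simpa using this
  rw [← hN]
  exact map_dvd Ideal.absNorm (Ideal.dvd_span_singleton.mpr h4)

variable (L : Type) [Field L] [NumberField L]

noncomputable abbrev MM := IntermediateField.normalClosure ℚ L ℂ

noncomputable def toM (f : L →ₐ[ℚ] ℂ) : L →+* MM L :=
  (f : L →+* ℂ).codRestrict (MM L).toSubfield fun x => AlgHom.fieldRange_le_normalClosure f ⟨x, rfl⟩

lemma toM_coe (f : L →ₐ[ℚ] ℂ) (x : L) : ((toM L f x : MM L) : ℂ) = f x := rfl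

instance : NumberField (MM L) where
  to_charZero := inferInstance
  to_finiteDimensional := inferInstance

noncomputable def sg (f : L →ₐ[ℚ] ℂ) : 𝓞 L →+* 𝓞 (MM L) := RingOfIntegers.mapRingHom (toM L f)

lemma sg_coe (f : L →ₐ[ℚ] ℂ) (x : 𝓞 L) : (((sg L f x : 𝓞 (MM L)) : MM L) : ℂ) = f (x : L) := rfl

lemma sg_ext {x y : 𝓞 (MM L)} (h : ((x : MM L) : ℂ) = ((y : MM L) : ℂ)) : x = y :=
  RingOfIntegers.ext (Subtype.ext h)

lemma norm_sg (x : 𝓞 L) : ((Algebra.norm ℤ x : ℤ) : 𝓞 (MM L)) = ∏ f : L →ₐ[ℚ] ℂ, sg L f x := by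
  apply sg_ext
  have h := Algebra.norm_eq_prod_embeddings ℚ ℂ (x : L)
  have e1 : Algebra.norm ℚ (x : L) = ((Algebra.norm ℤ x : ℤ) : ℚ) := (Algebra.coe_norm_int x).symm
  rw [e1] at h
  have e2 : (((∏ f : L →ₐ[ℚ] ℂ, sg L f x : 𝓞 (MM L)) : MM L) : ℂ) = ∏ f : L →ₐ[ℚ] ℂ, f (x : L) := by
    have := map_prod ((algebraMap (MM L) ℂ).comp (algebraMap (𝓞 (MM L)) (MM L))) (fun f => sg L f x) Finset.univ
    exact this
  rw [e2, ← h]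
  have := map_intCast ((algebraMap (MM L) ℂ).comp (algebraMap (𝓞 (MM L)) (MM L))) (Algebra.norm ℤ x)
  rw [map_intCast]
  exact this

lemma sg_ne {f g : L →ₐ[ℚ] ℂ} (h : f ≠ g) : ∃ x : 𝓞 L, sg L f x - sg L g x ≠ 0 := by
  by_contra hh
  push Not at hh
  apply h
  have : (f : L →+* ℂ) = (g : L →+* ℂ) := by
    apply IsLocalization.ringHom_ext (nonZeroDivisors (𝓞 L))
    ext x
    have := congrArg (fun y : 𝓞 (MM L) => ((y : MM L) : ℂ)) (sub_eq_zero.mp (hh x))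
    exact this
  ext x
  exact congrArg (fun k : L →+* ℂ => k x) this

lemma ne_emb : Nonempty (L →ₐ[ℚ] ℂ) := by
  rw [← Fintype.card_pos_iff, AlgHom.card]; exact Module.finrank_pos

lemma irr_ne {a : L} (ha : ∀ q : ℚ, a ≠ q) : ∃ f g : L →ₐ[ℚ] ℂ, f a ≠ g a := by
  by_contra hh
  push Not at hh
  have f : L →ₐ[ℚ] ℂ := Classical.choice (ne_emb L)
  have h := trace_eq_sum_embeddings (K := ℚ) (L := L) ℂ (x := a)
  have h2 : ∑ σ : L →ₐ[ℚ] ℂ, σ a = Module.finrank ℚ L * f a := by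
    rw [Finset.sum_congr rfl (fun σ _ => hh σ f), Finset.sum_const, Finset.card_univ, AlgHom.card, nsmul_eq_mul]
  rw [h2] at h
  have hd : (Module.finrank ℚ L : ℂ) ≠ 0 := by exact_mod_cast Module.finrank_pos.ne'
  apply ha (Algebra.trace ℚ L a / Module.finrank ℚ L)
  apply f.toRingHom.injective
  have : f a = (((Algebra.trace ℚ L a / Module.finrank ℚ L : ℚ)) : ℂ) := by
    push_cast
    rw [eq_div_iff hd, mul_comm, ← h]; simp
  change f a = f _
  rw [this, map_ratCast]

lemma good_primes (η : ℕ) (hη : 0 < η) (α : Rring L η) (hα : ∀ q : ℚ, (α : L) ≠ q) :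
    ∃ Δ : ℕ, Δ ≠ 0 ∧ ∀ p : ℕ, p.Prime → ¬ p ∣ Δ → (∃ P : Ideal (𝓞 (MM L)), P.IsPrime ∧ Ideal.absNorm P = p) →
      ∃ φ : (L →ₐ[ℚ] ℂ) → (𝓞 L →+* ZMod (p ^ 2)), (∀ f g, f ≠ g → ∃ x, IsUnit (φ f x - φ g x)) ∧
        (∀ x, ((Algebra.norm ℤ x : ℤ) : ZMod (p ^ 2)) = ∏ f, φ f x) ∧
        ∃ φ1 φ2 : Rring L η →+* ZMod p, φ1 α ≠ φ2 α := by
  classical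
  obtain ⟨b, k, hb⟩ := rring_form hη α
  obtain ⟨f1, g1, hfg⟩ := irr_ne L hα
  have hbL : (η : L) ^ k * (α : L) = (b : L) := by
    have := congrArg Subtype.val hb
    push_cast at this
    exact this
  have hβ : sg L f1 b - sg L g1 b ≠ 0 := by
    intro h
    have := congrArg (fun y : 𝓞 (MM L) => ((y : MM L) : ℂ)) (sub_eq_zero.mp h)
    simp only [sg_coe] at this
    rw [← hbL, map_mul, map_mul, map_pow, map_pow, map_natCast, map_natCast] at this
    have hη0 : (η : ℂ) ≠ 0 := by exact_mod_cast hη.ne'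
    exact hfg (mul_left_cancel₀ (pow_ne_zero k hη0) this)
  choose! γ hγ using fun (f g : L →ₐ[ℚ] ℂ) (h : f ≠ g) => sg_ne L h
  let N (x : 𝓞 (MM L)) : ℕ := Ideal.absNorm (Ideal.span {x})
  have hN0 : ∀ x, x ≠ 0 → N x ≠ 0 := by
    intro x hx
    change Ideal.absNorm (Ideal.span {x}) ≠ 0
    rw [Ne, Ideal.absNorm_eq_zero_iff, Ideal.span_singleton_eq_bot]; exact hx
  let T : ℕ := ∏ q : (L →ₐ[ℚ] ℂ) × (L →ₐ[ℚ] ℂ), if q.1 = q.2 then 1 else N (sg L q.1 (γ q.1 q.2) - sg L q.2 (γ q.1 q.2))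
  refine ⟨Ideal.absNorm (differentIdeal ℤ (𝓞 (MM L))) * η * T * N (sg L f1 b - sg L g1 b), ?_, ?_⟩
  · refine mul_ne_zero (mul_ne_zero (mul_ne_zero ?_ hη.ne') ?_) (hN0 _ hβ)
    · rw [Ne, Ideal.absNorm_eq_zero_iff]
      exact differentIdeal_ne_bot
    · refine Finset.prod_ne_zero_iff.mpr fun q _ => ?_
      split_ifs with h
      · exact one_ne_zero
      · exact hN0 _ (hγ _ _ h)
  · rintro p hp hpD ⟨P, hP, hPN⟩
    have h1 : ¬ p ∣ Ideal.absNorm (differentIdeal ℤ (𝓞 (MM L))) := fun h => hpD (((h.mul_right _).mul_right _).mul_right _)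
    have h2 : ¬ p ∣ η := fun h => hpD (((h.mul_left _).mul_right _).mul_right _)
    have h3 : ¬ p ∣ T := fun h => hpD ((h.mul_left _).mul_right _)
    have h4 : ¬ p ∣ N (sg L f1 b - sg L g1 b) := fun h => hpD (h.mul_left _)
    obtain ⟨ψ, hψ⟩ := sq_hom hP hp hPN h1
    refine ⟨fun f => ψ.comp (sg L f), ?_, ?_, ?_⟩
    · intro f g hfg
      refine ⟨γ f g, ?_⟩
      rw [RingHom.comp_apply, RingHom.comp_apply, ← map_sub]
      refine isUnit_sq hp hPN hψ _ fun h => h3 ?_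
      refine dvd_trans ?_ (Finset.dvd_prod_of_mem _ (Finset.mem_univ (f, g)))
      simp only [if_neg hfg]
      exact h
    · intro x
      rw [← map_intCast ψ, norm_sg, map_prod]; rfl
    · have hc : p.Coprime η := (hp.coprime_iff_not_dvd).mpr h2
      let r := ZMod.castHom (dvd_pow_self p two_ne_zero) (ZMod p)
      obtain ⟨φ1, e1⟩ := hom_extend (L := L) hη hc (r.comp (ψ.comp (sg L f1)))
      obtain ⟨φ2, e2⟩ := hom_extend (L := L) hη hc (r.comp (ψ.comp (sg L g1)))
      refine ⟨φ1, φ2, fun h => ?_⟩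
      have e3 : φ1 (algebraMap _ _ b) = φ2 (algebraMap _ _ b) := by
        rw [← hb, map_mul, map_mul, h, map_pow, map_pow, map_natCast, map_natCast]
      have e4 := congrArg (fun q : 𝓞 L →+* ZMod p => q b) e1
      have e5 := congrArg (fun q : 𝓞 L →+* ZMod p => q b) e2
      simp only [RingHom.comp_apply] at e4 e5
      rw [e4, e5, ← sub_eq_zero, ← map_sub, ← map_sub] at e3
      have hu := (isUnit_sq hp hPN hψ _ h4).map r
      rw [e3] at hu
      haveI : Fact p.Prime := ⟨hp⟩
      exact not_isUnit_zero hu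

end GG

section HH

lemma crt_surj {A κ : Type} [CommRing A] [Finite κ] (n : κ → ℕ) (φ : ∀ k, A →+* ZMod (n k))
    (hc : ∀ k l, k ≠ l → IsCoprime (RingHom.ker (φ k)) (RingHom.ker (φ l))) (y : ∀ k, ZMod (n k)) :
    ∃ a, ∀ k, φ k a = y k := by
  choose b hb using fun k => ZMod.ringHom_surjective (φ k) (y k)
  obtain ⟨a, ha⟩ := Ideal.pi_quotient_surjective (I := fun k => RingHom.ker (φ k)) (fun k l h => hc k l h)
    (fun k => Ideal.Quotient.mk _ (b k))
  refine ⟨a, fun k => ?_⟩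
  rw [← hb]
  have := ha k
  have := Ideal.Quotient.eq.mp this
  rw [RingHom.mem_ker, map_sub, sub_eq_zero] at this
  exact this

lemma coprime_ker_of_unit {A : Type} [CommRing A] {n : ℕ} [NeZero n] (φ ψ : A →+* ZMod n) (x : A) (h : IsUnit (φ x - ψ x)) :
    IsCoprime (RingHom.ker φ) (RingHom.ker ψ) := by
  obtain ⟨u, hu⟩ := h
  rw [Ideal.isCoprime_iff_exists]
  have e : (φ x - ψ x) * ((↑u⁻¹ : ZMod n)) = 1 := by rw [← hu]; exact u.mul_inv
  set i : A := (((↑u⁻¹ : ZMod n).val : ℕ) : A) with hi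
  have hi1 : φ i = ((↑u⁻¹ : ZMod n)) := by rw [hi, map_natCast, ZMod.natCast_zmod_val]
  have hi2 : ψ i = ((↑u⁻¹ : ZMod n)) := by rw [hi, map_natCast, ZMod.natCast_zmod_val]
  set q : A := (((ψ x).val : ℕ) : A) with hq
  have hq1 : φ q = ψ x := by rw [hq, map_natCast, ZMod.natCast_zmod_val]
  have hq2 : ψ q = ψ x := by rw [hq, map_natCast, ZMod.natCast_zmod_val]
  refine ⟨1 - (x - q) * i, ?_, (x - q) * i, ?_, by ring⟩
  · rw [RingHom.mem_ker, map_sub, map_one, map_mul, map_sub, hq1, hi1, e, sub_self]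
  · rw [RingHom.mem_ker, map_mul, map_sub, hq2, sub_self, zero_mul]

lemma coprime_ker_of_coprime {A : Type} [CommRing A] {n m : ℕ} (φ : A →+* ZMod n) (ψ : A →+* ZMod m) (h : n.Coprime m) :
    IsCoprime (RingHom.ker φ) (RingHom.ker ψ) := by
  obtain ⟨u, w, huw⟩ := (Nat.isCoprime_iff_coprime (m := n) (n := m)).mpr h
  rw [Ideal.isCoprime_iff_exists]
  refine ⟨((u * n : ℤ) : A), ?_, ((w * m : ℤ) : A), ?_, ?_⟩
  · rw [RingHom.mem_ker, map_intCast]; push_cast; rw [ZMod.natCast_self, mul_zero]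
  · rw [RingHom.mem_ker, map_intCast]; push_cast; rw [ZMod.natCast_self, mul_zero]
  · rw [← Int.cast_add, huw, Int.cast_one]

lemma joint_surj {A ι : Type} [CommRing A] [Finite ι] (P : Finset ℕ) (hP : ∀ p ∈ P, p.Prime)
    (φ : ∀ p : P, ι → (A →+* ZMod ((p : ℕ) ^ 2)))
    (hφ : ∀ p f g, f ≠ g → ∃ x, IsUnit (φ p f x - φ p g x)) (y : ∀ p : P, ι → ZMod ((p : ℕ) ^ 2)) :
    ∃ a, ∀ p f, φ p f a = y p f := by
  have hc : ∀ k l : P × ι, k ≠ l → IsCoprime (RingHom.ker (φ k.1 k.2)) (RingHom.ker (φ l.1 l.2)) := by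
    rintro ⟨p, f⟩ ⟨q, g⟩ hne
    by_cases hpq : p = q
    · subst hpq
      have hfg : f ≠ g := fun h => hne (by rw [h])
      obtain ⟨x, hx⟩ := hφ p f g hfg
      haveI : NeZero ((p : ℕ) ^ 2) := ⟨pow_ne_zero 2 (hP p p.2).ne_zero⟩
      exact coprime_ker_of_unit _ _ x hx
    · apply coprime_ker_of_coprime
      apply Nat.Coprime.pow
      exact (Nat.coprime_primes (hP p p.2) (hP q q.2)).mpr fun h => hpq (Subtype.ext h)
  obtain ⟨a, ha⟩ := crt_surj (κ := P × ι) (fun k => (k.1 : ℕ) ^ 2) (fun k => φ k.1 k.2) hc (fun k => y k.1 k.2)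
  exact ⟨a, fun p f => ha (p, f)⟩

variable (L : Type) [Field L] [NumberField L]

lemma main_bound (η : ℕ) (hη : 0 < η) (α : Rring L η) (hα : ∀ q : ℚ, (α : L) ≠ q) (h : ℤ) (hh : h ≠ 0) :
    ∃ (Δ : ℕ) (c0 C1 : ℝ), Δ ≠ 0 ∧ 0 < c0 ∧ 0 < C1 ∧ ∀ P : Finset ℕ, (∀ p ∈ P, p.Prime ∧ ¬ p ∣ Δ ∧
      (∃ Q : Ideal (𝓞 (MM L)), Q.IsPrime ∧ Ideal.absNorm Q = p)) →
      ∃ x0 : ℝ, ∀ x, x0 ≤ x → ∑ a ∈ (finJ (K := L) Set.univ x).toFinset, ∏ p ∈ P, wp α p h (Ideal.absNorm a) ≤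
        C1 * x * ∏ p ∈ P, (1 - c0 / p) := by
  classical
  obtain ⟨C0, C1, hC1, hW⟩ := weighted_count L
  obtain ⟨Δ, hΔ, hgood⟩ := good_primes L η hη α hα
  set d := Module.finrank ℚ L with hd
  have hd0 : 0 < d := Module.finrank_pos
  have hs2 : 0 < 2 - Real.sqrt 2 := by
    have : Real.sqrt 2 < 2 := by rw [Real.sqrt_lt' (by norm_num)]; norm_num
    linarith
  refine ⟨Δ * h.natAbs * C0.factorial, (2 - Real.sqrt 2) / d / 2 ^ d, C1, ?_, by positivity, hC1, ?_⟩
  · exact mul_ne_zero (mul_ne_zero hΔ (Int.natAbs_ne_zero.mpr hh)) C0.factorial_ne_zero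
  intro P hP
  have hpr : ∀ p ∈ P, p.Prime := fun p hp => (hP p hp).1
  have hex : ∀ p : P, ∃ φ : (L →ₐ[ℚ] ℂ) → (𝓞 L →+* ZMod ((p : ℕ) ^ 2)), (∀ f g, f ≠ g → ∃ x, IsUnit (φ f x - φ g x)) ∧
        (∀ x, ((Algebra.norm ℤ x : ℤ) : ZMod ((p : ℕ) ^ 2)) = ∏ f, φ f x) ∧
        ∃ φ1 φ2 : Rring L η →+* ZMod p, φ1 α ≠ φ2 α := by
    intro p
    obtain ⟨h1, h2, h3⟩ := hP p p.2
    exact hgood p h1 (fun hd => h2 ((hd.mul_right _).mul_right _)) h3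
  choose φ hφ1 hφ2 φ1 φ2 hφ3 using hex
  set m := ∏ p ∈ P, p ^ 2 with hm
  have hm0 : 0 < m := Finset.prod_pos fun p hp => pow_pos (hpr p hp).pos 2
  haveI : NeZero m := ⟨hm0.ne'⟩
  haveI hne2 : ∀ p : P, NeZero ((p : ℕ) ^ 2) := fun p => ⟨pow_ne_zero 2 (hpr p p.2).ne_zero⟩
  haveI hfact : ∀ p : P, Fact (p : ℕ).Prime := fun p => ⟨hpr p p.2⟩
  haveI := ne_emb L
  have hcardι : Fintype.card (L →ₐ[ℚ] ℂ) = d := AlgHom.card ℚ L ℂ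
  have hpm : ∀ p : P, (p : ℕ) ^ 2 ∣ m := fun p => Finset.dvd_prod_of_mem _ p.2
  let r : ∀ p : P, ZMod m →+* ZMod ((p : ℕ) ^ 2) := fun p => ZMod.castHom (hpm p) _
  let Φ : (bI L → ZMod m) → (∀ p : P, (L →ₐ[ℚ] ℂ) → ZMod ((p : ℕ) ^ 2)) :=
    fun w p f => ∑ i, r p (w i) * φ p f (bas L i)
  have hΦ : ∀ (z : bI L → ℤ) p f, Φ (fun i => (z i : ZMod m)) p f = φ p f (elt L z) := by
    intro z p f
    simp only [Φ, elt, map_sum, map_intCast, zsmul_eq_mul, map_mul]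
  have hΦs : Function.Surjective Φ := by
    intro y
    obtain ⟨γ, hγ⟩ := joint_surj P hpr φ hφ1 y
    refine ⟨fun i => (((bas L).repr γ i : ℤ) : ZMod m), ?_⟩
    funext p f
    have hel : elt L (⇑((bas L).repr γ)) = γ := (bas L).sum_repr γ
    rw [hΦ, hel, hγ]
  have hcard : Fintype.card (bI L → ZMod m) = Fintype.card (∀ p : P, (L →ₐ[ℚ] ℂ) → ZMod ((p : ℕ) ^ 2)) := by
    simp only [Fintype.card_fun, Fintype.card_pi, ZMod.card, Finset.prod_const, Finset.card_univ, hcardι, card_bI]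
    rw [Finset.prod_pow, hm, ← Finset.prod_coe_sort]
  have hΦb : Function.Bijective Φ := (Fintype.bijective_iff_surjective_and_card Φ).mpr ⟨hΦs, hcard⟩
  let F : ℕ → ℤ → ∀ p : P, ((L →ₐ[ℚ] ℂ) → ZMod ((p : ℕ) ^ 2)) → ℝ :=
    fun t s p y => wp α p h (((s : ZMod ((p : ℕ) ^ 2)) * (t : ZMod ((p : ℕ) ^ 2))⁻¹) * ∏ f, y f).val
  have hcop : ∀ (p : P) (t : ℕ), 1 ≤ t → t ≤ C0 → t.Coprime ((p : ℕ) ^ 2) := by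
    intro p t h1 h2
    apply Nat.Coprime.pow_right
    rw [Nat.coprime_comm, (hpr p p.2).coprime_iff_not_dvd]
    intro hd
    exact (hP p p.2).2.1 ((hd.trans (Nat.dvd_factorial h1 h2)).mul_left _)
  have hmain := hW m hm0 (fun n => ∏ p ∈ P, wp α p h n) (fun t s w => ∏ p : P, F t s p (Φ w p))
    ((m : ℝ) ^ d * ∏ p ∈ P, (1 - ((2 - Real.sqrt 2) / d / 2 ^ d) / p)) ?_ ?_ ?_
  · obtain ⟨x0, hx0⟩ := hmain
    refine ⟨x0, fun x hx => (hx0 x hx).trans (le_of_eq ?_)⟩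
    have : (m : ℝ) ^ d ≠ 0 := by positivity
    rw [mul_div_cancel_left₀ _ this]
  · intro t s w
    exact Finset.prod_nonneg fun p _ => wp_nonneg _ _ _ _
  · intro t s ht1 ht2 hs
    have e1 : ∑ w, ∏ p : P, F t s p (Φ w p) = ∑ y : ∀ p : P, (L →ₐ[ℚ] ℂ) → ZMod ((p : ℕ) ^ 2), ∏ p : P, F t s p (y p) :=
      hΦb.sum_comp (fun y => ∏ p : P, F t s p (y p))
    have e2 : ∑ y : ∀ p : P, (L →ₐ[ℚ] ℂ) → ZMod ((p : ℕ) ^ 2), ∏ p : P, F t s p (y p) = ∏ p : P, ∑ y, F t s p y := by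
      rw [Finset.prod_univ_sum, Fintype.piFinset_univ]
    have e3 : ∏ p : P, ∑ y, F t s p y ≤ ∏ p : P, ((((p : ℕ) ^ 2 : ℕ) : ℝ) ^ d * (1 - ((2 - Real.sqrt 2) / d / 2 ^ d) / (p : ℕ))) := by
      refine Finset.prod_le_prod (fun p _ => Finset.sum_nonneg fun _ _ => wp_nonneg _ _ _ _) fun p _ => ?_
      have hsu : IsUnit (s : ZMod ((p : ℕ) ^ 2)) := by
        rcases hs with rfl | rfl <;> simp
      let u : (ZMod ((p : ℕ) ^ 2))ˣ := hsu.unit * (ZMod.unitOfCoprime t (hcop p t ht1 ht2))⁻¹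
      have hu : (u : ZMod ((p : ℕ) ^ 2)) = (s : ZMod ((p : ℕ) ^ 2)) * (t : ZMod ((p : ℕ) ^ 2))⁻¹ := by
        rw [Units.val_mul, IsUnit.unit_spec, ← ZMod.inv_coe_unit, ZMod.coe_unitOfCoprime]
      have hhp : (h : ZMod p) ≠ 0 := by
        rw [Ne, ZMod.intCast_zmod_eq_zero_iff_dvd, Int.natCast_dvd]
        intro hd
        exact (hP p p.2).2.1 ((hd.mul_left _).mul_right _)
      have := local_bound (ι := L →ₐ[ℚ] ℂ) α p (hom_card hη (hpr p p.2).ne_zero).1 d (rho_prime_le hη (hpr p p.2))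
        (φ1 p) (φ2 p) (hφ3 p) h hhp u
      rw [hu, hcardι] at this
      exact this
    rw [Finset.prod_mul_distrib, Finset.prod_pow, Finset.prod_coe_sort P (fun p => ((p ^ 2 : ℕ) : ℝ)),
      Finset.prod_coe_sort P (fun p => (1 - ((2 - Real.sqrt 2) / d / 2 ^ d) / (p : ℝ))), ← Nat.cast_prod, ← hm, ← e2, ← e1] at e3
    exact e3
  · intro t s z n ht1 ht2 hs hn
    rw [← Finset.prod_coe_sort]
    refine le_of_eq (Finset.prod_congr rfl fun p _ => ?_)
    simp only [F, hΦ]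
    rw [← hφ2 p, ← hn]
    have e : (s : ZMod ((p : ℕ) ^ 2)) * (t : ZMod ((p : ℕ) ^ 2))⁻¹ * ((n * t * s : ℤ) : ZMod ((p : ℕ) ^ 2)) = (n : ℕ) := by
      have h1 := ZMod.coe_mul_inv_eq_one t (hcop p t ht1 ht2)
      have h2 : (s : ZMod ((p : ℕ) ^ 2)) * s = 1 := by
        rcases hs with rfl | rfl <;> simp
      push_cast
      linear_combination (n : ZMod ((p : ℕ) ^ 2)) * h1 * (s : ZMod ((p : ℕ) ^ 2)) * s + n * h2
    rw [e, ZMod.val_natCast, wp_mod α (hpr p p.2)]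

end HH

section II
variable {L : Type} [Field L] [NumberField L] {η : ℕ}

def SS (L : Type) [Field L] [NumberField L] (η : ℕ) (x : ℝ) : Set (Ideal (Rring L η)) :=
  {𝔞 | DegOne 𝔞 ∧ (idealNorm 𝔞 : ℝ) ≤ x}

lemma SS_finite (hη : 0 < η) (x : ℝ) : (SS L η x).Finite := by
  have hsub : SS L η x ⊆ ⋃ n ∈ Set.Icc 1 ⌊x⌋₊, Set.range (fun φ : Rring L η →+* ZMod n => RingHom.ker φ) := by
    intro I hI
    have h0 := degOne_finite hη hI.1
    obtain ⟨φ, hφ⟩ := ker_surj hη h0 (I := I) ⟨hI.1, rfl⟩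
    simp only [Set.mem_iUnion]
    exact ⟨idealNorm I, ⟨Nat.one_le_iff_ne_zero.mpr h0, Nat.le_floor hI.2⟩, φ, hφ⟩
  refine Set.Finite.subset (Set.Finite.biUnion (Set.finite_Icc _ _) fun n hn => ?_) hsub
  haveI := (hom_card (L := L) hη (n := n) (by have := hn.1; omega)).1
  exact Set.finite_range _

lemma SS_lower (hη : 0 < η) : ∃ c : ℝ, 0 < c ∧ ∃ x0 : ℝ, ∀ x, x0 ≤ x → c * x ≤ ((SS L η x).ncard : ℝ) := by
  obtain ⟨c, hc, x0, h⟩ := posLow_sqfree (K := L) η hη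
  refine ⟨c, hc, x0, fun x hx => (h x hx).trans ?_⟩
  rw [cntI]
  norm_cast
  have key : ∀ a : Ideal (𝓞 L), a ≠ ⊥ → Squarefree (Ideal.absNorm a) → (Ideal.absNorm a).Coprime η →
      ∃ b : Ideal (Rring L η), b ∈ Sset L η (Ideal.absNorm a) ∧ b.comap (algebraMap (𝓞 L) (Rring L η)) = a := by
    intro a ha hs hcop
    obtain ⟨φ, hφ⟩ := sqfree_hom ha hs
    obtain ⟨ψ, hψ⟩ := hom_extend hη hcop φ
    have hn : Ideal.absNorm a ≠ 0 := by rwa [Ne, Ideal.absNorm_eq_zero_iff]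
    refine ⟨RingHom.ker ψ, ker_mem hη hn ψ, ?_⟩
    rw [RingHom.comap_ker, hψ, hφ]
  have key2 : ∀ a : Ideal (𝓞 L), ∃ b : Ideal (Rring L η), a ≠ ⊥ → Squarefree (Ideal.absNorm a) → (Ideal.absNorm a).Coprime η →
      b ∈ Sset L η (Ideal.absNorm a) ∧ b.comap (algebraMap (𝓞 L) (Rring L η)) = a := by
    intro a
    by_cases hh : a ≠ ⊥ ∧ Squarefree (Ideal.absNorm a) ∧ (Ideal.absNorm a).Coprime η
    · obtain ⟨b, hb⟩ := key a hh.1 hh.2.1 hh.2.2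
      exact ⟨b, fun _ _ _ => hb⟩
    · exact ⟨⊥, fun h1 h2 h3 => (hh ⟨h1, h2, h3⟩).elim⟩
  choose f hf using key2
  refine Set.ncard_le_ncard_of_injOn f ?_ ?_ (SS_finite hη x)
  · rintro a ⟨h1, h2, h3⟩
    obtain ⟨⟨h4, h5⟩, h6⟩ := hf a h2 (h1 h2).1 (h1 h2).2
    exact ⟨h4, by rw [h5]; exact h3⟩
  · rintro a ⟨h1, h2, h3⟩ b ⟨k1, k2, k3⟩ hab
    rw [← (hf a h2 (h1 h2).1 (h1 h2).2).2, hab, (hf b k2 (k1 k2).1 (k1 k2).2).2]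

lemma exp_fiber (hη : 0 < η) (α : Rring L η) (res : Ideal (Rring L η) → ℕ)
    (hres : ∀ 𝔞 : Ideal ↥(Rring L η), DegOne 𝔞 →
      res 𝔞 < idealNorm 𝔞 ∧ α - ((res 𝔞 : ℕ) : ↥(Rring L η)) ∈ 𝔞) (h : ℤ) (x : ℝ) {n : ℕ} (hn : n ≠ 0) (hnx : (n : ℝ) ≤ x) :
    ∑ 𝔞 ∈ (SS_finite (L := L) hη x).toFinset with idealNorm 𝔞 = n, eZ (idealNorm 𝔞) (h * res 𝔞) = Tn (Rring L η) α n h := by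
  classical
  haveI := (hom_card (L := L) hη hn).1
  haveI : NeZero n := ⟨hn⟩
  haveI := Fintype.ofFinite (Rring L η →+* ZMod n)
  rw [Tn, finsum_eq_sum_of_fintype]
  symm
  refine Finset.sum_nbij (fun φ => RingHom.ker φ) ?_ ?_ ?_ ?_
  · intro φ _
    have := ker_mem hη hn φ
    simp only [Finset.mem_filter, Set.Finite.mem_toFinset]
    exact ⟨⟨this.1, by rw [this.2]; exact hnx⟩, this.2⟩
  · intro φ _ ψ _ hφψ
    exact zhom_ext hφψ
  · intro I hI
    simp only [Finset.coe_filter, Set.Finite.mem_toFinset] at hI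
    obtain ⟨φ, hφ⟩ := ker_surj hη hn (I := I) ⟨hI.1.1, hI.2⟩
    exact ⟨φ, by simp, hφ⟩
  · intro φ _
    rw [(ker_mem hη hn φ).2, res_ker hη hn α res hres φ]

lemma exp_bound (hη : 0 < η) (α : Rring L η) (res : Ideal (Rring L η) → ℕ)
    (hres : ∀ 𝔞 : Ideal ↥(Rring L η), DegOne 𝔞 →
      res 𝔞 < idealNorm 𝔞 ∧ α - ((res 𝔞 : ℕ) : ↥(Rring L η)) ∈ 𝔞) (h : ℤ) (x : ℝ) (P : Finset ℕ) (hP : ∀ p ∈ P, p.Prime) :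
    ‖∑ 𝔞 ∈ (SS_finite (L := L) hη x).toFinset, eZ (idealNorm 𝔞) (h * res 𝔞)‖ ≤
      ∑ a ∈ (finJ (K := L) Set.univ x).toFinset, ∏ p ∈ P, wp α p h (Ideal.absNorm a) := by
  classical
  have hx : ∀ n ∈ Finset.Icc 1 ⌊x⌋₊, n ≠ 0 ∧ (n : ℝ) ≤ x := by
    intro n hn
    rw [Finset.mem_Icc] at hn
    refine ⟨by omega, ?_⟩
    rcases le_or_gt 0 x with h0 | h0
    · exact (Nat.le_floor_iff h0).mp hn.2
    · rw [Nat.floor_of_nonpos h0.le] at hn; omega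
  rw [← Finset.sum_fiberwise_of_maps_to (s := (SS_finite (L := L) hη x).toFinset) (t := Finset.Icc 1 ⌊x⌋₊) (g := fun 𝔞 => idealNorm 𝔞),
    ← Finset.sum_fiberwise_of_maps_to (s := (finJ (K := L) Set.univ x).toFinset) (t := Finset.Icc 1 ⌊x⌋₊) (g := fun 𝔞 => Ideal.absNorm 𝔞)]
  · refine (norm_sum_le _ _).trans (Finset.sum_le_sum fun n hn => ?_)
    obtain ⟨hn0, hnx⟩ := hx n hn
    rw [exp_fiber hη α res hres h x hn0 hnx]
    refine (Tn_bound α (fun n hn => (hom_card hη hn).1) P hP n hn0 h).trans ?_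
    rw [Finset.sum_congr rfl (g := fun _ => ∏ p ∈ P, wp α p h n), Finset.sum_const, nsmul_eq_mul]
    · refine mul_le_mul_of_nonneg_right ?_ (Finset.prod_nonneg fun p _ => wp_nonneg _ _ _ _)
      norm_cast
      refine (hom_card hη hn0).2.trans (le_of_eq ?_)
      refine Nat.subtype_card _ fun a => ?_
      rw [Finset.mem_filter, Set.Finite.mem_toFinset]
      refine ⟨fun h => h.2, fun h => ⟨⟨trivial, ?_, by rw [h]; exact hnx⟩, h⟩⟩
      rintro rfl
      rw [Ideal.absNorm_bot] at h
      exact hn0 h.symm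
    · intro a ha
      rw [(Finset.mem_filter.mp ha).2]
  · intro a ha
    rw [Set.Finite.mem_toFinset] at ha
    rw [Finset.mem_Icc]
    refine ⟨Nat.one_le_iff_ne_zero.mpr ?_, Nat.le_floor ha.2.2⟩
    rw [Ne, Ideal.absNorm_eq_zero_iff]; exact ha.2.1
  · intro a ha
    rw [Set.Finite.mem_toFinset] at ha
    rw [Finset.mem_Icc]
    exact ⟨Nat.one_le_iff_ne_zero.mpr (degOne_finite hη ha.1), Nat.le_floor ha.2⟩

end II

section JJ

lemma small_euler_prod (K : Type) [Field K] [NumberField K] (Δ : ℕ) (hΔ : Δ ≠ 0) (c0 : ℝ) (hc0 : 0 < c0) (ε : ℝ) (hε : 0 < ε) :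
    ∃ P : Finset ℕ, (∀ p ∈ P, p.Prime ∧ ¬ p ∣ Δ ∧
      (∃ Q : Ideal (𝓞 K), Q.IsPrime ∧ Ideal.absNorm Q = p)) ∧ ∏ p ∈ P, (1 - c0 / p) ≤ ε := by
  classical
  let q : ℕ → Prop := fun p => (p.Prime ∧ ∃ Q : Ideal (𝓞 K), Q.IsPrime ∧ Ideal.absNorm Q = p) ∧ ¬ p ∣ Δ ∧ c0 < p
  let g : ℕ → ℝ := fun p => if q p then 1 / (p : ℝ) else 0
  have hg : ¬ Summable g := by
    intro hs
    apply not_summable_fP (K := K)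
    refine (summable_congr_cofinite ?_).mp hs
    rw [Nat.cofinite_eq_atTop]
    filter_upwards [eventually_gt_atTop Δ, eventually_gt_atTop ⌈c0⌉₊] with p hp1 hp2
    have h1 : ¬ p ∣ Δ := fun h => absurd (Nat.le_of_dvd (Nat.pos_of_ne_zero hΔ) h) (by omega)
    have h2 : c0 < p := (Nat.le_ceil c0).trans_lt (by exact_mod_cast hp2)
    have : q p ↔ (p.Prime ∧ ∃ Q : Ideal (𝓞 K), Q.IsPrime ∧ Ideal.absNorm Q = p) := ⟨fun h => h.1, fun h => ⟨h, h1, h2⟩⟩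
    simp only [g, fP, this]
  have hg0 : ∀ p, 0 ≤ g p := fun p => by simp only [g]; split_ifs <;> positivity
  have : ∃ s : Finset ℕ, -Real.log ε / c0 < ∑ p ∈ s, g p := by
    by_contra! hcon
    exact hg (summable_of_sum_le hg0 hcon)
  obtain ⟨s, hs⟩ := this
  refine ⟨s.filter q, fun p hp => ?_, ?_⟩
  · obtain ⟨h1, h2, h3⟩ := (Finset.mem_filter.mp hp).2
    exact ⟨h1.1, h2, h1.2⟩
  · have h1 : ∏ p ∈ s.filter q, (1 - c0 / p) ≤ ∏ p ∈ s.filter q, Real.exp (-(c0 * (1 / p))) := by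
      refine Finset.prod_le_prod (fun p hp => ?_) fun p hp => ?_
      · obtain ⟨h1, h2, h3⟩ := (Finset.mem_filter.mp hp).2
        have : (0 : ℝ) < p := hc0.trans h3
        rw [sub_nonneg, div_le_one this]; exact h3.le
      · have := Real.one_sub_le_exp_neg (c0 * (1 / p))
        rwa [mul_one_div] at this ⊢
    refine h1.trans ?_
    rw [← Real.exp_sum, ← Real.le_log_iff_exp_le hε, Finset.sum_neg_distrib, ← Finset.mul_sum, Finset.sum_filter]
    rw [div_lt_iff₀ hc0] at hs
    have : ∑ p ∈ s, g p = ∑ a ∈ s, if q a then 1 / (a : ℝ) else 0 := rfl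
    rw [← this]
    linarith

variable {L : Type} [Field L] [NumberField L] {η : ℕ}

lemma avg_zero (hη : 0 < η) (α : Rring L η) (hα : ∀ q : ℚ, (α : L) ≠ q) (res : Ideal (Rring L η) → ℕ)
    (hres : ∀ 𝔞 : Ideal ↥(Rring L η), DegOne 𝔞 →
      res 𝔞 < idealNorm 𝔞 ∧ α - ((res 𝔞 : ℕ) : ↥(Rring L η)) ∈ 𝔞) (h : ℤ) (hh : h ≠ 0) :
    Tendsto (fun x : ℝ => (∑ 𝔞 ∈ (SS_finite (L := L) hη x).toFinset, eZ (idealNorm 𝔞) (h * res 𝔞)) /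
      ((SS_finite (L := L) hη x).toFinset.card : ℂ)) atTop (𝓝 0) := by
  obtain ⟨Δ, c0, C1, hΔ, hc0, hC1, hb⟩ := main_bound L η hη α hα h hh
  obtain ⟨c, hc, x1, hlow⟩ := SS_lower (L := L) hη
  rw [Metric.tendsto_atTop]
  intro ε hε
  obtain ⟨P, hP, hPe⟩ := small_euler_prod (MM L) Δ hΔ c0 hc0 (ε * c / (2 * C1)) (by positivity)
  obtain ⟨x0, hx0⟩ := hb P hP
  refine ⟨max (max x0 x1) 1, fun x hx => ?_⟩
  have hxx0 : x0 ≤ x := le_trans (by simp) hx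
  have hxx1 : x1 ≤ x := le_trans (by simp) hx
  have hx1 : 1 ≤ x := le_trans (by simp) hx
  have hxp : 0 < x := by linarith
  have h1 := (exp_bound hη α res hres h x P (fun p hp => (hP p hp).1)).trans (hx0 x hxx0)
  have h2 := hlow x hxx1
  rw [Set.ncard_eq_toFinset_card _ (SS_finite hη x)] at h2
  have h3 : 0 < ((SS_finite (L := L) hη x).toFinset.card : ℝ) := lt_of_lt_of_le (by positivity) h2
  rw [dist_zero_right, norm_div, Complex.norm_natCast, div_lt_iff₀ h3]
  calc _ ≤ _ := h1
    _ ≤ C1 * x * (ε * c / (2 * C1)) := mul_le_mul_of_nonneg_left hPe (by positivity)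
    _ = ε / 2 * (c * x) := by field_simp
    _ ≤ ε / 2 * _ := mul_le_mul_of_nonneg_left h2 (by positivity)
    _ < _ := mul_lt_mul_of_pos_right (by linarith) h3

end JJ

section KK

lemma unit_circle_fact : Fact ((0 : ℝ) < 1) := ⟨zero_lt_one⟩

noncomputable def avgC {ι : Type} (F : Finset ι) (y : ι → ℝ) (g : C(AddCircle (1 : ℝ), ℂ)) : ℂ :=
  (∑ i ∈ F, g (y i : AddCircle (1 : ℝ))) / (F.card : ℂ)

noncomputable def intC (g : C(AddCircle (1 : ℝ), ℂ)) : ℂ := ∫ t in (0 : ℝ)..1, g (t : AddCircle (1 : ℝ))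

lemma contC (g : C(AddCircle (1 : ℝ), ℂ)) : Continuous (fun t : ℝ => g (t : AddCircle (1 : ℝ))) :=
  g.continuous.comp (AddCircle.continuous_mk' 1)

lemma avgC_sub {ι : Type} (F : Finset ι) (y : ι → ℝ) (g k : C(AddCircle (1 : ℝ), ℂ)) :
    avgC F y g - avgC F y k = avgC F y (g - k) := by
  simp only [avgC, ContinuousMap.sub_apply, Finset.sum_sub_distrib, sub_div]

lemma intC_sub (g k : C(AddCircle (1 : ℝ), ℂ)) : intC g - intC k = intC (g - k) := by
  simp only [intC, ContinuousMap.sub_apply]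
  rw [intervalIntegral.integral_sub ((contC g).intervalIntegrable _ _) ((contC k).intervalIntegrable _ _)]

lemma avgC_norm {ι : Type} (F : Finset ι) (y : ι → ℝ) (g : C(AddCircle (1 : ℝ), ℂ)) : ‖avgC F y g‖ ≤ ‖g‖ := by
  haveI := unit_circle_fact
  rw [avgC, norm_div, Complex.norm_natCast]
  refine div_le_of_le_mul₀ (by positivity) (norm_nonneg _) ?_
  refine (norm_sum_le _ _).trans ?_
  refine (Finset.sum_le_card_nsmul _ _ ‖g‖ fun i _ => g.norm_coe_le_norm _).trans ?_
  rw [nsmul_eq_mul, mul_comm]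

lemma intC_norm (g : C(AddCircle (1 : ℝ), ℂ)) : ‖intC g‖ ≤ ‖g‖ := by
  haveI := unit_circle_fact
  have := intervalIntegral.norm_integral_le_of_norm_le_const (a := (0 : ℝ)) (b := 1) (C := ‖g‖)
    (f := fun t : ℝ => g (t : AddCircle (1 : ℝ))) fun t _ => g.norm_coe_le_norm _
  simpa [intC] using this

lemma intC_fourier (h : ℤ) (hh : h ≠ 0) : intC (fourier h) = 0 := by
  rw [intC]
  have h2 : (2 * Real.pi * Complex.I * h : ℂ) ≠ 0 := by
    have : (h : ℂ) ≠ 0 := by exact_mod_cast hh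
    exact mul_ne_zero Complex.two_pi_I_ne_zero this
  have : ∀ t : ℝ, fourier h (t : AddCircle (1 : ℝ)) = Complex.exp ((2 * Real.pi * Complex.I * h) * t) := by
    intro t
    rw [fourier_coe_apply]
    congr 1
    push_cast
    ring
  simp only [this]
  rw [integral_exp_mul_complex h2]
  have e : Complex.exp (2 * Real.pi * Complex.I * h * ((1 : ℝ) : ℂ)) = 1 := by
    rw [Complex.exp_eq_one_iff]
    exact ⟨h, by push_cast; ring⟩
  rw [e]; simp

lemma weyl_cont {ι : Type} (F : ℝ → Finset ι) (y : ι → ℝ) (hF : ∀ᶠ x in atTop, (F x).card ≠ 0)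
    (hy : ∀ h : ℤ, h ≠ 0 → Tendsto (fun x => avgC (F x) y (fourier h)) atTop (𝓝 0)) (g : C(AddCircle (1 : ℝ), ℂ)) :
    Tendsto (fun x => avgC (F x) y g) atTop (𝓝 (intC g)) := by
  haveI := unit_circle_fact
  have hspan : ∀ p ∈ Submodule.span ℂ (Set.range (fourier (T := (1 : ℝ)))), Tendsto (fun x => avgC (F x) y p) atTop (𝓝 (intC p)) := by
    intro p hp
    induction hp using Submodule.span_induction with
    | mem p hp =>
      obtain ⟨h, rfl⟩ := hp
      by_cases hh : h = 0
      · subst hh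
        have h1 : intC (fourier 0) = 1 := by simp [intC]
        rw [h1]
        refine tendsto_const_nhds.congr' ?_
        filter_upwards [hF] with x hx
        have : ((F x).card : ℂ) ≠ 0 := by exact_mod_cast hx
        simp [avgC, div_self this]
      · rw [intC_fourier h hh]; exact hy h hh
    | zero => simp [avgC, intC]
    | add p q _ _ hp hq =>
      have e1 : intC (p + q) = intC p + intC q := by
        simp only [intC, ContinuousMap.add_apply]
        rw [intervalIntegral.integral_add ((contC p).intervalIntegrable _ _) ((contC q).intervalIntegrable _ _)]
      rw [e1]
      refine (hp.add hq).congr fun x => ?_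
      simp only [avgC, ContinuousMap.add_apply, Finset.sum_add_distrib, add_div]
    | smul c p _ hp =>
      have e1 : intC (c • p) = c * intC p := by
        simp only [intC, ContinuousMap.smul_apply, smul_eq_mul]
        rw [intervalIntegral.integral_const_mul]
      rw [e1]
      refine (hp.const_mul c).congr fun x => ?_
      simp only [avgC, ContinuousMap.smul_apply, smul_eq_mul, ← Finset.mul_sum, mul_div_assoc]
  rw [Metric.tendsto_atTop]
  intro ε hε
  have hg : g ∈ (Submodule.span ℂ (Set.range (fourier (T := (1 : ℝ))))).topologicalClosure := by
    rw [span_fourier_closure_eq_top]; trivial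
  obtain ⟨p, hp, hgp⟩ := Metric.mem_closure_iff.mp hg (ε / 3) (by positivity)
  obtain ⟨x0, hx0⟩ := (Metric.tendsto_atTop.mp (hspan p hp)) (ε / 3) (by positivity)
  refine ⟨x0, fun x hx => ?_⟩
  have h1 := hx0 x hx
  rw [dist_eq_norm] at h1 hgp ⊢
  have h2 := avgC_norm (F x) y (g - p)
  have h3 := intC_norm (g - p)
  rw [← avgC_sub] at h2
  rw [← intC_sub] at h3
  have : avgC (F x) y g - intC g = (avgC (F x) y g - avgC (F x) y p) + (avgC (F x) y p - intC p) - (intC g - intC p) := by ring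
  rw [this]
  have h4 := norm_sub_le ((avgC (F x) y g - avgC (F x) y p) + (avgC (F x) y p - intC p)) (intC g - intC p)
  have h5 := norm_add_le (avgC (F x) y g - avgC (F x) y p) (avgC (F x) y p - intC p)
  linarith

noncomputable def trap (u v δ t : ℝ) : ℝ := max 0 (min 1 (min ((t - u) / δ) ((v - t) / δ)))

lemma trap_cont (u v δ : ℝ) : Continuous (trap u v δ) := by unfold trap; fun_prop

open scoped Classical in
lemma weyl_lower {ι : Type} (F : ℝ → Finset ι) (y : ι → ℝ) (hy01 : ∀ x, ∀ i ∈ F x, 0 ≤ y i ∧ y i < 1) (hF : ∀ᶠ x in atTop, (F x).card ≠ 0)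
    (hy : ∀ h : ℤ, h ≠ 0 → Tendsto (fun x => avgC (F x) y (fourier h)) atTop (𝓝 0))
    (u v : ℝ) (hu : 0 ≤ u) (hv : v ≤ 1) (ε : ℝ) (hε : 0 < ε) :
    ∀ᶠ x in atTop, v - u - ε ≤ (((F x).filter fun i => u ≤ y i ∧ y i < v).card : ℝ) / (F x).card := by
  haveI := unit_circle_fact
  by_cases hbig : v - u ≤ ε
  · refine Eventually.of_forall fun x => ?_
    have : (0 : ℝ) ≤ (((F x).filter fun i => u ≤ y i ∧ y i < v).card : ℝ) / (F x).card := by positivity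
    linarith
  push Not at hbig
  set δ := ε / 4 with hδ
  have hδ0 : 0 < δ := by positivity
  have t0 : ∀ t, 0 ≤ trap u v δ t := fun t => le_max_left _ _
  have t1 : ∀ t, trap u v δ t ≤ 1 := fun t => max_le zero_le_one (min_le_left _ _)
  have tu : ∀ t, t ≤ u → trap u v δ t = 0 := fun t ht => by
    refine max_eq_left ((min_le_right _ _).trans ((min_le_left _ _).trans ?_))
    exact div_nonpos_of_nonpos_of_nonneg (by linarith) hδ0.le
  have tv : ∀ t, v ≤ t → trap u v δ t = 0 := fun t ht => by
    refine max_eq_left ((min_le_right _ _).trans ((min_le_right _ _).trans ?_))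
    exact div_nonpos_of_nonpos_of_nonneg (by linarith) hδ0.le
  have tm : ∀ t, u + δ ≤ t → t ≤ v - δ → trap u v δ t = 1 := fun t h1 h2 => by
    have e1 : 1 ≤ (t - u) / δ := by rw [le_div_iff₀ hδ0]; linarith
    have e2 : 1 ≤ (v - t) / δ := by rw [le_div_iff₀ hδ0]; linarith
    rw [trap, min_eq_left (le_min e1 e2), max_eq_right zero_le_one]
  let G : C(AddCircle (1 : ℝ), ℂ) := ⟨AddCircle.liftIco 1 0 (fun t => (trap u v δ t : ℂ)), by
    refine AddCircle.liftIco_zero_continuous ?_ ?_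
    · rw [tu 0 hu, tv 1 hv]
    · exact (Complex.continuous_ofReal.comp (trap_cont u v δ)).continuousOn⟩
  have hG : ∀ t : ℝ, 0 ≤ t → t < 1 → G (t : AddCircle (1 : ℝ)) = (trap u v δ t : ℂ) := by
    intro t h1 h2
    exact AddCircle.liftIco_coe_apply (p := (1 : ℝ)) (a := 0) (f := fun t => (trap u v δ t : ℂ)) ⟨h1, by linarith⟩
  have hI : intC G = ((∫ t in (0 : ℝ)..1, trap u v δ t : ℝ) : ℂ) := by
    rw [intC, ← intervalIntegral.integral_ofReal]
    rw [intervalIntegral.integral_of_le zero_le_one, intervalIntegral.integral_of_le zero_le_one,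
      MeasureTheory.integral_Ioc_eq_integral_Ioo, MeasureTheory.integral_Ioc_eq_integral_Ioo]
    exact MeasureTheory.setIntegral_congr_fun measurableSet_Ioo fun t ht => hG t ht.1.le ht.2
  have hA : ∀ x, avgC (F x) y G = (((∑ i ∈ F x, trap u v δ (y i)) / (F x).card : ℝ) : ℂ) := by
    intro x
    rw [avgC]
    push_cast
    rw [Finset.sum_congr rfl fun i hi => hG (y i) (hy01 x i hi).1 (hy01 x i hi).2]
  have hint : v - u - 2 * δ ≤ ∫ t in (0 : ℝ)..1, trap u v δ t := by
    have hii : ∀ a b : ℝ, IntervalIntegrable (trap u v δ) MeasureTheory.volume a b := fun a b => (trap_cont u v δ).intervalIntegrable a b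
    have hle : u + δ ≤ v - δ := by linarith
    have e1 : ∫ t in (u + δ)..(v - δ), trap u v δ t = v - u - 2 * δ := by
      rw [intervalIntegral.integral_congr (g := fun _ => (1 : ℝ))]
      · simp; ring
      · intro t ht
        rw [Set.uIcc_of_le hle] at ht
        exact tm t ht.1 ht.2
    rw [← e1]
    exact intervalIntegral.integral_mono_interval (by linarith) hle (by linarith) (Eventually.of_forall t0) (hii 0 1)
  have hT := weyl_cont F y hF hy G
  rw [hI] at hT
  simp only [hA] at hT
  have hT' := (Complex.continuous_re.tendsto _).comp hT
  simp only [Function.comp_def, Complex.ofReal_re] at hT'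
  filter_upwards [hT'.eventually (lt_mem_nhds (show (∫ t in (0 : ℝ)..1, trap u v δ t) - δ < _ by linarith))] with x hx
  refine le_trans (by linarith) (hx.le.trans ?_)
  gcongr
  rw [Finset.card_filter]
  push_cast
  refine Finset.sum_le_sum fun i _ => ?_
  split_ifs with hc
  · exact t1 _
  · by_cases h1 : u ≤ y i
    · exact (tv _ (not_lt.mp fun h2 => hc ⟨h1, h2⟩)).le
    · exact (tu _ (not_le.mp h1).le).le

open scoped Classical in
lemma weyl {ι : Type} (F : ℝ → Finset ι) (y : ι → ℝ) (hy01 : ∀ x, ∀ i ∈ F x, 0 ≤ y i ∧ y i < 1) (hF : ∀ᶠ x in atTop, (F x).card ≠ 0)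
    (hy : ∀ h : ℤ, h ≠ 0 → Tendsto (fun x => avgC (F x) y (fourier h)) atTop (𝓝 0))
    (u v : ℝ) (hu : 0 ≤ u) (huv : u < v) (hv : v ≤ 1) :
    Tendsto (fun x => (((F x).filter fun i => u ≤ y i ∧ y i < v).card : ℝ) / (F x).card) atTop (𝓝 (v - u)) := by
  rw [Metric.tendsto_nhds]
  intro ε hε
  filter_upwards [hF, weyl_lower F y hy01 hF hy u v hu hv (ε / 4) (by positivity),
    weyl_lower F y hy01 hF hy 0 u le_rfl (by linarith) (ε / 4) (by positivity),
    weyl_lower F y hy01 hF hy v 1 (by linarith) le_rfl (ε / 4) (by positivity)] with x hx h1 h2 h3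
  have hsum : ((F x).filter fun i => u ≤ y i ∧ y i < v).card + ((F x).filter fun i => 0 ≤ y i ∧ y i < u).card +
      ((F x).filter fun i => v ≤ y i ∧ y i < 1).card = (F x).card := by
    rw [Finset.card_filter, Finset.card_filter, Finset.card_filter, ← Finset.sum_add_distrib, ← Finset.sum_add_distrib,
      Finset.card_eq_sum_ones]
    refine Finset.sum_congr rfl fun i hi => ?_
    obtain ⟨k1, k2⟩ := hy01 x i hi
    rcases lt_or_ge (y i) u with k3 | k3
    · rw [if_neg (by intro h; linarith [h.1]), if_pos ⟨k1, k3⟩, if_neg (by intro h; linarith [h.1])]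
    · rcases lt_or_ge (y i) v with k4 | k4
      · rw [if_pos ⟨k3, k4⟩, if_neg (by intro h; linarith [h.2]), if_neg (by intro h; linarith [h.1])]
      · rw [if_neg (by intro h; linarith [h.2]), if_neg (by intro h; linarith [h.2]), if_pos ⟨k4, k2⟩]
  have hc : (0 : ℝ) < (F x).card := by exact_mod_cast Nat.pos_of_ne_zero hx
  have hsum' : (((F x).filter fun i => u ≤ y i ∧ y i < v).card : ℝ) / (F x).card + (((F x).filter fun i => 0 ≤ y i ∧ y i < u).card : ℝ) / (F x).card +
      (((F x).filter fun i => v ≤ y i ∧ y i < 1).card : ℝ) / (F x).card = 1 := by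
    rw [← add_div, ← add_div, div_eq_one_iff_eq hc.ne']
    exact_mod_cast hsum
  rw [Real.dist_eq, abs_lt]
  constructor <;> linarith

end KK

open scoped Classical

theorem statement2 (L : Type) [Field L] [NumberField L] (η : ℕ) (hη : 0 < η)
    (α : ↥(Rring L η)) (hα : ∀ q : ℚ, (α : L) ≠ q)
    (res : Ideal ↥(Rring L η) → ℕ)
    (hres : ∀ 𝔞 : Ideal ↥(Rring L η), DegOne 𝔞 →
      res 𝔞 < idealNorm 𝔞 ∧ α - ((res 𝔞 : ℕ) : ↥(Rring L η)) ∈ 𝔞)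
    (u v : ℝ) (hu : 0 ≤ u) (huv : u < v) (hv : v ≤ 1) :
    Filter.Tendsto (fun x : ℝ =>
      (Nat.card {𝔞 : Ideal ↥(Rring L η) | DegOne 𝔞 ∧ (idealNorm 𝔞 : ℝ) ≤ x ∧
          u ≤ (res 𝔞 : ℝ) / (idealNorm 𝔞 : ℝ) ∧ (res 𝔞 : ℝ) / (idealNorm 𝔞 : ℝ) < v} : ℝ) /
      (Nat.card {𝔞 : Ideal ↥(Rring L η) | DegOne 𝔞 ∧ (idealNorm 𝔞 : ℝ) ≤ x} : ℝ))
      Filter.atTop (nhds (v - u)) := by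
  have hw := weyl (fun x => (SS_finite (L := L) hη x).toFinset) (fun 𝔞 => (res 𝔞 : ℝ) / (idealNorm 𝔞 : ℝ)) ?_ ?_ ?_ u v hu huv hv
  · refine hw.congr fun x => ?_
    congr 2
    · symm
      refine Nat.subtype_card _ fun I => ?_
      rw [Finset.mem_filter, Set.Finite.mem_toFinset]
      exact ⟨fun h => ⟨h.1.1, h.1.2, h.2⟩, fun h => ⟨⟨h.1, h.2.1⟩, h.2.2⟩⟩
    · symm
      refine Nat.subtype_card _ fun I => ?_
      rw [Set.Finite.mem_toFinset]
      rfl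
  · intro x I hI
    rw [Set.Finite.mem_toFinset] at hI
    have h1 := (hres I hI.1).1
    have h2 : (0 : ℝ) < idealNorm I := by exact_mod_cast Nat.pos_of_ne_zero (degOne_finite hη hI.1)
    refine ⟨by positivity, ?_⟩
    rw [div_lt_one h2]
    exact_mod_cast h1
  · obtain ⟨c, hc, x0, h⟩ := SS_lower (L := L) hη
    filter_upwards [eventually_ge_atTop x0, eventually_gt_atTop 0] with x hx hx0
    have h1 := h x hx
    rw [Set.ncard_eq_toFinset_card _ (SS_finite hη x)] at h1
    have : 0 < ((SS_finite (L := L) hη x).toFinset.card : ℝ) := lt_of_lt_of_le (by positivity) h1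
    exact_mod_cast this.ne'
  · intro h hh
    refine (avg_zero hη α hα res hres h hh).congr fun x => ?_
    rw [avgC]
    congr 1
    refine Finset.sum_congr rfl fun I _ => ?_
    rw [fourier_coe_apply, eZ]
    congr 1
    push_cast
    ring
end
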